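/- arXiv:2111.07111 — 4 statements merged into one kernel-verified Lean document; each statement's English description precedes it below -/
import Mathlib

section
/- Let Φ ≥ 0, α ≥ 0, let n be an integer, let f be an admissible right-hand side, and let ψ be a smooth solution of the n-th mode problem with Navier boundary conditions. Then the following two energy identities hold: (i) n·∫₀¹ (Ū(r)/r)·|(d/dr)(r·ψ(r))|² dr + n³·∫₀¹ Ū(r)·|ψ(r)|²·r dr = −Im ∫₀¹ f(r)·conj(ψ(r))·r dr; (ii) ∫₀¹ |(𝓛ψ)(r)|²·r dr + 2·n²·∫₀¹ |(d/dr)(r·ψ(r))|²·(1/r) dr + n⁴·∫₀¹ |ψ(r)|²·r dr + α·|ψ'(1)|² = −Re ∫₀¹ f(r)·conj(ψ(r))·r dr − (4Φ/π)·(α/(α+4))·n·Im ∫₀¹ (d/dr)(r·ψ(r))·r·conj(ψ(r)) dr. (Identities (2-1-5) and (2-1-7) from the proof of Proposition 3.1.) -/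
open MeasureTheory Filter

/-- One-sided derivative on `(0,1]`. -/
noncomputable def dz (g : ℝ → ℂ) : ℝ → ℂ := derivWithin g (Set.Ioc 0 1)

/-- The operator `(𝓛 g)(r) = g''(r) + (1/r) g'(r) − (1/r²) g(r)`. -/
noncomputable def Lop (g : ℝ → ℂ) : ℝ → ℂ := fun r =>
  dz (dz g) r + ((r : ℂ))⁻¹ * dz g r - (((r : ℂ)) ^ 2)⁻¹ * g r

/-- Weighted integral over `(0,1)` with values in `[0,∞]`. -/
noncomputable def wInt (h : ℝ → ℝ) : ENNReal :=
  ∫⁻ r in Set.Ioo (0 : ℝ) 1, ENNReal.ofReal (h r)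

/-- The Poiseuille profile `Ū(r) = ((4+2α)/(4+α)) (1 − (2α/(4+2α)) r²) (Φ/π)`. -/
noncomputable def Ubar (Φ α : ℝ) : ℝ → ℝ := fun r =>
  (4 + 2 * α) / (4 + α) * (1 - 2 * α / (4 + 2 * α) * r ^ 2) * (Φ / Real.pi)

/-- A smooth solution of the `n`-th mode problem with Navier boundary conditions:
`ψ` is four times continuously differentiable on `(0,1]`; `ψ`, `ψ'`, `𝓛ψ` and
`(d/dr)(r 𝓛ψ)` extend continuously to `[0,1]`;
`i n Ū (𝓛−n²)ψ − (𝓛−n²)²ψ = f` on `(0,1)`; `ψ(0) = ψ(1) = (𝓛ψ)(0) = 0` and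
`(𝓛ψ)(1) = −α ψ'(1)`; and the relevant weighted integrals are finite. -/
structure NavierSol (Φ α : ℝ) (n : ℤ) (f ψ : ℝ → ℂ) : Prop where
  smooth : ContDiffOn ℝ 4 ψ (Set.Ioc 0 1)
  /-- `ψ` extends continuously to `[0,1]` with `ψ(0) = 0`. -/
  ext_psi : Filter.Tendsto ψ (nhdsWithin (0 : ℝ) (Set.Ioc 0 1)) (nhds (0 : ℂ))
  /-- `ψ'` extends continuously to `[0,1]`. -/
  ext_dpsi : ∃ L : ℂ, Filter.Tendsto (dz ψ) (nhdsWithin (0 : ℝ) (Set.Ioc 0 1)) (nhds L)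
  /-- `𝓛ψ` extends continuously to `[0,1]` with `(𝓛ψ)(0) = 0`. -/
  ext_Lpsi : Filter.Tendsto (Lop ψ) (nhdsWithin (0 : ℝ) (Set.Ioc 0 1)) (nhds (0 : ℂ))
  /-- `(d/dr)(r 𝓛ψ)` extends continuously to `[0,1]`. -/
  ext_dLpsi : ∃ L : ℂ, Filter.Tendsto (dz (fun r => (r : ℂ) * Lop ψ r))
    (nhdsWithin (0 : ℝ) (Set.Ioc 0 1)) (nhds L)
  bc_psi : ψ 1 = 0
  bc_navier : Lop ψ 1 = -(α : ℂ) * dz ψ 1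
  eqn : ∀ r ∈ Set.Ioo (0 : ℝ) 1,
    Complex.I * (n : ℂ) * (Ubar Φ α r : ℂ) * (Lop ψ r - (n : ℂ) ^ 2 * ψ r)
      - (Lop (fun s => Lop ψ s - (n : ℂ) ^ 2 * ψ s) r
          - (n : ℂ) ^ 2 * (Lop ψ r - (n : ℂ) ^ 2 * ψ r)) = f r
  fin_psi : wInt (fun r => ‖ψ r‖ ^ 2 * r) < ⊤
  fin_dpsi : wInt (fun r => ‖dz (fun s => (s : ℂ) * ψ s) r‖ ^ 2 / r) < ⊤
  fin_Lpsi : wInt (fun r => ‖Lop ψ r‖ ^ 2 * r) < ⊤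
  fin_dLpsi : wInt (fun r => ‖dz (fun s => (s : ℂ) * Lop ψ s) r‖ ^ 2 / r) < ⊤
  fin_LLpsi : wInt (fun r => ‖Lop (Lop ψ) r‖ ^ 2 * r) < ⊤

lemma aux_hasDerivAt {g : ℝ → ℂ} (hg : DifferentiableOn ℝ g (Set.Ioc 0 1)) {r : ℝ}
    (hr : r ∈ Set.Ioo (0 : ℝ) 1) : HasDerivAt g (dz g r) r :=
  (hg r ⟨hr.1, hr.2.le⟩).hasDerivWithinAt.hasDerivAt (Ioc_mem_nhds hr.1 hr.2)

lemma aux_contDiffOn_dz {g : ℝ → ℂ} {m n : ℕ} (hg : ContDiffOn ℝ n g (Set.Ioc 0 1))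
    (hmn : m + 1 ≤ n) : ContDiffOn ℝ m (dz g) (Set.Ioc 0 1) :=
  hg.derivWithin (uniqueDiffOn_Ioc 0 1) (by exact_mod_cast hmn)

lemma aux_contDiffOn_Lop {g : ℝ → ℂ} {m n : ℕ} (hg : ContDiffOn ℝ n g (Set.Ioc 0 1))
    (hmn : m + 2 ≤ n) : ContDiffOn ℝ m (Lop g) (Set.Ioc 0 1) := by
  have h1 : ContDiffOn ℝ ((m + 1 : ℕ)) (dz g) (Set.Ioc 0 1) := aux_contDiffOn_dz hg (by omega)
  have h2 : ContDiffOn ℝ m (dz (dz g)) (Set.Ioc 0 1) := aux_contDiffOn_dz h1 (by omega)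
  have h1' : ContDiffOn ℝ m (dz g) (Set.Ioc 0 1) := h1.of_le (by exact_mod_cast (by omega))
  have h0' : ContDiffOn ℝ m g (Set.Ioc 0 1) := hg.of_le (by exact_mod_cast (by omega))
  have hid : ContDiffOn ℝ m (fun r : ℝ => (r : ℂ)) (Set.Ioc 0 1) :=
    Complex.ofRealCLM.contDiff.contDiffOn
  have hne : ∀ r ∈ Set.Ioc (0 : ℝ) 1, (r : ℂ) ≠ 0 := fun r hr => by
    exact_mod_cast hr.1.ne'
  exact (h2.add ((hid.inv hne).mul h1')).sub
    (((hid.pow 2).inv (fun r hr => pow_ne_zero 2 (hne r hr))).mul h0')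

lemma aux_dz_mul {g : ℝ → ℂ} (hg : DifferentiableOn ℝ g (Set.Ioc 0 1)) {r : ℝ}
    (hr : r ∈ Set.Ioc (0 : ℝ) 1) :
    dz (fun s => (s : ℂ) * g s) r = g r + r * dz g r := by
  have h1 : HasDerivWithinAt (fun s : ℝ => (s : ℂ)) 1 (Set.Ioc 0 1) r :=
    Complex.ofRealCLM.hasDerivAt.hasDerivWithinAt
  have := (h1.mul (hg r hr).hasDerivWithinAt).derivWithin (uniqueDiffOn_Ioc 0 1 r hr)
  simp only [one_mul] at this
  exact this

lemma aux_dz_sub {g h : ℝ → ℂ} (hg : DifferentiableOn ℝ g (Set.Ioc 0 1))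
    (hh : DifferentiableOn ℝ h (Set.Ioc 0 1)) (c : ℂ) {r : ℝ}
    (hr : r ∈ Set.Ioc (0 : ℝ) 1) :
    dz (fun s => g s - c * h s) r = dz g r - c * dz h r :=
  ((hg r hr).hasDerivWithinAt.sub ((hh r hr).hasDerivWithinAt.const_mul c)).derivWithin
    (uniqueDiffOn_Ioc 0 1 r hr)

lemma aux_Lop_sub {g h : ℝ → ℂ} (hg : ContDiffOn ℝ (2 : ℕ) g (Set.Ioc 0 1))
    (hh : ContDiffOn ℝ (2 : ℕ) h (Set.Ioc 0 1)) (c : ℂ) {r : ℝ}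
    (hr : r ∈ Set.Ioc (0 : ℝ) 1) :
    Lop (fun s => g s - c * h s) r = Lop g r - c * Lop h r := by
  have hg0 := hg.differentiableOn (by norm_num)
  have hh0 := hh.differentiableOn (by norm_num)
  have hg1 := (aux_contDiffOn_dz (m := 1) hg le_rfl).differentiableOn (by norm_num)
  have hh1 := (aux_contDiffOn_dz (m := 1) hh le_rfl).differentiableOn (by norm_num)
  have e1 : Set.EqOn (dz (fun s => g s - c * h s)) (fun s => dz g s - c * dz h s) (Set.Ioc 0 1) :=
    fun s hs => aux_dz_sub hg0 hh0 c hs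
  have e2 : dz (dz (fun s => g s - c * h s)) r = dz (dz g) r - c * dz (dz h) r := by
    rw [← aux_dz_sub hg1 hh1 c hr]
    exact derivWithin_congr e1 (e1 hr)
  simp only [Lop, e2, e1 hr]
  ring

lemma aux_integrable {h : ℝ → ℝ} (hc : ContinuousOn h (Set.Ioo 0 1))
    (h0 : ∀ r ∈ Set.Ioo (0 : ℝ) 1, 0 ≤ h r) (hf : wInt h < ⊤) :
    IntegrableOn h (Set.Ioo 0 1) := by
  refine ⟨hc.aestronglyMeasurable measurableSet_Ioo, ?_⟩
  rw [hasFiniteIntegral_iff_ofReal]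
  · exact hf
  · exact (ae_restrict_iff' measurableSet_Ioo).2 (Eventually.of_forall h0)

lemma aux_ftc {B B' : ℝ → ℂ} {a b : ℂ}
    (hd : ∀ r ∈ Set.Ioo (0 : ℝ) 1, HasDerivAt B (B' r) r)
    (hi : IntegrableOn B' (Set.Ioo 0 1))
    (ha : Tendsto B (nhdsWithin 0 (Set.Ioi 0)) (nhds a))
    (hb : Tendsto B (nhdsWithin 1 (Set.Iio 1)) (nhds b)) :
    ∫ r in Set.Ioo (0 : ℝ) 1, B' r = b - a := by
  rw [← intervalIntegral.integral_eq_sub_of_hasDerivAt_of_tendsto one_pos hd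
    ((intervalIntegrable_iff_integrableOn_Ioo_of_le zero_le_one).2 hi) ha hb,
    intervalIntegral.integral_of_le zero_le_one, integral_Ioc_eq_integral_Ioo]

lemma aux_tendsto_one {g : ℝ → ℂ} (hg : ContinuousOn g (Set.Ioc 0 1)) :
    Tendsto g (nhdsWithin 1 (Set.Iio 1)) (nhds (g 1)) := by
  have h := (hg 1 ⟨one_pos, le_rfl⟩).tendsto
  refine h.mono_left ?_
  rw [← nhdsWithin_Ioo_eq_nhdsLT (zero_lt_one' ℝ)]
  exact nhdsWithin_mono _ Set.Ioo_subset_Ioc_self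

/-- Identities (2-1-5) and (2-1-7) from the proof of Proposition 3.1: the two basic
energy identities for a smooth solution of the `n`-th mode problem with Navier
boundary conditions. -/
theorem energy_identities (Φ α : ℝ) (n : ℤ) (f ψ : ℝ → ℂ)
    (hΦ : 0 ≤ Φ) (hα : 0 ≤ α)
    (hf_cont : ContinuousOn f (Set.Ioo 0 1))
    (hf_fin : wInt (fun r => ‖f r‖ ^ 2 * r) < ⊤)
    (hsol : NavierSol Φ α n f ψ) :
    ((n : ℝ) * ∫ r in Set.Ioo (0 : ℝ) 1,
        (Ubar Φ α r / r) * ‖dz (fun s => (s : ℂ) * ψ s) r‖ ^ 2)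
      + (n : ℝ) ^ 3 * ∫ r in Set.Ioo (0 : ℝ) 1, Ubar Φ α r * ‖ψ r‖ ^ 2 * r
      = -(∫ r in Set.Ioo (0 : ℝ) 1,
            f r * (starRingEnd ℂ) (ψ r) * (r : ℂ)).im ∧
    (∫ r in Set.Ioo (0 : ℝ) 1, ‖Lop ψ r‖ ^ 2 * r)
      + 2 * (n : ℝ) ^ 2 * (∫ r in Set.Ioo (0 : ℝ) 1,
          ‖dz (fun s => (s : ℂ) * ψ s) r‖ ^ 2 / r)
      + (n : ℝ) ^ 4 * (∫ r in Set.Ioo (0 : ℝ) 1, ‖ψ r‖ ^ 2 * r)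
      + α * ‖dz ψ 1‖ ^ 2
      = -(∫ r in Set.Ioo (0 : ℝ) 1, f r * (starRingEnd ℂ) (ψ r) * (r : ℂ)).re
        - (4 * Φ / Real.pi) * (α / (α + 4)) * (n : ℝ)
            * (∫ r in Set.Ioo (0 : ℝ) 1,
                dz (fun s => (s : ℂ) * ψ s) r * (r : ℂ) * (starRingEnd ℂ) (ψ r)).im := by
  have hne : ∀ r ∈ Set.Ioo (0 : ℝ) 1, (r : ℂ) ≠ 0 := fun r hr => by
    exact_mod_cast hr.1.ne'
  have hsub : Set.Ioo (0 : ℝ) 1 ⊆ Set.Ioc 0 1 := Set.Ioo_subset_Ioc_self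
  have c4 : ContDiffOn ℝ (4 : ℕ) ψ (Set.Ioc 0 1) := hsol.smooth
  have c2 : ContDiffOn ℝ (2 : ℕ) ψ (Set.Ioc 0 1) := c4.of_le (by norm_num)
  have cp : ContDiffOn ℝ (3 : ℕ) (dz ψ) (Set.Ioc 0 1) := aux_contDiffOn_dz c4 (by norm_num)
  have cl : ContDiffOn ℝ (2 : ℕ) (Lop ψ) (Set.Ioc 0 1) := aux_contDiffOn_Lop c4 (by norm_num)
  have cm : ContDiffOn ℝ (1 : ℕ) (dz (Lop ψ)) (Set.Ioc 0 1) := aux_contDiffOn_dz cl (by norm_num)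
  have dψ := c4.differentiableOn (by norm_num)
  have dp := cp.differentiableOn (by norm_num)
  have dl := cl.differentiableOn (by norm_num)
  have dm := cm.differentiableOn (by norm_num)
  have hw : ∀ r ∈ Set.Ioc (0 : ℝ) 1, dz (fun s => (s : ℂ) * ψ s) r = ψ r + r * dz ψ r :=
    fun r hr => aux_dz_mul dψ hr
  have hv : ∀ r ∈ Set.Ioc (0 : ℝ) 1,
      dz (fun s => (s : ℂ) * Lop ψ s) r = Lop ψ r + r * dz (Lop ψ) r :=
    fun r hr => aux_dz_mul dl hr
  have cof : Continuous (fun r : ℝ => (r : ℂ)) := Complex.continuous_ofReal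
  have cw : ContinuousOn (dz (fun s => (s : ℂ) * ψ s)) (Set.Ioc 0 1) :=
    (c4.continuousOn.add (cof.continuousOn.mul cp.continuousOn)).congr hw
  have cψ' := c4.continuousOn.mono hsub
  have cw' := cw.mono hsub
  have cl' := cl.continuousOn.mono hsub
  -- abbreviations
  set w := dz (fun s => (s : ℂ) * ψ s) with hwdef
  set v := dz (fun s => (s : ℂ) * Lop ψ s) with hvdef
  set p := dz ψ with hpdef
  set l := Lop ψ with hldef
  have hPi : (Real.pi : ℝ) ≠ 0 := Real.pi_ne_zero
  have h4 : (4 + α) ≠ 0 := by positivity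
  have h42 : (4 + 2 * α) ≠ 0 := by positivity
  set c : ℝ := (4 * Φ / Real.pi) * (α / (α + 4)) with hc
  have hUd : ∀ r : ℝ, HasDerivAt (fun s => (Ubar Φ α s : ℂ)) ((-(c * r) : ℝ) : ℂ) r := by
    intro r
    have h1 : HasDerivAt (Ubar Φ α) (-(c * r)) r := by
      have := ((((hasDerivAt_pow 2 r).const_mul (2 * α / (4 + 2 * α))).const_sub 1).const_mul
        ((4 + 2 * α) / (4 + α))).mul_const (Φ / Real.pi)
      refine this.congr_deriv ?_
      rw [hc, add_comm α 4]
      push_cast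
      field_simp
      ring
    exact h1.ofReal_comp
  have cU : Continuous (Ubar Φ α) := by unfold Ubar; fun_prop
  -- integrability
  have i1 : IntegrableOn (fun r => ‖ψ r‖ ^ 2 * r) (Set.Ioo 0 1) :=
    aux_integrable ((cψ'.norm.pow 2).mul continuousOn_id)
      (fun r hr => mul_nonneg (sq_nonneg _) hr.1.le) hsol.fin_psi
  have i2 : IntegrableOn (fun r => ‖w r‖ ^ 2 / r) (Set.Ioo 0 1) :=
    aux_integrable ((cw'.norm.pow 2).div continuousOn_id (fun r hr => hr.1.ne'))
      (fun r hr => div_nonneg (sq_nonneg _) hr.1.le) hsol.fin_dpsi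
  have i3 : IntegrableOn (fun r => ‖l r‖ ^ 2 * r) (Set.Ioo 0 1) :=
    aux_integrable ((cl'.norm.pow 2).mul continuousOn_id)
      (fun r hr => mul_nonneg (sq_nonneg _) hr.1.le) hsol.fin_Lpsi
  have i4 : IntegrableOn (fun r => ‖f r‖ ^ 2 * r) (Set.Ioo 0 1) :=
    aux_integrable ((hf_cont.norm.pow 2).mul continuousOn_id)
      (fun r hr => mul_nonneg (sq_nonneg _) hr.1.le) hf_fin
  have hUb : ∃ M, ∀ r ∈ Set.Ioo (0 : ℝ) 1, ‖Ubar Φ α r‖ ≤ M := by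
    obtain ⟨M, hM⟩ := (isCompact_Icc (a := (0 : ℝ)) (b := 1)).exists_bound_of_continuousOn
      cU.continuousOn
    exact ⟨M, fun r hr => hM r (Set.Ioo_subset_Icc_self hr)⟩
  obtain ⟨M, hM⟩ := hUb
  have hMae : ∀ᵐ r ∂(volume.restrict (Set.Ioo (0 : ℝ) 1)), ‖Ubar Φ α r‖ ≤ M :=
    (ae_restrict_iff' measurableSet_Ioo).2 (Eventually.of_forall hM)
  have i5 : IntegrableOn (fun r => (Ubar Φ α r / r) * ‖w r‖ ^ 2) (Set.Ioo 0 1) := by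
    have := Integrable.bdd_mul i2 cU.aestronglyMeasurable hMae
    refine this.congr (Eventually.of_forall fun r => ?_)
    simp only []
    ring
  have i6 : IntegrableOn (fun r => Ubar Φ α r * ‖ψ r‖ ^ 2 * r) (Set.Ioo 0 1) := by
    have := Integrable.bdd_mul i1 cU.aestronglyMeasurable hMae
    refine this.congr (Eventually.of_forall fun r => ?_)
    simp only []
    ring
  have i7 : IntegrableOn (fun r => f r * (starRingEnd ℂ) (ψ r) * (r : ℂ)) (Set.Ioo 0 1) := by
    refine (i4.add i1).mono' ?_ ?_
    · exact ContinuousOn.aestronglyMeasurable ((hf_cont.mul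
        (Complex.continuous_conj.comp_continuousOn cψ')).mul cof.continuousOn) measurableSet_Ioo
    · refine (ae_restrict_iff' measurableSet_Ioo).2 (Eventually.of_forall fun r hr => ?_)
      have hr0 := hr.1
      simp only [norm_mul, RCLike.norm_conj, Complex.norm_real, Real.norm_eq_abs,
        abs_of_pos hr0, Pi.add_apply]
      rw [← add_mul]
      refine mul_le_mul_of_nonneg_right ?_ hr0.le
      nlinarith [sq_nonneg (‖f r‖ - ‖ψ r‖), sq_nonneg (‖f r‖), sq_nonneg ‖ψ r‖]
  have i8 : IntegrableOn (fun r => w r * (r : ℂ) * (starRingEnd ℂ) (ψ r)) (Set.Ioo 0 1) := by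
    refine (i2.add i1).mono' ?_ ?_
    · exact ContinuousOn.aestronglyMeasurable ((cw'.mul cof.continuousOn).mul
        (Complex.continuous_conj.comp_continuousOn cψ')) measurableSet_Ioo
    · refine (ae_restrict_iff' measurableSet_Ioo).2 (Eventually.of_forall fun r hr => ?_)
      have hr0 := hr.1
      simp only [norm_mul, RCLike.norm_conj, Complex.norm_real, Real.norm_eq_abs,
        abs_of_pos hr0, Pi.add_apply]
      have e : ‖w r‖ ^ 2 / r + ‖ψ r‖ ^ 2 * r = (‖w r‖ ^ 2 + ‖ψ r‖ ^ 2 * r ^ 2) / r := by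
        field_simp
      rw [e, le_div_iff₀ hr0]
      have h1 : r ≤ 1 := hr.2.le
      have h2 : ‖w r‖ * r * ‖ψ r‖ * r ≤ ‖w r‖ * r * ‖ψ r‖ * 1 :=
        mul_le_mul_of_nonneg_left h1 (by positivity)
      nlinarith [sq_nonneg (‖w r‖ - ‖ψ r‖ * r), sq_nonneg (‖w r‖), sq_nonneg (‖ψ r‖ * r)]
  -- limits
  have e0 : nhdsWithin (0 : ℝ) (Set.Ioc 0 1) = nhdsWithin 0 (Set.Ioi 0) :=
    nhdsWithin_Ioc_eq_nhdsGT one_pos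
  have t0 : Tendsto ψ (nhdsWithin 0 (Set.Ioi 0)) (nhds 0) := e0 ▸ hsol.ext_psi
  have tl : Tendsto l (nhdsWithin 0 (Set.Ioi 0)) (nhds 0) := e0 ▸ hsol.ext_Lpsi
  obtain ⟨P, hP⟩ := hsol.ext_dpsi
  obtain ⟨V, hV⟩ := hsol.ext_dLpsi
  rw [e0] at hP hV
  have tr : Tendsto (fun r : ℝ => (r : ℂ)) (nhdsWithin 0 (Set.Ioi 0)) (nhds 0) := by
    have := (cof.tendsto 0).mono_left (nhdsWithin_le_nhds (s := Set.Ioi (0 : ℝ)))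
    simpa using this
  have tw : Tendsto (fun r => ψ r + r * p r) (nhdsWithin 0 (Set.Ioi 0)) (nhds 0) := by
    simpa using t0.add (tr.mul hP)
  have tv : Tendsto (fun r => l r + r * dz l r) (nhdsWithin 0 (Set.Ioi 0)) (nhds V) := by
    refine hV.congr' ?_
    filter_upwards [Ioc_mem_nhdsGT (zero_lt_one' ℝ)] with r hr
    exact hv r hr
  have tU : Tendsto (fun r => (Ubar Φ α r : ℂ)) (nhdsWithin 0 (Set.Ioi 0))
      (nhds (Ubar Φ α 0 : ℂ)) :=
    ((cof.comp cU).tendsto 0).mono_left nhdsWithin_le_nhds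
  have tconj : ∀ {g : ℝ → ℂ} {a : ℂ}, Tendsto g (nhdsWithin 0 (Set.Ioi 0)) (nhds a) →
      Tendsto (fun r => (starRingEnd ℂ) (g r)) (nhdsWithin 0 (Set.Ioi 0))
        (nhds ((starRingEnd ℂ) a)) :=
    fun h => (Complex.continuous_conj.tendsto _).comp h
  have dconj : ∀ {g : ℝ → ℂ} {a : ℂ} {r : ℝ}, HasDerivAt g a r →
      HasDerivAt (fun s => (starRingEnd ℂ) (g s)) ((starRingEnd ℂ) a) r :=
    fun h => h.star
  have dof : ∀ r : ℝ, HasDerivAt (fun s : ℝ => (s : ℂ)) 1 r :=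
    fun r => Complex.ofRealCLM.hasDerivAt
  have nsq : ∀ z : ℂ, ((‖z‖ : ℂ)) ^ 2 = z * (starRingEnd ℂ) z := fun z => by
    rw [Complex.mul_conj, Complex.normSq_eq_norm_sq]; push_cast; rfl
  have cψ := c4.continuousOn
  have cpc := cp.continuousOn
  have clc := cl.continuousOn
  have cmc := cm.continuousOn
  have cUc : ContinuousOn (fun r => (Ubar Φ α r : ℂ)) (Set.Ioc 0 1) := (cof.comp cU).continuousOn
  have cofc : ContinuousOn (fun r : ℝ => (r : ℂ)) (Set.Ioc 0 1) := cof.continuousOn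
  have cconj : ∀ {g : ℝ → ℂ}, ContinuousOn g (Set.Ioc 0 1) →
      ContinuousOn (fun r => (starRingEnd ℂ) (g r)) (Set.Ioc 0 1) :=
    fun h => Complex.continuous_conj.comp_continuousOn h
  -- real part of the cross term vanishes
  set J := ∫ r in Set.Ioo (0 : ℝ) 1, w r * (r : ℂ) * (starRingEnd ℂ) (ψ r) with hJ
  have hJre : J.re = 0 := by
    have h := aux_ftc (B := fun r : ℝ => (r : ℂ) ^ 2 * (ψ r * (starRingEnd ℂ) (ψ r)))
      (B' := fun r => w r * (r : ℂ) * (starRingEnd ℂ) (ψ r)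
        + (starRingEnd ℂ) (w r * (r : ℂ) * (starRingEnd ℂ) (ψ r))) (a := 0) (b := 0)
      (by
        intro r hr
        have h1 := aux_hasDerivAt dψ hr
        refine (((dof r).pow 2).mul (h1.mul (dconj h1))).congr_deriv ?_
        rw [hw r (hsub hr)]
        simp only [map_mul, map_add, Complex.conj_conj, Complex.conj_ofReal]
        push_cast
        simp only [Pi.mul_apply, Pi.pow_apply]
        ring)
      (i8.add (by
        have := Complex.conjCLE.toContinuousLinearMap.integrable_comp i8
        exact this))
      (by simpa using (tr.pow 2).mul (t0.mul (tconj t0)))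
      (by
        have := aux_tendsto_one ((cofc.pow 2).mul (cψ.mul (cconj cψ)))
        simp only [Pi.mul_apply, hsol.bc_psi, map_zero, mul_zero] at this
        exact this)
    rw [integral_add i8 (by
        have := Complex.conjCLE.toContinuousLinearMap.integrable_comp i8
        exact this), integral_conj, ← hJ] at h
    have := congrArg Complex.re h
    simp at this
    linarith
  -- main identity
  let R1 : ℝ → ℝ := fun r => (n : ℝ) * ((Ubar Φ α r / r) * ‖w r‖ ^ 2)
    + (n : ℝ) ^ 3 * (Ubar Φ α r * ‖ψ r‖ ^ 2 * r)
  let R2 : ℝ → ℝ := fun r => ‖l r‖ ^ 2 * r + 2 * (n : ℝ) ^ 2 * (‖w r‖ ^ 2 / r)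
    + (n : ℝ) ^ 4 * (‖ψ r‖ ^ 2 * r)
  have iR1 : IntegrableOn R1 (Set.Ioo 0 1) := (i5.const_mul _).add (i6.const_mul _)
  have iR2 : IntegrableOn R2 (Set.Ioo 0 1) :=
    (i3.add (i2.const_mul _)).add (i1.const_mul _)
  have iG1 : IntegrableOn (fun r => Complex.I * (R1 r : ℂ)) (Set.Ioo 0 1) :=
    iR1.ofReal.const_mul _
  have iG2 : IntegrableOn (fun r => (R2 r : ℂ)) (Set.Ioo 0 1) := iR2.ofReal
  have iG3 : IntegrableOn (fun r => Complex.I * (n : ℂ) * (c : ℂ) *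
      (w r * (r : ℂ) * (starRingEnd ℂ) (ψ r))) (Set.Ioo 0 1) := i8.const_mul _
  have main := aux_ftc
    (B := fun r : ℝ => Complex.I * (n : ℂ) *
        ((Ubar Φ α r : ℂ) * ((ψ r + r * p r) * (starRingEnd ℂ) (ψ r)))
      - ((l r + r * dz l r) * (starRingEnd ℂ) (ψ r) - l r * (starRingEnd ℂ) (ψ r + r * p r))
      + 2 * (n : ℂ) ^ 2 * ((ψ r + r * p r) * (starRingEnd ℂ) (ψ r)))
    (B' := fun r => ((f r * (starRingEnd ℂ) (ψ r) * (r : ℂ) + Complex.I * (R1 r : ℂ))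
      + (R2 r : ℂ)) - Complex.I * (n : ℂ) * (c : ℂ) *
        (w r * (r : ℂ) * (starRingEnd ℂ) (ψ r)))
    (a := 0) (b := -(α * ‖p 1‖ ^ 2 : ℝ))
    (by
      intro r hr
      have hr' := hsub hr
      have h1 := aux_hasDerivAt dψ hr
      have h2 := aux_hasDerivAt dp hr
      have h3 := aux_hasDerivAt dl hr
      have h4 := aux_hasDerivAt dm hr
      have hW := h1.add ((dof r).mul h2)
      have hVd := h3.add ((dof r).mul h4)
      have hWψ := hW.mul (dconj h1)
      refine (((((hUd r).mul hWψ).const_mul (Complex.I * (n : ℂ))).sub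
        ((hVd.mul (dconj h1)).sub (h3.mul (dconj hW)))).add
        (hWψ.const_mul (2 * (n : ℂ) ^ 2))).congr_deriv ?_
      have heq := hsol.eqn r hr
      rw [aux_Lop_sub cl c2 _ hr', ← hldef] at heq
      have hq : dz p r = l r - (r : ℂ)⁻¹ * p r + ((r : ℂ) ^ 2)⁻¹ * ψ r := by
        simp only [hldef, hpdef, Lop]; ring
      have hm : dz (dz l) r = Lop l r - (r : ℂ)⁻¹ * dz l r + ((r : ℂ) ^ 2)⁻¹ * l r := by
        simp only [Lop]; ring
      have hrne := hne r hr
      rw [← hpdef, hq, hm, ← heq]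
      simp only [R1, R2]
      push_cast
      simp only [nsq, hw r hr', map_add, map_mul, map_sub, map_inv₀, map_pow,
        Complex.conj_ofReal, Pi.mul_apply, Pi.add_apply, map_one]
      field_simp
      ring)
    (((i7.add iG1).add iG2).sub iG3)
    (by
      have := (((tU.mul (tw.mul (tconj t0))).const_mul (Complex.I * (n : ℂ))).sub
        ((tv.mul (tconj t0)).sub (tl.mul (tconj tw)))).add
        ((tw.mul (tconj t0)).const_mul (2 * (n : ℂ) ^ 2))
      simpa using this)
    (by
      have cW := cψ.add (cofc.mul cpc)
      have cV := clc.add (cofc.mul cmc)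
      have := aux_tendsto_one ((((continuousOn_const (c := Complex.I * (n : ℂ))).mul
        (cUc.mul (cW.mul (cconj cψ)))).sub
        ((cV.mul (cconj cψ)).sub (clc.mul (cconj cW)))).add
        ((continuousOn_const (c := 2 * (n : ℂ) ^ 2)).mul (cW.mul (cconj cψ))))
      have hb : l 1 = -(α : ℂ) * p 1 := hsol.bc_navier
      simp only [Pi.mul_apply, Pi.add_apply, Pi.sub_apply, hsol.bc_psi, map_zero, mul_zero, hb,
        Complex.ofReal_one, one_mul, zero_add, zero_sub, add_zero, neg_neg] at this
      have e : -((α * ‖p 1‖ ^ 2 : ℝ) : ℂ) = -(α : ℂ) * p 1 * (starRingEnd ℂ) (p 1) := by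
        push_cast
        rw [nsq]
        ring
      rw [e]
      exact this)
  have s1 := integral_sub ((i7.add iG1).add iG2) iG3
  have s2 := integral_add (i7.add iG1) iG2
  have s3 := integral_add i7 iG1
  simp only [Pi.add_apply] at s1 s2 s3
  rw [s1, s2, s3, integral_const_mul, integral_const_mul, integral_complex_ofReal,
    integral_complex_ofReal, ← hJ] at main
  have eR1 : ∫ r in Set.Ioo (0 : ℝ) 1, R1 r = _ :=
    (integral_add (i5.const_mul _) (i6.const_mul _)).trans
      (by rw [integral_const_mul, integral_const_mul])
  have eR2 : ∫ r in Set.Ioo (0 : ℝ) 1, R2 r = _ :=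
    (integral_add (i3.add (i2.const_mul _)) (i1.const_mul _)).trans
      (by rw [integral_add' i3 (i2.const_mul _), integral_const_mul, integral_const_mul])
  rw [eR1, eR2] at main
  have mre := congrArg Complex.re main
  have mim := congrArg Complex.im main
  simp only [Complex.add_re, Complex.add_im, Complex.sub_re, Complex.sub_im, Complex.neg_re,
    Complex.neg_im, Complex.mul_re, Complex.mul_im, Complex.I_re, Complex.I_im, Complex.ofReal_re,
    Complex.ofReal_im, Complex.intCast_re, Complex.intCast_im, Complex.zero_re, Complex.zero_im,
    hJre] at mre mim
  constructor
  · linarith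
  · linarith
end

section
/- There exists a constant C > 0, independent of Φ, α, n, F^r and F^z, such that for every Φ ≥ 0, every α ≥ 0, every nonzero integer n, and every smooth solution ψ of the n-th mode problem with Navier boundary conditions with right-hand side f = i·n·F^r − (F^z)', one has ∫₀¹ |(𝓛ψ)(r)|²·r dr + n²·∫₀¹ |(d/dr)(r·ψ(r))|²·(1/r) dr + n⁴·∫₀¹ |ψ(r)|²·r dr + α·|ψ'(1)|² ≤ C·(1 + Φ·|n|⁻²)·|n|⁻²·∫₀¹ (|F^r(r)|² + |F^z(r)|²)·r dr. (Estimate (2-1-11-new) from the proof of Proposition 3.1, uniform in the flux and slip coefficient.) -/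
open MeasureTheory Filter

open Set

lemma ftc_re_im (G g : ℝ → ℂ) (hG : ContinuousOn G (Icc 0 1)) (hg : ContinuousOn g (Icc 0 1))
    (hd : ∀ r ∈ Ioo (0:ℝ) 1, HasDerivAt G (g r) r) :
    (∫ r in (0:ℝ)..1, (g r).re) = (G 1 - G 0).re ∧
    (∫ r in (0:ℝ)..1, (g r).im) = (G 1 - G 0).im := by
  have hi : IntervalIntegrable g volume 0 1 :=
    ContinuousOn.intervalIntegrable (by rwa [uIcc_of_le zero_le_one])
  have h := intervalIntegral.integral_eq_sub_of_hasDerivAt_of_le zero_le_one hG hd hi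
  rw [← h]
  exact ⟨Complex.reCLM.intervalIntegral_comp_comm hi, Complex.imCLM.intervalIntegral_comp_comm hi⟩

lemma ii_of_cont {g : ℝ → ℝ} (hg : ContinuousOn g (Icc 0 1)) :
    IntervalIntegrable g volume 0 1 :=
  ContinuousOn.intervalIntegrable (by rwa [uIcc_of_le zero_le_one])

lemma int_cs (h p q : ℝ → ℝ) (hh : ContinuousOn h (Icc 0 1)) (hp : ContinuousOn p (Icc 0 1))
    (hq : ContinuousOn q (Icc 0 1))
    (p0 : ∀ r ∈ Icc (0:ℝ) 1, 0 ≤ p r) (q0 : ∀ r ∈ Icc (0:ℝ) 1, 0 ≤ q r)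
    (hpq : ∀ r ∈ Icc (0:ℝ) 1, h r ^ 2 ≤ p r * q r) :
    (∫ r in (0:ℝ)..1, h r) ^ 2 ≤ (∫ r in (0:ℝ)..1, p r) * (∫ r in (0:ℝ)..1, q r) := by
  have key : ∀ t : ℝ, 0 ≤ (∫ r in (0:ℝ)..1, p r) * (t * t) + (2 * ∫ r in (0:ℝ)..1, h r) * t
      + ∫ r in (0:ℝ)..1, q r := by
    intro t
    have e : (∫ r in (0:ℝ)..1, p r) * (t * t) + (2 * ∫ r in (0:ℝ)..1, h r) * t
      + ∫ r in (0:ℝ)..1, q r = ∫ r in (0:ℝ)..1, (p r * (t * t) + (h r * (2 * t) + q r)) := by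
      rw [intervalIntegral.integral_add (ii_of_cont (by fun_prop)) (ii_of_cont (by fun_prop)),
        intervalIntegral.integral_add (ii_of_cont (by fun_prop)) (ii_of_cont (by fun_prop)),
        intervalIntegral.integral_mul_const, intervalIntegral.integral_mul_const]
      ring
    rw [e]
    apply intervalIntegral.integral_nonneg zero_le_one
    intro r hr
    have h1 := hpq r hr
    have h2 := p0 r hr
    have h3 := q0 r hr
    rcases h2.eq_or_lt with h4 | h4
    · rw [← h4] at h1 ⊢
      have : h r = 0 := by nlinarith
      rw [this]; linarith
    · by_contra hc
      push Not at hc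
      nlinarith [sq_nonneg (p r * t + h r), mul_neg_of_pos_of_neg h4 hc]
  have := discrim_le_zero key
  unfold discrim at this
  nlinarith

lemma weight_id (ψ v : ℝ → ℂ) (k k' : ℝ → ℝ)
    (hψ : ContinuousOn ψ (Icc 0 1)) (hv : ContinuousOn v (Icc 0 1))
    (hk : ContinuousOn k (Icc 0 1)) (hk' : ContinuousOn k' (Icc 0 1))
    (hψ1 : ψ 1 = 0)
    (dψ : ∀ r ∈ Ioo (0:ℝ) 1, HasDerivAt ψ (v r - ψ r / r) r)
    (dk : ∀ r ∈ Ioo (0:ℝ) 1, HasDerivAt k (k' r) r) :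
    (∫ r in (0:ℝ)..1, k' r * (r ^ 2 * ‖ψ r‖ ^ 2))
      + 2 * (∫ r in (0:ℝ)..1, k r * (r ^ 2 * inner ℝ (ψ r) (v r))) = 0 := by
  have hd : ∀ r ∈ Ioo (0:ℝ) 1, HasDerivAt (fun r : ℝ => k r * (r ^ 2 * ‖ψ r‖ ^ 2))
      (k' r * (r ^ 2 * ‖ψ r‖ ^ 2) + 2 * (k r * (r ^ 2 * inner ℝ (ψ r) (v r)))) r := by
    intro r hr
    have h1 := (dψ r hr).norm_sq
    have h2 := (dk r hr).mul (((hasDerivAt_id r).pow 2).mul h1)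
    refine h2.congr_deriv ?_
    have hr0 : r ≠ 0 := hr.1.ne'
    have : inner ℝ (ψ r) (v r - ψ r / r) = inner ℝ (ψ r) (v r) - ‖ψ r‖ ^ 2 / r := by
      rw [inner_sub_right]
      congr 1
      have : ψ r / (r:ℂ) = (r⁻¹ : ℝ) • ψ r := by
        rw [Complex.real_smul]; push_cast; field_simp
      rw [this, real_inner_smul_right, real_inner_self_eq_norm_sq]; field_simp
    rw [this]
    simp
    field_simp
    ring
  have hci : ContinuousOn (fun r => inner ℝ (ψ r) (v r)) (Icc 0 1) := hψ.inner hv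
  have hi : IntervalIntegrable (fun r => k' r * (r ^ 2 * ‖ψ r‖ ^ 2) + 2 * (k r * (r ^ 2 * inner ℝ (ψ r) (v r)))) volume 0 1 := ii_of_cont (by fun_prop)
  have h := intervalIntegral.integral_eq_sub_of_hasDerivAt_of_le zero_le_one (by fun_prop) hd hi
  rw [intervalIntegral.integral_add (ii_of_cont (by fun_prop)) (ii_of_cont (by fun_prop)),
    intervalIntegral.integral_const_mul] at h
  rw [h, hψ1]; simp

/-- The interpolation inequality for the nonlocal term. -/
lemma interp (ψ v : ℝ → ℂ)
    (hψ : ContinuousOn ψ (Icc 0 1)) (hv : ContinuousOn v (Icc 0 1))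
    (hψ1 : ψ 1 = 0)
    (dψ : ∀ r ∈ Ioo (0:ℝ) 1, HasDerivAt ψ (v r - ψ r / r) r) :
    (∫ r in (0:ℝ)..1, r ^ 2 * ‖v r‖ * ‖ψ r‖) ^ 8 ≤
      (∫ r in (0:ℝ)..1, (1 - r ^ 2) * (r * ‖v r‖ ^ 2)) ^ 5
       * (∫ r in (0:ℝ)..1, (1 - r ^ 2) * (r * ‖ψ r‖ ^ 2))
       * (∫ r in (0:ℝ)..1, r * ‖v r‖ ^ 2) ^ 2 := by
  have hci : ContinuousOn (fun r => inner ℝ (ψ r) (v r)) (Icc 0 1) := hψ.inner hv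
  have hin : ∀ r, (inner ℝ (ψ r) (v r)) ^ 2 ≤ ‖ψ r‖ ^ 2 * ‖v r‖ ^ 2 := by
    intro r
    rw [← mul_pow, sq_le_sq, abs_of_nonneg (by positivity : 0 ≤ ‖ψ r‖ * ‖v r‖)]
    exact abs_real_inner_le_norm _ _
  have hs : ∀ r ∈ Icc (0:ℝ) 1, 0 ≤ 1 - r ^ 2 := by
    intro r hr; nlinarith [hr.1, hr.2]
  set J := ∫ r in (0:ℝ)..1, r ^ 2 * ‖v r‖ * ‖ψ r‖ with hJ
  set W1 := ∫ r in (0:ℝ)..1, (1 - r ^ 2) * (r * ‖v r‖ ^ 2) with hW1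
  set W0 := ∫ r in (0:ℝ)..1, (1 - r ^ 2) * (r * ‖ψ r‖ ^ 2) with hW0
  set D := ∫ r in (0:ℝ)..1, r * ‖v r‖ ^ 2 with hD
  set M := ∫ r in (0:ℝ)..1, r ^ 3 * ‖ψ r‖ ^ 2 with hM
  have D0 : 0 ≤ D := intervalIntegral.integral_nonneg zero_le_one
    fun r hr => mul_nonneg hr.1 (by positivity)
  have W10 : 0 ≤ W1 := intervalIntegral.integral_nonneg zero_le_one
    fun r hr => mul_nonneg (hs r hr) (mul_nonneg hr.1 (by positivity))
  have M0 : 0 ≤ M := intervalIntegral.integral_nonneg zero_le_one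
    fun r hr => mul_nonneg (pow_nonneg hr.1 _) (by positivity)
  -- M² ≤ W1 W0
  have hMW : M ^ 2 ≤ W1 * W0 := by
    have h := weight_id ψ v (fun r => 1 - r ^ 2) (fun r => - (2 * r)) hψ hv (by fun_prop)
      (by fun_prop) hψ1 dψ (by
        intro r hr
        have := ((hasDerivAt_id r).pow 2).const_sub 1
        refine this.congr_deriv ?_
        simp)
    have e : (∫ r in (0:ℝ)..1, -(2 * r) * (r ^ 2 * ‖ψ r‖ ^ 2)) = -2 * M := by
      rw [hM, ← intervalIntegral.integral_const_mul]
      congr 1; ext r; ring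
    rw [e] at h
    have e2 : M = ∫ r in (0:ℝ)..1, (1 - r ^ 2) * (r ^ 2 * inner ℝ (ψ r) (v r)) := by linarith
    rw [e2]
    apply int_cs _ _ _ (by fun_prop) (by fun_prop) (by fun_prop)
    · exact fun r hr => mul_nonneg (hs r hr) (mul_nonneg hr.1 (by positivity))
    · exact fun r hr => mul_nonneg (hs r hr) (mul_nonneg hr.1 (by positivity))
    · intro r hr
      have h1 := hin r
      have h3 : r ^ 4 ≤ r ^ 2 := pow_le_pow_of_le_one hr.1 hr.2 (by norm_num)
      calc ((1 - r ^ 2) * (r ^ 2 * inner ℝ (ψ r) (v r))) ^ 2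
          = (1 - r ^ 2) ^ 2 * (r ^ 4 * (inner ℝ (ψ r) (v r)) ^ 2) := by ring
        _ ≤ (1 - r ^ 2) ^ 2 * (r ^ 2 * (‖ψ r‖ ^ 2 * ‖v r‖ ^ 2)) := by
            gcongr
        _ = _ := by ring
  -- regularised Hardy
  have heps : ∀ ε : ℝ, 0 < ε → J ^ 4 ≤ (W1 + ε * D) ^ 2 * (M * D) := by
    intro ε hε
    have hse : ∀ r ∈ Icc (0:ℝ) 1, 0 < 1 - r ^ 2 + ε := fun r hr => by linarith [hs r hr]
    have hse' : ∀ r ∈ Icc (0:ℝ) 1, 1 - r ^ 2 + ε ≠ 0 := fun r hr => (hse r hr).ne'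
    have hse2 : ∀ r ∈ Icc (0:ℝ) 1, (1 - r ^ 2 + ε) ^ 2 ≠ 0 := fun r hr => pow_ne_zero _ (hse' r hr)
    have c1 : ContinuousOn (fun r : ℝ => (1 - r ^ 2 + ε)⁻¹) (Icc 0 1) :=
      ContinuousOn.inv₀ (by fun_prop) hse'
    set X := ∫ r in (0:ℝ)..1, (((1 - r ^ 2 + ε)⁻¹) ^ 2 * (r ^ 3 * ‖ψ r‖ ^ 2)) with hX
    set H := ∫ r in (0:ℝ)..1, ((1 - r ^ 2 + ε)⁻¹ * (r ^ 3 * ‖ψ r‖ ^ 2)) with hH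
    have X0 : 0 ≤ X := intervalIntegral.integral_nonneg zero_le_one
      fun r hr => mul_nonneg (by positivity) (mul_nonneg (pow_nonneg hr.1 _) (by positivity))
    have hXD : X ≤ D := by
      have h := weight_id ψ v (fun r => (1 - r ^ 2 + ε)⁻¹)
        (fun r => 2 * r * ((1 - r ^ 2 + ε)⁻¹) ^ 2) hψ hv (by fun_prop)
        (by fun_prop) hψ1 dψ (by
          intro r hr
          have := ((((hasDerivAt_id r).pow 2).const_sub 1).add_const ε).inv
            (hse' r ⟨hr.1.le, hr.2.le⟩)
          refine this.congr_deriv ?_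
          simp [div_eq_mul_inv])
      have e : (∫ r in (0:ℝ)..1, 2 * r * ((1 - r ^ 2 + ε)⁻¹) ^ 2 * (r ^ 2 * ‖ψ r‖ ^ 2))
          = 2 * X := by
        rw [hX, ← intervalIntegral.integral_const_mul]
        congr 1; ext r; ring
      rw [e] at h
      have e2 : X = - ∫ r in (0:ℝ)..1, (1 - r ^ 2 + ε)⁻¹ * (r ^ 2 * inner ℝ (ψ r) (v r)) := by
        linarith
      have h2 : X ^ 2 ≤ X * D := by
        nth_rw 1 [e2]
        rw [neg_sq]
        apply int_cs _ _ _ (by fun_prop) (by fun_prop) (by fun_prop)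
        · exact fun r hr => mul_nonneg (by positivity)
            (mul_nonneg (pow_nonneg hr.1 _) (by positivity))
        · exact fun r hr => (mul_nonneg hr.1 (by positivity))
        · intro r hr
          have h1 := hin r
          have h0 := hr.1
          calc ((1 - r ^ 2 + ε)⁻¹ * (r ^ 2 * inner ℝ (ψ r) (v r))) ^ 2
              = ((1 - r ^ 2 + ε)⁻¹) ^ 2 * (r ^ 4 * (inner ℝ (ψ r) (v r)) ^ 2) := by ring
            _ ≤ ((1 - r ^ 2 + ε)⁻¹) ^ 2 * (r ^ 4 * (‖ψ r‖ ^ 2 * ‖v r‖ ^ 2)) := by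
                gcongr
            _ = _ := by ring
      rcases X0.eq_or_lt with h3 | h3
      · rw [← h3]; exact D0
      · nlinarith
    have hH2 : H ^ 2 ≤ M * X := by
      apply int_cs _ _ _ (by fun_prop) (by fun_prop) (by fun_prop)
      · exact fun r hr => (mul_nonneg (pow_nonneg hr.1 _) (by positivity))
      · exact fun r hr => mul_nonneg (by positivity)
            (mul_nonneg (pow_nonneg hr.1 _) (by positivity))
      · intro r hr
        apply le_of_eq; ring
    have hJ2 : J ^ 2 ≤ (W1 + ε * D) * H := by
      have e : W1 + ε * D = ∫ r in (0:ℝ)..1, (1 - r ^ 2 + ε) * (r * ‖v r‖ ^ 2) := by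
        rw [hW1, hD, ← intervalIntegral.integral_const_mul,
          ← intervalIntegral.integral_add (ii_of_cont (by fun_prop)) (ii_of_cont (by fun_prop))]
        congr 1; ext r; ring
      rw [e]
      apply int_cs _ _ _ (by fun_prop) (by fun_prop) (by fun_prop)
      · exact fun r hr => mul_nonneg (hse r hr).le (mul_nonneg hr.1 (by positivity))
      · exact fun r hr => mul_nonneg (inv_nonneg.2 (hse r hr).le)
            (mul_nonneg (pow_nonneg hr.1 _) (by positivity))
      · intro r hr
        apply le_of_eq
        have := hse' r hr
        field_simp
    calc J ^ 4 = (J ^ 2) ^ 2 := by ring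
      _ ≤ ((W1 + ε * D) * H) ^ 2 := by gcongr
      _ = (W1 + ε * D) ^ 2 * H ^ 2 := by ring
      _ ≤ (W1 + ε * D) ^ 2 * (M * D) := by
        have : M * X ≤ M * D := by gcongr
        gcongr
        linarith
  have hJ4 : J ^ 4 ≤ W1 ^ 2 * (M * D) := by
    have ht : Tendsto (fun ε : ℝ => (W1 + ε * D) ^ 2 * (M * D)) (nhdsWithin 0 (Ioi 0))
        (nhds ((W1 + 0 * D) ^ 2 * (M * D))) := by
      apply Tendsto.mono_left _ nhdsWithin_le_nhds
      apply Continuous.tendsto (by fun_prop)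
    rw [zero_mul, add_zero] at ht
    refine ge_of_tendsto ht ?_
    filter_upwards [self_mem_nhdsWithin] with ε hε using heps ε hε
  calc J ^ 8 = (J ^ 4) ^ 2 := by ring
    _ ≤ (W1 ^ 2 * (M * D)) ^ 2 := by gcongr
    _ = W1 ^ 4 * M ^ 2 * D ^ 2 := by ring
    _ ≤ W1 ^ 4 * (W1 * W0) * D ^ 2 := by gcongr
    _ = _ := by ring

/-- Final algebra. -/
lemma final_alg (S A T g κ : ℝ) (hS : 0 ≤ S) (hg : 0 ≤ g) (hκ : 0 ≤ κ)
    (h1 : S ≤ A + T) (h2 : A ^ 2 ≤ 2 * S * g) (h3 : T ^ 8 ≤ 64 * A ^ 6 * κ ^ 2 * S ^ 2) :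
    S ≤ 51 * (1 + κ) * g := by
  rcases hS.eq_or_lt with h0 | h0
  · rw [← h0]; positivity
  rcases le_total T A with h | h
  · have : S ^ 2 ≤ 8 * g * S := by
      have : S ^ 2 ≤ (2 * A) ^ 2 := by gcongr; linarith
      nlinarith
    have : S ≤ 8 * g := by nlinarith
    nlinarith [mul_nonneg hκ hg]
  · have hST : S ≤ 2 * T := by linarith
    have h8 : S ^ 8 ≤ 131072 * (g ^ 3 * κ ^ 2) * S ^ 5 := by
      calc S ^ 8 ≤ (2 * T) ^ 8 := by gcongr
        _ = 256 * T ^ 8 := by ring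
        _ ≤ 256 * (64 * A ^ 6 * κ ^ 2 * S ^ 2) := by gcongr
        _ = 16384 * (A ^ 2) ^ 3 * κ ^ 2 * S ^ 2 := by ring
        _ ≤ 16384 * (2 * S * g) ^ 3 * κ ^ 2 * S ^ 2 := by gcongr
        _ = _ := by ring
    have h5 : 0 < S ^ 5 := by positivity
    have h9 : S ^ 3 ≤ 131072 * (g ^ 3 * κ ^ 2) := by
      have : S ^ 3 * S ^ 5 ≤ 131072 * (g ^ 3 * κ ^ 2) * S ^ 5 := by
        calc _ = S ^ 8 := by ring
          _ ≤ _ := h8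
      exact le_of_mul_le_mul_right this h5
    have h10 : S ^ 3 ≤ (51 * (1 + κ) * g) ^ 3 := by
      refine h9.trans ?_
      have : κ ^ 2 ≤ (1 + κ) ^ 3 := by nlinarith [pow_nonneg hκ 3, pow_nonneg hκ 2]
      calc 131072 * (g ^ 3 * κ ^ 2) ≤ 132651 * (g ^ 3 * (1 + κ) ^ 3) := by gcongr; norm_num
        _ = _ := by ring
    exact le_of_pow_le_pow_left₀ (by norm_num) (by positivity) h10

set_option maxHeartbeats 4000000 in
open ComplexConjugate in
lemma core (N α c : ℝ) (U : ℝ → ℝ) (ψ v w Q Fr Fz Fz' : ℝ → ℂ) (hN : N ≠ 0) (hα : 0 ≤ α)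
    (hc : 0 ≤ c)
    (cU : ContinuousOn U (Icc 0 1)) (dU : ∀ r ∈ Ioo (0:ℝ) 1, HasDerivAt U (-(c * r)) r)
    (hU : ∀ r ∈ Icc (0:ℝ) 1, c / 2 * (1 - r ^ 2) ≤ U r)
    (cψ : ContinuousOn ψ (Icc 0 1)) (cv : ContinuousOn v (Icc 0 1))
    (cw : ContinuousOn w (Icc 0 1)) (cQ : ContinuousOn Q (Icc 0 1))
    (cFr : ContinuousOn Fr (Icc 0 1)) (cFz : ContinuousOn Fz (Icc 0 1))
    (ψ0 : ψ 0 = 0) (ψ1 : ψ 1 = 0) (w1 : w 1 = -(α : ℂ) * v 1)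
    (dψ : ∀ r ∈ Ioo (0:ℝ) 1, HasDerivAt ψ (v r - ψ r / r) r)
    (dv : ∀ r ∈ Ioo (0:ℝ) 1, HasDerivAt v (w r) r)
    (dZ : ∀ r ∈ Ioo (0:ℝ) 1,
      HasDerivAt (fun s : ℝ => (s : ℂ) * (w s - (N : ℂ) ^ 2 * ψ s)) (Q r) r)
    (dQ : ∀ r ∈ Ioo (0:ℝ) 1, HasDerivAt Q (Q r / r + r *
      (Complex.I * N * U r * (w r - (N : ℂ) ^ 2 * ψ r) + (N : ℂ) ^ 2 * (w r - (N : ℂ) ^ 2 * ψ r)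
        - Complex.I * N * Fr r + Fz' r)) r)
    (dFz : ∀ r ∈ Ioo (0:ℝ) 1, HasDerivAt Fz (Fz' r) r) :
    (∫ r in (0:ℝ)..1, r * ‖w r‖ ^ 2) + N ^ 2 * (∫ r in (0:ℝ)..1, r * ‖v r‖ ^ 2)
      + N ^ 4 * (∫ r in (0:ℝ)..1, r * ‖ψ r‖ ^ 2) + α * ‖v 1‖ ^ 2
      ≤ 51 * (1 + c / N ^ 2) *
        ((∫ r in (0:ℝ)..1, r * (‖Fr r‖ ^ 2 + ‖Fz r‖ ^ 2)) / N ^ 2) := by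
  have hs : ∀ r ∈ Icc (0:ℝ) 1, 0 ≤ 1 - r ^ 2 := by
    intro r hr; nlinarith [hr.1, hr.2]
  have hci : ContinuousOn (fun r => inner ℝ (ψ r) (v r)) (Icc 0 1) := cψ.inner cv
  have ccψ : ContinuousOn (fun r => conj (ψ r)) (Icc 0 1) := Complex.continuous_conj.comp_continuousOn cψ
  have ccv : ContinuousOn (fun r => conj (v r)) (Icc 0 1) := Complex.continuous_conj.comp_continuousOn cv
  have ccw : ContinuousOn (fun r => conj (w r)) (Icc 0 1) := Complex.continuous_conj.comp_continuousOn cw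
  have cUc : ContinuousOn (fun r => (U r : ℂ)) (Icc 0 1) := Complex.continuous_ofReal.comp_continuousOn cU
  have cre : ∀ f : ℝ → ℂ, ContinuousOn f (Icc 0 1) → ContinuousOn (fun r => (f r).re) (Icc 0 1) :=
    fun f hf => Complex.continuous_re.comp_continuousOn hf
  have cim : ∀ f : ℝ → ℂ, ContinuousOn f (Icc 0 1) → ContinuousOn (fun r => (f r).im) (Icc 0 1) :=
    fun f hf => Complex.continuous_im.comp_continuousOn hf
  obtain ⟨hre, him⟩ := ftc_re_im
    (fun r : ℝ => Q r * conj (ψ r) - ((r:ℂ) * (w r - (N : ℂ) ^ 2 * ψ r)) * conj (v r)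
      - Fz r * r * conj (ψ r) - (N:ℂ) ^ 2 * (v r * r * conj (ψ r))
      - (N:ℂ) ^ 2 * (conj (v r) * r * ψ r) - Complex.I * N * (U r * (v r * r * conj (ψ r))))
    (fun r : ℝ => ((-(r * ‖w r‖ ^ 2 + 2 * N ^ 2 * (r * ‖v r‖ ^ 2) + N ^ 4 * (r * ‖ψ r‖ ^ 2)) : ℝ) : ℂ)
      - Complex.I * ((N ^ 3 * (U r * (r * ‖ψ r‖ ^ 2)) + N * (U r * (r * ‖v r‖ ^ 2)) : ℝ) : ℂ)
      + Complex.I * ((N * c * r ^ 2 : ℝ) : ℂ) * (conj (ψ r) * v r)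
      - (Complex.I * N * (r * conj (ψ r) * Fr r) + Fz r * r * conj (v r)))
    (by fun_prop) (by
      have := cψ.norm; have := cv.norm; have := cw.norm
      fun_prop) (by
      intro r hr
      have hr0 : (r:ℂ) ≠ 0 := by exact_mod_cast hr.1.ne'
      have e1 := (dψ r hr).star
      have e2 := (dv r hr).star
      have er : HasDerivAt (fun r : ℝ => (r:ℂ)) 1 r := (hasDerivAt_id r).ofReal_comp
      have eU := (dU r hr).ofReal_comp
      have h := ((((((dQ r hr).mul e1).sub ((dZ r hr).mul e2)).sub
        (((dFz r hr).mul er).mul e1)).sub ((((dv r hr).mul er).mul e1).const_mul ((N:ℂ) ^ 2))).sub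
        (((e2.mul er).mul (dψ r hr)).const_mul ((N:ℂ) ^ 2))).sub
        ((eU.mul (((dv r hr).mul er).mul e1)).const_mul (Complex.I * N))
      refine h.congr_deriv ?_
      push_cast
      rw [← Complex.mul_conj' (w r), ← Complex.mul_conj' (v r), ← Complex.mul_conj' (ψ r)]
      simp only [← starRingEnd_apply, map_sub, map_div₀, Complex.conj_ofReal, Pi.mul_apply]
      field_simp
      ring)
  simp only [ψ0, ψ1, w1] at hre him
  have hre' : (∫ r in (0:ℝ)..1, (-(r * ‖w r‖ ^ 2 + 2 * N ^ 2 * (r * ‖v r‖ ^ 2) + N ^ 4 * (r * ‖ψ r‖ ^ 2))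
      + (Complex.I * ((N * c * r ^ 2 : ℝ) : ℂ) * (conj (ψ r) * v r)
      - (Complex.I * N * (r * conj (ψ r) * Fr r) + Fz r * r * conj (v r))).re))
      = α * ‖v 1‖ ^ 2 := by
    refine Eq.trans ?_ (hre.trans ?_)
    · congr 1; ext r
      simp only [Complex.add_re, Complex.sub_re, Complex.ofReal_re, Complex.re_mul_ofReal, Complex.I_re]
      ring
    · simp [← mul_assoc]
      rw [Complex.sq_norm, Complex.normSq_apply]; ring
  have him' : (∫ r in (0:ℝ)..1, (-(N ^ 3 * (U r * (r * ‖ψ r‖ ^ 2)) + N * (U r * (r * ‖v r‖ ^ 2)))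
      + (N * c) * (r ^ 2 * inner ℝ (ψ r) (v r))
      - (Complex.I * N * (r * conj (ψ r) * Fr r) + Fz r * r * conj (v r)).im)) = 0 := by
    refine Eq.trans ?_ (him.trans ?_)
    · congr 1; ext r
      have : (Complex.I * ((N * c * r ^ 2 : ℝ) : ℂ) * (conj (ψ r) * v r)).im
          = (N * c) * (r ^ 2 * inner ℝ (ψ r) (v r)) := by
        rw [Complex.inner, mul_assoc, Complex.I_mul_im, Complex.re_ofReal_mul]; ring
      simp only [Complex.add_im, Complex.sub_im, this, Complex.ofReal_im, Complex.I_mul_im, Complex.ofReal_re]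
      ring
    · simp [← mul_assoc]
      ring
  clear hre him
  have npsi := cψ.norm
  have nv := cv.norm
  have nw := cw.norm
  have nFr := cFr.norm
  have nFz := cFz.norm
  set a := ∫ r in (0:ℝ)..1, r * ‖ψ r‖ ^ 2 with ha
  set D := ∫ r in (0:ℝ)..1, r * ‖v r‖ ^ 2 with hD
  set W := ∫ r in (0:ℝ)..1, r * ‖w r‖ ^ 2 with hW
  set J := ∫ r in (0:ℝ)..1, r ^ 2 * ‖v r‖ * ‖ψ r‖ with hJ
  set b1 := ∫ r in (0:ℝ)..1, r * ‖ψ r‖ * ‖Fr r‖ with hb1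
  set b2 := ∫ r in (0:ℝ)..1, r * ‖Fz r‖ * ‖v r‖ with hb2
  set f1 := ∫ r in (0:ℝ)..1, r * ‖Fr r‖ ^ 2 with hf1
  set f2 := ∫ r in (0:ℝ)..1, r * ‖Fz r‖ ^ 2 with hf2
  set W1 := ∫ r in (0:ℝ)..1, (1 - r ^ 2) * (r * ‖v r‖ ^ 2) with hW1
  set W0 := ∫ r in (0:ℝ)..1, (1 - r ^ 2) * (r * ‖ψ r‖ ^ 2) with hW0
  have eF : (∫ r in (0:ℝ)..1, r * (‖Fr r‖ ^ 2 + ‖Fz r‖ ^ 2)) = f1 + f2 := by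
    rw [hf1, hf2, ← intervalIntegral.integral_add (ii_of_cont (by fun_prop)) (ii_of_cont (by fun_prop))]
    congr 1; ext r; ring
  rw [eF]
  have nn : ∀ k : ℝ → ℝ, (∀ r ∈ Icc (0:ℝ) 1, 0 ≤ k r) → 0 ≤ ∫ r in (0:ℝ)..1, k r :=
    fun k hk => intervalIntegral.integral_nonneg zero_le_one hk
  have a0 : 0 ≤ a := nn _ fun r hr => mul_nonneg hr.1 (by positivity)
  have D0 : 0 ≤ D := nn _ fun r hr => mul_nonneg hr.1 (by positivity)
  have WW0 : 0 ≤ W := nn _ fun r hr => mul_nonneg hr.1 (by positivity)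
  have f10 : 0 ≤ f1 := nn _ fun r hr => mul_nonneg hr.1 (by positivity)
  have f20 : 0 ≤ f2 := nn _ fun r hr => mul_nonneg hr.1 (by positivity)
  have b10 : 0 ≤ b1 := nn _ fun r hr => mul_nonneg (mul_nonneg hr.1 (by positivity)) (by positivity)
  have b20 : 0 ≤ b2 := nn _ fun r hr => mul_nonneg (mul_nonneg hr.1 (by positivity)) (by positivity)
  have J0 : 0 ≤ J := nn _ fun r hr => mul_nonneg (mul_nonneg (by positivity) (by positivity)) (by positivity)
  have W10 : 0 ≤ W1 := nn _ fun r hr => mul_nonneg (hs r hr) (mul_nonneg hr.1 (by positivity))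
  have W00 : 0 ≤ W0 := nn _ fun r hr => mul_nonneg (hs r hr) (mul_nonneg hr.1 (by positivity))
  have hb1s : b1 ^ 2 ≤ a * f1 := by
    apply int_cs _ _ _ (by fun_prop) (by fun_prop) (by fun_prop)
    · exact fun r hr => mul_nonneg hr.1 (by positivity)
    · exact fun r hr => mul_nonneg hr.1 (by positivity)
    · intro r hr; apply le_of_eq; ring
  have hb2s : b2 ^ 2 ≤ D * f2 := by
    apply int_cs _ _ _ (by fun_prop) (by fun_prop) (by fun_prop)
    · exact fun r hr => mul_nonneg hr.1 (by positivity)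
    · exact fun r hr => mul_nonneg hr.1 (by positivity)
    · intro r hr; apply le_of_eq; ring
  set A := |N| * b1 + b2 with hA
  have A0 : 0 ≤ A := by positivity
  -- pointwise bound of the right-hand side
  have hB : ∀ r ∈ Icc (0:ℝ) 1, ‖Complex.I * N * (r * conj (ψ r) * Fr r) + Fz r * r * conj (v r)‖
      ≤ |N| * (r * ‖ψ r‖ * ‖Fr r‖) + r * ‖Fz r‖ * ‖v r‖ := by
    intro r hr
    refine (norm_add_le _ _).trans (le_of_eq ?_)
    simp only [norm_mul, Complex.norm_I, Complex.norm_real, Complex.norm_conj, Real.norm_eq_abs,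
      abs_of_nonneg hr.1]
    ring
  have eA : (∫ r in (0:ℝ)..1, (|N| * (r * ‖ψ r‖ * ‖Fr r‖) + r * ‖Fz r‖ * ‖v r‖)) = A := by
    rw [intervalIntegral.integral_add (ii_of_cont (by fun_prop)) (ii_of_cont (by fun_prop)),
      intervalIntegral.integral_const_mul]
  -- real part
  have hreal : W + 2 * N ^ 2 * D + N ^ 4 * a + α * ‖v 1‖ ^ 2 ≤ A + |N| * c * J := by
    have e : A + |N| * c * J - (W + 2 * N ^ 2 * D + N ^ 4 * a) =
        ∫ r in (0:ℝ)..1, ((|N| * (r * ‖ψ r‖ * ‖Fr r‖) + r * ‖Fz r‖ * ‖v r‖)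
          + |N| * c * (r ^ 2 * ‖v r‖ * ‖ψ r‖)
          - (r * ‖w r‖ ^ 2 + 2 * N ^ 2 * (r * ‖v r‖ ^ 2) + N ^ 4 * (r * ‖ψ r‖ ^ 2))) := by
      rw [intervalIntegral.integral_sub (ii_of_cont (by fun_prop)) (ii_of_cont (by fun_prop)),
        intervalIntegral.integral_add (ii_of_cont (by fun_prop)) (ii_of_cont (by fun_prop)), eA,
        intervalIntegral.integral_add (ii_of_cont (by fun_prop)) (ii_of_cont (by fun_prop)),
        intervalIntegral.integral_add (ii_of_cont (by fun_prop)) (ii_of_cont (by fun_prop)),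
        intervalIntegral.integral_const_mul, intervalIntegral.integral_const_mul,
        intervalIntegral.integral_const_mul]
    have hle : α * ‖v 1‖ ^ 2 ≤ A + |N| * c * J - (W + 2 * N ^ 2 * D + N ^ 4 * a) := by
      rw [e, ← hre']
      apply intervalIntegral.integral_mono_on zero_le_one
      · apply ii_of_cont
        refine ContinuousOn.add (by fun_prop) (cre _ (by fun_prop))
      · exact ii_of_cont (by fun_prop)
      · intro r hr
        have h1 := Complex.re_le_norm (Complex.I * ((N * c * r ^ 2 : ℝ) : ℂ) * (conj (ψ r) * v r)
          - (Complex.I * N * (r * conj (ψ r) * Fr r) + Fz r * r * conj (v r)))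
        have h2 := norm_sub_le (Complex.I * ((N * c * r ^ 2 : ℝ) : ℂ) * (conj (ψ r) * v r))
          (Complex.I * N * (r * conj (ψ r) * Fr r) + Fz r * r * conj (v r))
        have h3 := hB r hr
        have h4 : ‖Complex.I * ((N * c * r ^ 2 : ℝ) : ℂ) * (conj (ψ r) * v r)‖
            = |N| * c * (r ^ 2 * ‖v r‖ * ‖ψ r‖) := by
          rw [norm_mul, norm_mul, norm_mul, Complex.norm_I, Complex.norm_real, Complex.norm_conj,
            Real.norm_eq_abs, abs_mul, abs_mul, abs_of_nonneg hc, abs_of_nonneg (sq_nonneg r)]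
          ring
        linarith
    linarith
  -- imaginary part
  have hwt := weight_id ψ v (fun _ => 1) (fun _ => 0) cψ cv (by fun_prop) (by fun_prop) ψ1 dψ
    (fun r _ => hasDerivAt_const r 1)
  simp only [zero_mul, intervalIntegral.integral_zero, one_mul, zero_add] at hwt
  have hwt' : (∫ r in (0:ℝ)..1, r ^ 2 * inner ℝ (ψ r) (v r)) = 0 := by linarith
  set Uψ := ∫ r in (0:ℝ)..1, U r * (r * ‖ψ r‖ ^ 2) with hUψ
  set Uv := ∫ r in (0:ℝ)..1, U r * (r * ‖v r‖ ^ 2) with hUv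
  have hU1 : c / 2 * W1 ≤ Uv := by
    rw [hW1, ← intervalIntegral.integral_const_mul]
    apply intervalIntegral.integral_mono_on zero_le_one (ii_of_cont (by fun_prop)) (ii_of_cont (by fun_prop))
    intro r hr
    rw [← mul_assoc]
    exact mul_le_mul_of_nonneg_right (hU r hr) (mul_nonneg hr.1 (by positivity))
  have hU0 : c / 2 * W0 ≤ Uψ := by
    rw [hW0, ← intervalIntegral.integral_const_mul]
    apply intervalIntegral.integral_mono_on zero_le_one (ii_of_cont (by fun_prop)) (ii_of_cont (by fun_prop))
    intro r hr
    rw [← mul_assoc]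
    exact mul_le_mul_of_nonneg_right (hU r hr) (mul_nonneg hr.1 (by positivity))
  have himag : |N| * (N ^ 2 * Uψ + Uv) ≤ A := by
    have cB : ContinuousOn (fun r : ℝ => (Complex.I * N * (r * conj (ψ r) * Fr r) + Fz r * r * conj (v r)).im) (Icc 0 1) :=
      cim _ (by fun_prop)
    rw [intervalIntegral.integral_sub (ii_of_cont (by fun_prop)) (ii_of_cont cB),
      intervalIntegral.integral_add (ii_of_cont (by fun_prop)) (ii_of_cont (by fun_prop)),
      intervalIntegral.integral_neg,
      intervalIntegral.integral_add (ii_of_cont (by fun_prop)) (ii_of_cont (by fun_prop)),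
      intervalIntegral.integral_const_mul, intervalIntegral.integral_const_mul,
      intervalIntegral.integral_const_mul, hwt'] at him'
    have h1 : |∫ r in (0:ℝ)..1, (Complex.I * N * (r * conj (ψ r) * Fr r) + Fz r * r * conj (v r)).im| ≤ A := by
      refine (intervalIntegral.abs_integral_le_integral_abs zero_le_one).trans ?_
      rw [← eA]
      apply intervalIntegral.integral_mono_on zero_le_one (ii_of_cont cB.abs) (ii_of_cont (by fun_prop))
      intro r hr
      exact (Complex.abs_im_le_norm _).trans (hB r hr)
    have h2 : N * (N ^ 2 * Uψ + Uv) = -∫ r in (0:ℝ)..1, (Complex.I * N * (r * conj (ψ r) * Fr r) + Fz r * r * conj (v r)).im := by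
      linarith
    have h3 : |N * (N ^ 2 * Uψ + Uv)| ≤ A := by rw [h2, abs_neg]; exact h1
    rw [abs_mul] at h3
    exact (mul_le_mul_of_nonneg_left (le_abs_self _) (abs_nonneg _)).trans h3
  have hN0 : 0 < |N| := abs_pos.2 hN
  have hN2 : |N| ^ 2 = N ^ 2 := sq_abs N
  have hN2p : 0 < N ^ 2 := by positivity
  have hUψ0 : 0 ≤ Uψ := le_trans (by positivity) hU0
  have hUv0 : 0 ≤ Uv := le_trans (by positivity) hU1
  have k1 : |N| * c * W1 ≤ 2 * A := by
    have : |N| * (c / 2 * W1) ≤ |N| * (N ^ 2 * Uψ + Uv) := by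
      have h1 := mul_nonneg hN2p.le hUψ0
      exact mul_le_mul_of_nonneg_left (by linarith only [h1, hU1]) hN0.le
    linarith only [this, himag]
  have k0 : |N| ^ 3 * c * W0 ≤ 2 * A := by
    have : |N| * (N ^ 2 * (c / 2 * W0)) ≤ |N| * (N ^ 2 * Uψ + Uv) := by
      have h1 := mul_le_mul_of_nonneg_left hU0 hN2p.le
      exact mul_le_mul_of_nonneg_left (by linarith only [h1, hUv0]) hN0.le
    have h2 : |N| ^ 3 * c * W0 = 2 * (|N| * (N ^ 2 * (c / 2 * W0))) := by rw [← hN2]; ring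
    linarith only [this, himag, h2]
  have hinterp := interp ψ v cψ cv ψ1 dψ
  rw [← hJ, ← hW1, ← hW0, ← hD] at hinterp
  set S := W + 2 * N ^ 2 * D + N ^ 4 * a + α * ‖v 1‖ ^ 2 with hS
  have hDS : N ^ 2 * D ≤ S := by
    have : 0 ≤ N ^ 2 * D := by positivity
    have : 0 ≤ N ^ 4 * a := by positivity
    have : 0 ≤ α * ‖v 1‖ ^ 2 := by positivity
    linarith
  have haS : N ^ 4 * a ≤ S := by
    have : 0 ≤ N ^ 2 * D := by positivity
    have : 0 ≤ α * ‖v 1‖ ^ 2 := by positivity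
    linarith
  have S0 : 0 ≤ S := by positivity
  have hA2 : A ^ 2 ≤ 2 * S * ((f1 + f2) / N ^ 2) := by
    have h1 : A ^ 2 ≤ 2 * (N ^ 2 * b1 ^ 2 + b2 ^ 2) := by
      rw [← hN2]; linarith only [sq_nonneg (|N| * b1 - b2), hA, show A ^ 2 = (|N| * b1 + b2) ^ 2 from rfl]
    have h2 : N ^ 2 * A ^ 2 ≤ 2 * S * (f1 + f2) := by
      calc N ^ 2 * A ^ 2 ≤ N ^ 2 * (2 * (N ^ 2 * b1 ^ 2 + b2 ^ 2)) := by gcongr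
        _ ≤ N ^ 2 * (2 * (N ^ 2 * (a * f1) + D * f2)) := by gcongr
        _ = 2 * ((N ^ 4 * a) * f1 + (N ^ 2 * D) * f2) := by ring
        _ ≤ 2 * (S * f1 + S * f2) := by gcongr
        _ = _ := by ring
    rw [mul_div_assoc', le_div_iff₀ hN2p]
    linarith
  have hT : (|N| * c * J) ^ 8 ≤ 64 * A ^ 6 * (c / N ^ 2) ^ 2 * S ^ 2 := by
    calc (|N| * c * J) ^ 8 = (|N| * c) ^ 8 * J ^ 8 := by ring
      _ ≤ (|N| * c) ^ 8 * (W1 ^ 5 * W0 * D ^ 2) := by gcongr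
      _ = (|N| * c * W1) ^ 5 * (|N| ^ 3 * c * W0) * (c * D) ^ 2 := by ring
      _ ≤ (2 * A) ^ 5 * (2 * A) * (c * D) ^ 2 := by gcongr
      _ = 64 * A ^ 6 * (c / N ^ 2) ^ 2 * (N ^ 2 * D) ^ 2 := by field_simp; ring
      _ ≤ _ := by gcongr
  have := final_alg S A (|N| * c * J) ((f1 + f2) / N ^ 2) (c / N ^ 2) S0 (by positivity)
    (by positivity) hreal hA2 hT
  refine le_trans ?_ this
  have : 0 ≤ N ^ 2 * D := by positivity
  linarith

lemma ext_cont {g : ℝ → ℂ} {L : ℂ} (hg : ContinuousOn g (Ioc 0 1))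
    (hL : Tendsto g (nhdsWithin (0:ℝ) (Ioc 0 1)) (nhds L)) :
    ContinuousOn (Function.update g 0 L) (Icc 0 1) := by
  rw [continuousOn_update_iff, Icc_sdiff_left]
  exact ⟨hg, fun _ => hL⟩

lemma dz_hasDerivAt {g : ℝ → ℂ} (hg : DifferentiableOn ℝ g (Ioc 0 1)) {r : ℝ} (hr : r ∈ Ioo (0:ℝ) 1) :
    HasDerivAt g (dz g r) r := by
  have hm : Ioc (0:ℝ) 1 ∈ nhds r := mem_of_superset (Ioo_mem_nhds hr.1 hr.2) Ioo_subset_Ioc_self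
  exact ((hg r ⟨hr.1, hr.2.le⟩).hasDerivWithinAt).hasDerivAt hm

lemma upd_deriv {g : ℝ → ℂ} {L d : ℂ} {r : ℝ} (hr : r ∈ Ioo (0:ℝ) 1) (h : HasDerivAt g d r) :
    HasDerivAt (Function.update g 0 L) d r := by
  refine h.congr_of_eventuallyEq ?_
  filter_upwards [Ioo_mem_nhds hr.1 hr.2] with s hs
  exact Function.update_of_ne hs.1.ne' _ _

lemma wInt_eq (h k : ℝ → ℝ) (hk : ContinuousOn k (Icc 0 1)) (k0 : ∀ r ∈ Icc (0:ℝ) 1, 0 ≤ k r)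
    (e : ∀ r ∈ Ioo (0:ℝ) 1, h r = k r) :
    wInt h = ENNReal.ofReal (∫ r in (0:ℝ)..1, k r) := by
  unfold wInt
  rw [intervalIntegral.integral_of_le zero_le_one, integral_Ioc_eq_integral_Ioo,
    ofReal_integral_eq_lintegral_ofReal]
  · exact setLIntegral_congr_fun measurableSet_Ioo fun r hr => by simp only [e r hr]
  · exact (hk.integrableOn_Icc).mono_set Ioo_subset_Icc_self
  · filter_upwards [ae_restrict_mem measurableSet_Ioo] with r hr
    exact k0 r (Ioo_subset_Icc_self hr)

lemma psi_div {ψ : ℝ → ℂ} {L : ℂ} (hd : DifferentiableOn ℝ ψ (Ioc 0 1))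
    (h0 : Tendsto ψ (nhdsWithin (0:ℝ) (Ioc 0 1)) (nhds 0))
    (hL : Tendsto (dz ψ) (nhdsWithin (0:ℝ) (Ioc 0 1)) (nhds L)) :
    Tendsto (fun r : ℝ => ψ r / r) (nhdsWithin (0:ℝ) (Ioc 0 1)) (nhds L) := by
  have hw : nhdsWithin (0:ℝ) (Ioc 0 1) = nhdsWithin 0 (Ioi 0) := nhdsWithin_Ioc_eq_nhdsGT zero_lt_one
  have hc := ext_cont hd.continuousOn h0
  have hu : ∀ r ∈ Ioo (0:ℝ) 1, HasDerivAt (Function.update ψ 0 0) (dz ψ r) r :=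
    fun r hr => upd_deriv hr (dz_hasDerivAt hd hr)
  have h := hasDerivWithinAt_Ici_of_tendsto_deriv (s := Ioo (0:ℝ) 1) (e := L) (a := 0)
    (f := Function.update ψ 0 0)
    (fun r hr => (hu r hr).differentiableAt.differentiableWithinAt)
    ((hc 0 (by simp)).mono Ioo_subset_Icc_self) (Ioo_mem_nhdsGT zero_lt_one) (by
      rw [← hw]
      refine hL.congr' ?_
      rw [hw]
      filter_upwards [Ioo_mem_nhdsGT (zero_lt_one (α := ℝ))] with r hr
      exact (hu r hr).deriv.symm)
  rw [hasDerivWithinAt_iff_tendsto_slope, Ici_sdiff_left] at h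
  rw [hw]
  refine h.congr' ?_
  filter_upwards [self_mem_nhdsWithin] with r hr
  rw [slope_def_module]
  have : r ≠ 0 := ne_of_gt hr
  simp [this, Complex.real_smul]
  field_simp

/-- Estimate (2-1-11-new) from the proof of Proposition 3.1, uniform in the flux `Φ`
and slip coefficient `α`: for `n ≠ 0` and right-hand side `f = i n F^r − (F^z)'`,
`∫₀¹|𝓛ψ|² r + n² ∫₀¹|(rψ)'|²/r + n⁴ ∫₀¹|ψ|² r + α|ψ'(1)|²
  ≤ C (1 + Φ |n|⁻²) |n|⁻² ∫₀¹ (|F^r|² + |F^z|²) r dr`. -/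
theorem uniform_mode_estimate :
    ∃ C : ℝ, 0 < C ∧ ∀ (Φ α : ℝ) (n : ℤ) (Fr Fz ψ : ℝ → ℂ),
      0 ≤ Φ → 0 ≤ α → n ≠ 0 →
      ContinuousOn Fr (Set.Icc 0 1) → ContDiffOn ℝ 1 Fz (Set.Icc 0 1) →
      NavierSol Φ α n (fun r => Complex.I * (n : ℂ) * Fr r - dz Fz r) ψ →
      wInt (fun r => ‖Lop ψ r‖ ^ 2 * r)
        + ENNReal.ofReal ((n : ℝ) ^ 2)
            * wInt (fun r => ‖dz (fun s => (s : ℂ) * ψ s) r‖ ^ 2 / r)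
        + ENNReal.ofReal ((n : ℝ) ^ 4) * wInt (fun r => ‖ψ r‖ ^ 2 * r)
        + ENNReal.ofReal (α * ‖dz ψ 1‖ ^ 2)
          ≤ ENNReal.ofReal (C * (1 + Φ / (n : ℝ) ^ 2) / (n : ℝ) ^ 2)
              * wInt (fun r => (‖Fr r‖ ^ 2 + ‖Fz r‖ ^ 2) * r) := by
  refine ⟨102, by norm_num, ?_⟩
  intro Φ α n Fr Fz ψ hΦ hα hn cFr cFz sol
  have hud : UniqueDiffOn ℝ (Ioc (0:ℝ) 1) := uniqueDiffOn_Ioc 0 1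
  have s4 := sol.smooth
  have s3 : ContDiffOn ℝ 3 (dz ψ) (Ioc 0 1) := s4.derivWithin hud (by norm_num)
  have s2 : ContDiffOn ℝ 2 (dz (dz ψ)) (Ioc 0 1) := s3.derivWithin hud (by norm_num)
  have sr : ContDiffOn ℝ 4 (fun r : ℝ => (r:ℂ)) (Ioc 0 1) := Complex.ofRealCLM.contDiff.contDiffOn
  have hr0 : ∀ r ∈ Ioc (0:ℝ) 1, (r:ℂ) ≠ 0 := fun r hr => by exact_mod_cast hr.1.ne'
  have sri : ContDiffOn ℝ 4 (fun r : ℝ => (r:ℂ)⁻¹) (Ioc 0 1) := sr.inv hr0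
  have sri2 : ContDiffOn ℝ 4 (fun r : ℝ => ((r:ℂ) ^ 2)⁻¹) (Ioc 0 1) :=
    (sr.pow 2).inv fun r hr => pow_ne_zero 2 (hr0 r hr)
  have sw : ContDiffOn ℝ 2 (Lop ψ) (Ioc 0 1) := by
    unfold Lop
    exact (s2.add ((sri.of_le (by norm_num)).mul (s3.of_le (by norm_num)))).sub
      ((sri2.of_le (by norm_num)).mul (s4.of_le (by norm_num)))
  have sζ : ContDiffOn ℝ 2 (fun s => Lop ψ s - (n : ℂ) ^ 2 * ψ s) (Ioc 0 1) :=
    sw.sub (contDiffOn_const.mul (s4.of_le (by norm_num)))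
  have sdζ : ContDiffOn ℝ 1 (dz (fun s => Lop ψ s - (n : ℂ) ^ 2 * ψ s)) (Ioc 0 1) :=
    sζ.derivWithin hud (by norm_num)
  set ζ := (fun s => Lop ψ s - (n : ℂ) ^ 2 * ψ s) with hζ
  obtain ⟨L, hL⟩ := sol.ext_dpsi
  obtain ⟨K, hK⟩ := sol.ext_dLpsi
  have er : ∀ r : ℝ, HasDerivAt (fun r : ℝ => (r:ℂ)) 1 r := fun r => (hasDerivAt_id r).ofReal_comp
  have cr0 : Tendsto (fun r : ℝ => (r:ℂ)) (nhdsWithin (0:ℝ) (Ioc 0 1)) (nhds 0) := by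
    have : Tendsto (fun r : ℝ => (r:ℂ)) (nhds 0) (nhds ((0:ℝ):ℂ)) := Complex.continuous_ofReal.tendsto 0
    rw [Complex.ofReal_zero] at this
    exact this.mono_left nhdsWithin_le_nhds
  -- the product rule for dz on (0,1]
  have dzmul : ∀ g : ℝ → ℂ, DifferentiableOn ℝ g (Ioc 0 1) → ∀ r ∈ Ioc (0:ℝ) 1,
      dz (fun s : ℝ => (s:ℂ) * g s) r = g r + r * dz g r := by
    intro g hg r hr
    have h1 := ((er r).hasDerivWithinAt (s := Ioc 0 1)).mul (hg r hr).hasDerivWithinAt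
    have := h1.derivWithin (hud r hr)
    rw [one_mul] at this
    exact this
  have dψ4 := s4.differentiableOn (by norm_num : (4 : WithTop ℕ∞) ≠ 0)
  have dw2 := sw.differentiableOn (by norm_num : (2 : WithTop ℕ∞) ≠ 0)
  have dζ2 := sζ.differentiableOn (by norm_num : (2 : WithTop ℕ∞) ≠ 0)
  have ddψ := s3.differentiableOn (by norm_num : (3 : WithTop ℕ∞) ≠ 0)
  have ddζ := sdζ.differentiableOn (by norm_num : (1 : WithTop ℕ∞) ≠ 0)
  -- the function v
  set v0 : ℝ → ℂ := fun r => dz ψ r + ψ r / r with hv0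
  have cv0 : ContinuousOn v0 (Ioc 0 1) :=
    s3.continuousOn.add (s4.continuousOn.div sr.continuousOn hr0)
  have tv0 : Tendsto v0 (nhdsWithin (0:ℝ) (Ioc 0 1)) (nhds (L + L)) :=
    hL.add (psi_div dψ4 sol.ext_psi hL)
  -- the function Q
  set Q0 : ℝ → ℂ := fun r => dz (fun s : ℝ => (s:ℂ) * Lop ψ s) r - (n:ℂ) ^ 2 * (r * v0 r) with hQ0
  have eQ0 : ∀ r ∈ Ioc (0:ℝ) 1, Q0 r = ζ r + r * dz ζ r := by
    intro r hr
    have h1 := dzmul _ dw2 r hr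
    have h2 : dz ζ r = dz (Lop ψ) r - (n:ℂ) ^ 2 * dz ψ r :=
      ((dw2 r hr).hasDerivWithinAt.sub ((dψ4 r hr).hasDerivWithinAt.const_mul ((n:ℂ) ^ 2))).derivWithin
        (hud r hr)
    have := hr0 r hr
    have h3 : ζ r = Lop ψ r - (n:ℂ) ^ 2 * ψ r := rfl
    rw [h2, h3]
    simp only [hQ0, h1, hv0]
    field_simp
    ring
  have cQ0 : ContinuousOn Q0 (Ioc 0 1) :=
    (sζ.continuousOn.add (sr.continuousOn.mul sdζ.continuousOn)).congr eQ0
  have tQ0 : Tendsto Q0 (nhdsWithin (0:ℝ) (Ioc 0 1)) (nhds (K - (n:ℂ) ^ 2 * (0 * (L + L)))) :=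
    hK.sub ((cr0.mul tv0).const_mul _)
  have hpi := Real.pi_pos
  have hpi3 := Real.pi_gt_three
  set c : ℝ := 4 * α / (4 + α) * (Φ / Real.pi) with hc
  have hc0 : 0 ≤ c := by positivity
  have cz : ∀ r ∈ Ioo (0:ℝ) 1, ∀ (g : ℝ → ℂ) (x : ℂ), Function.update g 0 x r = g r :=
    fun r hr g x => Function.update_of_ne hr.1.ne' _ _
  have u1 : ∀ (g : ℝ → ℂ) (x : ℂ), Function.update g 0 x 1 = g 1 :=
    fun g x => Function.update_of_ne one_ne_zero _ _
  have hζupd : (fun s : ℝ => (s : ℂ) * (Function.update (Lop ψ) 0 0 s - (((n:ℝ):ℂ)) ^ 2 * Function.update ψ 0 0 s))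
      = Function.update (fun s : ℝ => (s:ℂ) * ζ s) 0 0 := by
    ext s
    by_cases hs : s = 0
    · subst hs; simp
    · simp [hs, hζ]
  have cψu := ext_cont s4.continuousOn sol.ext_psi
  have cvu := ext_cont cv0 tv0
  have cwu := ext_cont sw.continuousOn sol.ext_Lpsi
  have v1 : v0 1 = dz ψ 1 := by simp [hv0, sol.bc_psi]
  have main := core (n:ℝ) α c (Ubar Φ α) (Function.update ψ 0 0) (Function.update v0 0 (L + L))
    (Function.update (Lop ψ) 0 0) (Function.update Q0 0 (K - (n:ℂ) ^ 2 * (0 * (L + L)))) Fr Fz (dz Fz)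
    (by exact_mod_cast hn) hα hc0
    (by unfold Ubar; fun_prop)
    (by
      intro r hr
      have := ((((hasDerivAt_id r).pow 2).const_mul (2 * α / (4 + 2 * α))).const_sub 1 |>.const_mul
        ((4 + 2 * α) / (4 + α))).mul_const (Φ / Real.pi)
      refine this.congr_deriv ?_
      simp [hc]
      field_simp
      ring)
    (by
      intro r hr
      have : Ubar Φ α r - c / 2 * (1 - r ^ 2) = 4 / (4 + α) * (Φ / Real.pi) := by
        unfold Ubar
        rw [hc]
        field_simp
        ring
      have h2 : 0 ≤ 4 / (4 + α) * (Φ / Real.pi) := by positivity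
      linarith)
    cψu cvu cwu (ext_cont cQ0 tQ0) cFr cFz.continuousOn (by simp) (by rw [u1, sol.bc_psi])
    (by rw [u1, u1, v1, sol.bc_navier])
    (by
      intro r hr
      refine upd_deriv hr ?_
      rw [cz r hr, cz r hr]
      refine (dz_hasDerivAt dψ4 hr).congr_deriv ?_
      simp [hv0])
    (by
      intro r hr
      refine upd_deriv hr ?_
      rw [cz r hr]
      have h := (dz_hasDerivAt ddψ hr).add ((dz_hasDerivAt dψ4 hr).div (er r) (hr0 r ⟨hr.1, hr.2.le⟩))
      refine h.congr_deriv ?_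
      have := hr0 r ⟨hr.1, hr.2.le⟩
      unfold Lop
      field_simp
      ring)
    (by
      intro r hr
      rw [hζupd, cz r hr]
      refine upd_deriv hr ?_
      have h := (er r).mul (dz_hasDerivAt dζ2 hr)
      refine h.congr_deriv ?_
      rw [eQ0 r ⟨hr.1, hr.2.le⟩]; ring)
    (by
      intro r hr
      refine upd_deriv hr ?_
      rw [cz r hr, cz r hr, cz r hr]
      have h := (dz_hasDerivAt dζ2 hr).add ((er r).mul (dz_hasDerivAt ddζ hr))
      have h' : HasDerivAt Q0 _ r := h.congr_of_eventuallyEq (by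
        filter_upwards [Ioo_mem_nhds hr.1 hr.2] with s hs using eQ0 s ⟨hs.1, hs.2.le⟩)
      refine h'.congr_deriv ?_
      have e := sol.eqn r hr
      have e2 : Lop ζ r = dz (dz ζ) r + ((r : ℂ))⁻¹ * dz ζ r - (((r : ℂ)) ^ 2)⁻¹ * ζ r := rfl
      rw [← hζ, e2] at e
      have hζr : ζ r = Lop ψ r - (n : ℂ) ^ 2 * ψ r := rfl
      rw [← hζr] at e
      have := hr0 r ⟨hr.1, hr.2.le⟩
      rw [eQ0 r ⟨hr.1, hr.2.le⟩]
      simp only [Complex.ofReal_intCast]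
      rw [← hζr]
      have e3 : Complex.I * n * (Ubar Φ α r) * ζ r + (n:ℂ) ^ 2 * ζ r - Complex.I * n * Fr r + dz Fz r
        = dz (dz ζ) r + ((r : ℂ))⁻¹ * dz ζ r - (((r : ℂ)) ^ 2)⁻¹ * ζ r := by
        linear_combination e
      rw [e3]
      field_simp
      ring)
    (by
      intro r hr
      exact dz_hasDerivAt ((cFz.differentiableOn (by norm_num)).mono Ioc_subset_Icc_self) hr)
  have npsi := cψu.norm
  have nv := cvu.norm
  have nw := cwu.norm
  have nFr := cFr.norm
  have nFz := cFz.continuousOn.norm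
  rw [wInt_eq (fun r => ‖Lop ψ r‖ ^ 2 * r) (fun r => r * ‖Function.update (Lop ψ) 0 0 r‖ ^ 2)
      (by fun_prop) (fun r hr => mul_nonneg hr.1 (by positivity))
      (fun r hr => by simp only [cz r hr]; ring),
    wInt_eq (fun r => ‖ψ r‖ ^ 2 * r) (fun r => r * ‖Function.update ψ 0 0 r‖ ^ 2)
      (by fun_prop) (fun r hr => mul_nonneg hr.1 (by positivity))
      (fun r hr => by simp only [cz r hr]; ring),
    wInt_eq (fun r => ‖dz (fun s => (s : ℂ) * ψ s) r‖ ^ 2 / r)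
      (fun r => r * ‖Function.update v0 0 (L + L) r‖ ^ 2)
      (by fun_prop) (fun r hr => mul_nonneg hr.1 (by positivity))
      (fun r hr => by
        simp only [cz r hr]
        have h1 : dz (fun s => (s : ℂ) * ψ s) r = r * v0 r := by
          have := hr0 r ⟨hr.1, hr.2.le⟩
          rw [dzmul _ dψ4 r ⟨hr.1, hr.2.le⟩]
          simp only [hv0]
          field_simp
          ring
        rw [h1, norm_mul, Complex.norm_real, Real.norm_eq_abs, abs_of_pos hr.1]
        have := hr.1.ne'
        field_simp),
    wInt_eq (fun r => (‖Fr r‖ ^ 2 + ‖Fz r‖ ^ 2) * r) (fun r => r * (‖Fr r‖ ^ 2 + ‖Fz r‖ ^ 2))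
      (by fun_prop) (fun r hr => mul_nonneg hr.1 (by positivity))
      (fun r hr => by ring)]
  have nn : ∀ k : ℝ → ℝ, (∀ r ∈ Icc (0:ℝ) 1, 0 ≤ k r) → 0 ≤ ∫ r in (0:ℝ)..1, k r :=
    fun k hk => intervalIntegral.integral_nonneg zero_le_one hk
  have p1 := nn (fun r => r * ‖Function.update (Lop ψ) 0 0 r‖ ^ 2) fun r hr => mul_nonneg hr.1 (by positivity)
  have p2 := nn (fun r => r * ‖Function.update ψ 0 0 r‖ ^ 2) fun r hr => mul_nonneg hr.1 (by positivity)
  have p3 := nn (fun r => r * ‖Function.update v0 0 (L + L) r‖ ^ 2) fun r hr => mul_nonneg hr.1 (by positivity)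
  have p4 := nn (fun r => r * (‖Fr r‖ ^ 2 + ‖Fz r‖ ^ 2)) fun r hr => mul_nonneg hr.1 (by positivity)
  have hn2 : 0 < (n:ℝ) ^ 2 := by positivity
  rw [← ENNReal.ofReal_mul (by positivity), ← ENNReal.ofReal_mul (by positivity),
    ← ENNReal.ofReal_mul (by positivity),
    ← ENNReal.ofReal_add (by positivity) (by positivity),
    ← ENNReal.ofReal_add (by positivity) (by positivity),
    ← ENNReal.ofReal_add (by positivity) (by positivity)]
  apply ENNReal.ofReal_le_ofReal
  rw [u1, v1] at main
  refine main.trans ?_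
  have hcΦ : c ≤ 2 * Φ := by
    have h1 : 4 * α / (4 + α) ≤ 4 := by
      rw [div_le_iff₀ (by positivity)]; linarith
    have h2 : Φ / Real.pi ≤ Φ / 2 := by gcongr; linarith
    calc c ≤ 4 * (Φ / 2) := by rw [hc]; gcongr
      _ = 2 * Φ := by ring
  have h3 : c / (n:ℝ) ^ 2 ≤ 2 * (Φ / (n:ℝ) ^ 2) := by
    rw [← mul_div_assoc]; gcongr
  set F := ∫ r in (0:ℝ)..1, r * (‖Fr r‖ ^ 2 + ‖Fz r‖ ^ 2)
  calc 51 * (1 + c / (n:ℝ) ^ 2) * (F / (n:ℝ) ^ 2)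
      ≤ 102 * (1 + Φ / (n:ℝ) ^ 2) * (F / (n:ℝ) ^ 2) := by
        gcongr ?_ * _
        linarith
    _ = _ := by ring
end

section
/- Let ε₁ ∈ (0,1). There exists a constant C > 0 depending only on ε₁ (independent of Φ, α, n, F^r, F^z) such that for every Φ ≥ 0, every α ≥ 0, and every integer n with |n| ≥ ε₁·√Φ and ε₁·√Φ ≥ 1, every smooth solution ψ of the n-th mode problem with Navier boundary conditions with right-hand side f = i·n·F^r − (F^z)' satisfies: (i) ∫₀¹ |(𝓛ψ)(r)|²·r dr + n²·∫₀¹ |(d/dr)(r·ψ(r))|²·(1/r) dr + n⁴·∫₀¹ |ψ(r)|²·r dr ≤ C·|n|⁻²·∫₀¹ (|F^r|² + |F^z|²)·r dr, and (ii) |n|·∫₀¹ (Ū(r)/r)·|(d/dr)(r·ψ(r))|² dr + |n|³·∫₀¹ Ū(r)·|ψ(r)|²·r dr ≤ C·|n|⁻²·∫₀¹ (|F^r|² + |F^z|²)·r dr. (Proposition 3.4: the case of large flux and high frequency.) -/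
open MeasureTheory Filter

section helpers

open Set Topology

def Gd {E : Type*} [NormedAddCommGroup E] (g : ℝ → E) : Prop :=
  ContinuousOn g (Set.Ioo 0 1) ∧ ∃ K : ℝ, ∀ r ∈ Set.Ioo (0 : ℝ) 1, ‖g r‖ ≤ K

namespace Gd

theorem integrable {E : Type*} [NormedAddCommGroup E] {g : ℝ → E} (h : Gd g) :
    IntegrableOn g (Set.Ioo 0 1) := by
  obtain ⟨hc, K, hK⟩ := h
  refine Integrable.of_bound (hc.aestronglyMeasurable measurableSet_Ioo) K ?_
  filter_upwards [ae_restrict_mem measurableSet_Ioo] with r hr using hK r hr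

theorem add {E : Type*} [NormedAddCommGroup E] {f g : ℝ → E} (hf : Gd f) (hg : Gd g) :
    Gd (fun r => f r + g r) := by
  obtain ⟨hc, K, hK⟩ := hf
  obtain ⟨hc', K', hK'⟩ := hg
  exact ⟨hc.add hc', K + K', fun r hr => (norm_add_le _ _).trans (add_le_add (hK r hr) (hK' r hr))⟩

theorem sub {E : Type*} [NormedAddCommGroup E] {f g : ℝ → E} (hf : Gd f) (hg : Gd g) :
    Gd (fun r => f r - g r) := by
  obtain ⟨hc, K, hK⟩ := hf
  obtain ⟨hc', K', hK'⟩ := hg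
  exact ⟨hc.sub hc', K + K', fun r hr => (norm_sub_le _ _).trans (add_le_add (hK r hr) (hK' r hr))⟩

theorem mul {E : Type*} [NormedRing E] {f g : ℝ → E} (hf : Gd f) (hg : Gd g) :
    Gd (fun r => f r * g r) := by
  obtain ⟨hc, K, hK⟩ := hf
  obtain ⟨hc', K', hK'⟩ := hg
  refine ⟨hc.mul hc', K * K', fun r hr => (norm_mul_le _ _).trans
    (mul_le_mul (hK r hr) (hK' r hr) (norm_nonneg _) ((norm_nonneg _).trans (hK r hr)))⟩

theorem pow2 {f : ℝ → ℝ} (hf : Gd f) : Gd (fun r => f r ^ 2) := by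
  simpa only [pow_two] using hf.mul hf

theorem star {f : ℝ → ℂ} (hf : Gd f) : Gd (fun r => star (f r)) := by
  obtain ⟨hc, K, hK⟩ := hf
  exact ⟨hc.star, K, fun r hr => by simpa using hK r hr⟩

theorem norm {E : Type*} [NormedAddCommGroup E] {f : ℝ → E} (hf : Gd f) : Gd (fun r => ‖f r‖) := by
  obtain ⟨hc, K, hK⟩ := hf
  exact ⟨hc.norm, K, fun r hr => by simpa using hK r hr⟩

theorem ofReal {f : ℝ → ℝ} (hf : Gd f) : Gd (fun r => (f r : ℂ)) := by
  obtain ⟨hc, K, hK⟩ := hf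
  exact ⟨Complex.continuous_ofReal.comp_continuousOn hc, K, fun r hr => by simpa using hK r hr⟩

theorem const {E : Type*} [NormedAddCommGroup E] (c : E) : Gd (fun _ => c) :=
  ⟨continuousOn_const, ‖c‖, fun _ _ => le_rfl⟩

theorem id : Gd (fun r : ℝ => r) :=
  ⟨continuousOn_id, 1, fun r hr => by rw [Real.norm_eq_abs, abs_of_pos hr.1]; exact hr.2.le⟩

theorem of_tendsto {E : Type*} [NormedAddCommGroup E] {g : ℝ → E} {a b : E}
    (hc : ContinuousOn g (Set.Ioo 0 1)) (h0 : Tendsto g (𝓝[>] 0) (𝓝 a))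
    (h1 : Tendsto g (𝓝[<] 1) (𝓝 b)) : Gd g := by
  refine ⟨hc, ?_⟩
  have h := continuousOn_Icc_extendFrom_Ioo hc h0 h1
  obtain ⟨K, hK⟩ := isCompact_Icc.exists_bound_of_continuousOn h
  refine ⟨K, fun r hr => ?_⟩
  have := hK r (Ioo_subset_Icc_self hr)
  rwa [extendFrom_eq (subset_closure hr) (hc r hr)] at this

theorem of_continuousOn {E : Type*} [NormedAddCommGroup E] {g : ℝ → E}
    (hc : ContinuousOn g (Set.Icc 0 1)) : Gd g := by
  obtain ⟨K, hK⟩ := isCompact_Icc.exists_bound_of_continuousOn hc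
  exact ⟨hc.mono Ioo_subset_Icc_self, K, fun r hr => hK r (Ioo_subset_Icc_self hr)⟩

theorem ftc {E : Type*} [NormedAddCommGroup E] [NormedSpace ℝ E] [CompleteSpace E]
    {F F' : ℝ → E} {a b : E} (hF : Gd F')
    (hd : ∀ r ∈ Set.Ioo (0 : ℝ) 1, HasDerivAt F (F' r) r)
    (h0 : Tendsto F (𝓝[>] 0) (𝓝 a)) (h1 : Tendsto F (𝓝[<] 1) (𝓝 b)) :
    ∫ r in Set.Ioo (0 : ℝ) 1, F' r = b - a := by
  rw [← integral_Ioc_eq_integral_Ioo, ← intervalIntegral.integral_of_le zero_le_one]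
  refine intervalIntegral.integral_eq_sub_of_hasDerivAt_of_tendsto zero_lt_one hd ?_ h0 h1
  rw [intervalIntegrable_iff_integrableOn_Ioo_of_le zero_le_one]
  exact hF.integrable

theorem mono_int {f g : ℝ → ℝ} (hf : Gd f) (hg : Gd g)
    (h : ∀ r ∈ Set.Ioo (0 : ℝ) 1, f r ≤ g r) :
    ∫ r in Set.Ioo (0 : ℝ) 1, f r ≤ ∫ r in Set.Ioo (0 : ℝ) 1, g r :=
  setIntegral_mono_on hf.integrable hg.integrable measurableSet_Ioo h

theorem int_add {E : Type*} [NormedAddCommGroup E] [NormedSpace ℝ E] {f g : ℝ → E}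
    (hf : Gd f) (hg : Gd g) :
    ∫ r in Set.Ioo (0 : ℝ) 1, (f r + g r)
      = (∫ r in Set.Ioo (0 : ℝ) 1, f r) + ∫ r in Set.Ioo (0 : ℝ) 1, g r :=
  integral_add hf.integrable hg.integrable

theorem int_sub {E : Type*} [NormedAddCommGroup E] [NormedSpace ℝ E] {f g : ℝ → E}
    (hf : Gd f) (hg : Gd g) :
    ∫ r in Set.Ioo (0 : ℝ) 1, (f r - g r)
      = (∫ r in Set.Ioo (0 : ℝ) 1, f r) - ∫ r in Set.Ioo (0 : ℝ) 1, g r :=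
  integral_sub hf.integrable hg.integrable

theorem wInt_eq {f : ℝ → ℝ} (hf : Gd f) (h0 : ∀ r ∈ Set.Ioo (0 : ℝ) 1, 0 ≤ f r) :
    ∫⁻ r in Set.Ioo (0 : ℝ) 1, ENNReal.ofReal (f r)
     = ENNReal.ofReal (∫ r in Set.Ioo (0 : ℝ) 1, f r) := by
  refine (ofReal_integral_eq_lintegral_ofReal hf.integrable ?_).symm
  filter_upwards [ae_restrict_mem measurableSet_Ioo] with r hr using h0 r hr

theorem tendsto_mul {f k : ℝ → ℂ} (hk : Gd k) {l : Filter ℝ}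
    (hl : ∀ᶠ r in l, r ∈ Set.Ioo (0 : ℝ) 1) (hf : Tendsto f l (𝓝 0)) :
    Tendsto (fun r => f r * k r) l (𝓝 0) := by
  obtain ⟨-, K, hK⟩ := hk
  refine squeeze_zero_norm' (a := fun r => ‖f r‖ * K) ?_ ?_
  · filter_upwards [hl] with r hr
    rw [norm_mul]
    exact mul_le_mul_of_nonneg_left (hK r hr) (norm_nonneg _)
  · simpa using hf.norm.mul_const K

theorem mul_le_of {f k : ℝ → ℂ} (hk : Gd k) {l : Filter ℝ} {g : ℝ → ℂ}
    (hl : ∀ᶠ r in l, r ∈ Set.Ioo (0 : ℝ) 1) (hf : Tendsto f l (𝓝 0))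
    (hg : ∀ r, g r = f r * k r) : Tendsto g l (𝓝 0) := by
  rw [show g = fun r => f r * k r from funext hg]
  exact hk.tendsto_mul hl hf

end Gd

theorem ev0 : ∀ᶠ r in 𝓝[>] (0 : ℝ), r ∈ Set.Ioo (0 : ℝ) 1 := Ioo_mem_nhdsGT zero_lt_one
theorem ev1 : ∀ᶠ r in 𝓝[<] (1 : ℝ), r ∈ Set.Ioo (0 : ℝ) 1 := Ioo_mem_nhdsLT zero_lt_one

theorem core_identity (n a0 c α : ℝ) (h1 : ℂ) (ψ h ω g Λ Fr Fz Fz' : ℝ → ℂ)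
    (gψ : Gd ψ) (gh : Gd h) (gω : Gd ω) (gg : Gd (fun r => (r : ℂ) * g r))
    (gFr : Gd Fr) (gFz : Gd Fz)
    (du : ∀ r ∈ Set.Ioo (0 : ℝ) 1, HasDerivAt (fun r : ℝ => (r : ℂ) * ψ r) (r * h r) r)
    (dh : ∀ r ∈ Set.Ioo (0 : ℝ) 1, HasDerivAt h (ω r) r)
    (dw : ∀ r ∈ Set.Ioo (0 : ℝ) 1, HasDerivAt (fun r : ℝ => (r : ℂ) * ω r) (r * g r) r)
    (dg : ∀ r ∈ Set.Ioo (0 : ℝ) 1, HasDerivAt g (Λ r) r)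
    (dF : ∀ r ∈ Set.Ioo (0 : ℝ) 1, HasDerivAt Fz (Fz' r) r)
    (ψ0 : Tendsto ψ (𝓝[>] 0) (𝓝 0)) (ω0 : Tendsto ω (𝓝[>] 0) (𝓝 0))
    (ψ1 : Tendsto ψ (𝓝[<] 1) (𝓝 0)) (hh1 : Tendsto h (𝓝[<] 1) (𝓝 h1))
    (ω1 : Tendsto ω (𝓝[<] 1) (𝓝 (-(α : ℂ) * h1)))
    (eqn : ∀ r ∈ Set.Ioo (0 : ℝ) 1,
      Complex.I * n * ((a0 - c / 2 * r ^ 2 : ℝ) : ℂ) * (ω r - (n : ℂ) ^ 2 * ψ r)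
      - (Λ r - (n : ℂ) ^ 2 * ω r - (n : ℂ) ^ 2 * (ω r - (n : ℂ) ^ 2 * ψ r))
       = Complex.I * n * Fr r - Fz' r) :
    (∫ r in Set.Ioo (0 : ℝ) 1, (Complex.I * n * ((r : ℂ) * star (ψ r) * Fr r)
          + Fz r * (r * star (h r))))
      - Complex.I * n * (c * (∫ r in Set.Ioo (0 : ℝ) 1, ((r : ℂ) * star (ψ r)) * (r * h r))
        - ((∫ r in Set.Ioo (0 : ℝ) 1, (a0 - c / 2 * r ^ 2) * (r * ‖h r‖ ^ 2) : ℝ) : ℂ)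
        - (n : ℂ) ^ 2
          * ((∫ r in Set.Ioo (0 : ℝ) 1, (a0 - c / 2 * r ^ 2) * (r * ‖ψ r‖ ^ 2) : ℝ) : ℂ))
      + ((∫ r in Set.Ioo (0 : ℝ) 1, r * ‖ω r‖ ^ 2 : ℝ) : ℂ)
      + 2 * (n : ℂ) ^ 2 * ((∫ r in Set.Ioo (0 : ℝ) 1, r * ‖h r‖ ^ 2 : ℝ) : ℂ)
      + (n : ℂ) ^ 4 * ((∫ r in Set.Ioo (0 : ℝ) 1, r * ‖ψ r‖ ^ 2 : ℝ) : ℂ)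
      = ((-α * ‖h1‖ ^ 2 : ℝ) : ℂ) := by
  have gid : Gd (fun r : ℝ => (r : ℂ)) := Gd.id.ofReal
  have gU : Gd (fun r : ℝ => a0 - c / 2 * r ^ 2) :=
    (Gd.const a0).sub ((Gd.const (c / 2)).mul Gd.id.pow2)
  have gS : Gd (fun r : ℝ => Complex.I * n * ((r : ℂ) * star (ψ r) * Fr r)
          + Fz r * (r * star (h r))) :=
    ((Gd.const (Complex.I * n)).mul ((gid.mul gψ.star).mul gFr)).add
      (gFz.mul (gid.mul gh.star))
  have gJ : Gd (fun r : ℝ => ((r : ℂ) * star (ψ r)) * (r * h r)) :=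
    (gid.mul gψ.star).mul (gid.mul gh)
  have gA : Gd (fun r : ℝ => r * ‖ω r‖ ^ 2) := Gd.id.mul gω.norm.pow2
  have gB : Gd (fun r : ℝ => r * ‖h r‖ ^ 2) := Gd.id.mul gh.norm.pow2
  have gD : Gd (fun r : ℝ => r * ‖ψ r‖ ^ 2) := Gd.id.mul gψ.norm.pow2
  have gX := gU.mul gB
  have gY := gU.mul gD
  have k0 := ((Gd.const (c : ℂ)).mul gJ)
  have k1 := k0.sub gX.ofReal
  have k2 := (Gd.const ((n : ℂ) ^ 2)).mul gY.ofReal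
  have k2' := (Gd.const (Complex.I * n)).mul (k1.sub k2)
  have k3 := (gS.sub k2').add gA.ofReal
  have kB := (Gd.const (2 * (n : ℂ) ^ 2)).mul gB.ofReal
  have kD := (Gd.const ((n : ℂ) ^ 4)).mul gD.ofReal
  have k4 := k3.add kB
  have k5 := k4.add kD
  have key : ∫ r in Set.Ioo (0 : ℝ) 1,
      ((Complex.I * n * ((r : ℂ) * star (ψ r) * Fr r) + Fz r * (r * star (h r)))
      - Complex.I * n * (c * (((r : ℂ) * star (ψ r)) * (r * h r))
        - (((a0 - c / 2 * r ^ 2) * (r * ‖h r‖ ^ 2) : ℝ) : ℂ)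
        - (n : ℂ) ^ 2 * (((a0 - c / 2 * r ^ 2) * (r * ‖ψ r‖ ^ 2) : ℝ) : ℂ))
      + ((r * ‖ω r‖ ^ 2 : ℝ) : ℂ)
      + 2 * (n : ℂ) ^ 2 * ((r * ‖h r‖ ^ 2 : ℝ) : ℂ)
      + (n : ℂ) ^ 4 * ((r * ‖ψ r‖ ^ 2 : ℝ) : ℂ)) = ((-α * ‖h1‖ ^ 2 : ℝ) : ℂ) - 0 := by
    refine Gd.ftc (F := fun r : ℝ => Complex.I * n * (((a0 - c / 2 * r ^ 2 : ℝ) : ℂ)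
        * (star ((r : ℂ) * ψ r) * h r)) - star ((r : ℂ) * ψ r) * g r
        + (r * ω r) * star (h r) + 2 * (n : ℂ) ^ 2 * (star ((r : ℂ) * ψ r) * h r)
        + Fz r * star ((r : ℂ) * ψ r)) ?_ ?_ ?_ ?_
    · exact k5
    · intro r hr
      have hu := (du r hr).star
      have hU : HasDerivAt (fun r : ℝ => ((a0 - c / 2 * r ^ 2 : ℝ) : ℂ))
          (((-(c * r) : ℝ)) : ℂ) r := by
        refine HasDerivAt.ofReal_comp ?_
        have := ((hasDerivAt_pow 2 r).const_mul (c / 2)).const_sub a0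
        refine this.congr_deriv ?_
        norm_num
        try ring
      have hq := hu.mul (dh r hr)
      have := ((((((hU.mul hq).const_mul (Complex.I * n)).sub (hu.mul (dg r hr))).add
        ((dw r hr).mul (dh r hr).star)).add (hq.const_mul (2 * (n : ℂ) ^ 2))).add
        ((dF r hr).mul hu))
      refine this.congr_deriv ?_
      have e := eqn r hr
      have hsq : ∀ z : ℂ, ((‖z‖ : ℂ)) ^ 2 = z * star z := fun z => (Complex.mul_conj' z).symm
      have hr' : star (r : ℂ) = r := Complex.conj_ofReal r
      have e2 : Λ r = Complex.I * n * ((a0 - c / 2 * r ^ 2 : ℝ) : ℂ) * (ω r - (n : ℂ) ^ 2 * ψ r)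
          - (- (n : ℂ) ^ 2 * ω r - (n : ℂ) ^ 2 * (ω r - (n : ℂ) ^ 2 * ψ r))
          - (Complex.I * n * Fr r - Fz' r) := by
        rw [← e]; ring
      rw [e2]
      push_cast
      simp only [hsq, star_mul', hr', Pi.mul_apply]
      ring
    · have z : Tendsto (fun r : ℝ => star (ψ r)) (𝓝[>] 0) (𝓝 0) := by
        simpa using ψ0.star
      have t1 := (((Gd.const (Complex.I * n)).mul (gU.ofReal.mul (gid.mul gh)))).mul_le_of
        (g := fun r : ℝ => Complex.I * n * (((a0 - c / 2 * r ^ 2 : ℝ) : ℂ)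
        * (star ((r : ℂ) * ψ r) * h r))) ev0 z (by intro r; simp; ring)
      have t2 := gg.mul_le_of (g := fun r : ℝ => star ((r : ℂ) * ψ r) * g r) ev0 z
        (by intro r; simp; ring)
      have t3 := (gid.mul gh.star).mul_le_of (g := fun r : ℝ => (r * ω r) * star (h r)) ev0 ω0
        (by intro r; ring)
      have t4 := ((Gd.const (2 * (n : ℂ) ^ 2)).mul (gid.mul gh)).mul_le_of
        (g := fun r : ℝ => 2 * (n : ℂ) ^ 2 * (star ((r : ℂ) * ψ r) * h r)) ev0 z
        (by intro r; simp; ring)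
      have t5 := (gFz.mul gid).mul_le_of
        (g := fun r : ℝ => Fz r * star ((r : ℂ) * ψ r)) ev0 z
        (by intro r; simp; ring)
      simpa using (((t1.sub t2).add t3).add t4).add t5
    · have z : Tendsto (fun r : ℝ => star (ψ r)) (𝓝[<] 1) (𝓝 0) := by
        simpa using ψ1.star
      have t1 := (((Gd.const (Complex.I * n)).mul (gU.ofReal.mul (gid.mul gh)))).mul_le_of
        (g := fun r : ℝ => Complex.I * n * (((a0 - c / 2 * r ^ 2 : ℝ) : ℂ)
        * (star ((r : ℂ) * ψ r) * h r))) ev1 z (by intro r; simp; ring)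
      have t2 := gg.mul_le_of (g := fun r : ℝ => star ((r : ℂ) * ψ r) * g r) ev1 z
        (by intro r; simp; ring)
      have hid : Tendsto (fun r : ℝ => (r : ℂ)) (𝓝[<] 1) (𝓝 ((1 : ℝ) : ℂ)) :=
        (Complex.continuous_ofReal.tendsto 1).mono_left nhdsWithin_le_nhds
      have t3 := (hid.mul ω1).mul hh1.star
      have t4 := ((Gd.const (2 * (n : ℂ) ^ 2)).mul (gid.mul gh)).mul_le_of
        (g := fun r : ℝ => 2 * (n : ℂ) ^ 2 * (star ((r : ℂ) * ψ r) * h r)) ev1 z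
        (by intro r; simp; ring)
      have t5 := (gFz.mul gid).mul_le_of
        (g := fun r : ℝ => Fz r * star ((r : ℂ) * ψ r)) ev1 z
        (by intro r; simp; ring)
      have := (((t1.sub t2).add t3).add t4).add t5
      convert this using 2
      have hsq : ∀ z : ℂ, ((‖z‖ : ℂ)) ^ 2 = z * star z := fun z => (Complex.mul_conj' z).symm
      push_cast
      rw [hsq]
      ring
  rw [sub_zero] at key
  rw [Gd.int_add k4 kD, Gd.int_add k3 kB, Gd.int_add (gS.sub k2') gA.ofReal, Gd.int_sub gS k2',
    integral_const_mul, integral_const_mul, integral_const_mul, Gd.int_sub k1 k2,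
    Gd.int_sub k0 gX.ofReal, integral_const_mul, integral_const_mul] at key
  simp only [integral_complex_ofReal] at key
  exact key

theorem final_num (ε n A B D X Y Z P c J G M : ℝ) (hε : 0 < ε) (hn : 1 ≤ |n|)
    (hA : 0 ≤ A) (hB : 0 ≤ B) (hX : 0 ≤ X) (hY : 0 ≤ Y) (hZ : 0 ≤ Z)
    (hJ : 0 ≤ J)
    (e1 : A + 2 * n ^ 2 * B + n ^ 4 * D ≤ M + |n| * (c * J))
    (e2 : |n| * (X + n ^ 2 * Y) ≤ M)
    (e3 : P * J ≤ (ε ^ 2)⁻¹ / 2 * X + P * ε ^ 2 / 2 * Z)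
    (e4 : 2 * |n| ^ 3 * Z ≤ n ^ 2 * B + n ^ 4 * D)
    (e5 : c ≤ 4 * P) (e6 : P * ε ^ 2 ≤ n ^ 2 / 3)
    (e7 : ∀ s > 0, M ≤ s / (2 * n ^ 2) * G + (n ^ 2 * B + n ^ 4 * D) / (2 * s)) :
    A + n ^ 2 * B + n ^ 4 * D ≤ (2 * (1 + 2 / ε ^ 2)) ^ 2 / n ^ 2 * G ∧
    |n| * X + |n| ^ 3 * Y ≤ (2 * (1 + 2 / ε ^ 2)) ^ 2 / n ^ 2 * G := by
  have hn0 : 0 < |n| := by linarith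
  have hn2 : 0 < n ^ 2 := by rw [← sq_abs]; positivity
  set t := (ε ^ 2)⁻¹ with ht
  have ht0 : 0 < t := by positivity
  set K := 2 * (1 + 2 / ε ^ 2) with hK
  have hKt : K = 2 * (1 + 2 * t) := by rw [hK, ht]; ring
  have hK1 : 1 ≤ K := by rw [hKt]; linarith
  set E := A + n ^ 2 * B + n ^ 4 * D with hE
  have hM : 0 ≤ M := le_trans (by positivity) e2
  have hnX : |n| * X ≤ M := by
    have : 0 ≤ |n| * (n ^ 2 * Y) := by positivity
    linarith
  have hc : |n| * (c * J) ≤ 2 * t * M + E / 3 := by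
    have a1 : |n| * (c * J) ≤ |n| * (4 * P * J) := by gcongr
    have a2 : |n| * (P * J) ≤ |n| * (t / 2 * X + P * ε ^ 2 / 2 * Z) := by gcongr
    have a3 : |n| * (P * ε ^ 2 * Z) ≤ |n| * (n ^ 2 / 3 * Z) := by gcongr
    have a4 : |n| * (n ^ 2 / 3 * Z) = |n| ^ 3 * Z / 3 := by rw [← sq_abs n]; ring
    have a5 : t * (|n| * X) ≤ t * M := by gcongr
    nlinarith
  have hEM : E ≤ K * M := by
    rw [hKt]
    have : 0 ≤ n ^ 2 * B := by positivity
    have : 0 ≤ t * M := by positivity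
    nlinarith
  have h7 := e7 K (by linarith)
  have hEBD : (n ^ 2 * B + n ^ 4 * D) / (2 * K) ≤ M / 2 := by
    rw [div_le_iff₀ (by linarith)]
    linarith
  have hMG : M ≤ K / n ^ 2 * G := by
    have : K / (2 * n ^ 2) * G = K / n ^ 2 * G / 2 := by field_simp
    linarith
  have hfin : K * M ≤ K ^ 2 / n ^ 2 * G := by
    calc K * M ≤ K * (K / n ^ 2 * G) := by gcongr
      _ = _ := by ring
  refine ⟨hEM.trans hfin, le_trans ?_ hfin⟩
  have : |n| * X + |n| ^ 3 * Y = |n| * (X + n ^ 2 * Y) := by rw [← sq_abs n]; ring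
  rw [this]
  nlinarith

set_option maxHeartbeats 4000000 in
theorem core_estimate (ε n P a0 c α : ℝ) (h1 : ℂ) (ψ h ω g Λ Fr Fz Fz' : ℝ → ℂ)
    (hε : 0 < ε) (hn : 1 ≤ |n|) (hα : 0 ≤ α) (hP : 0 ≤ P) (hc0 : 0 ≤ c) (hc : c ≤ 4 * P)
    (hPn : P * ε ^ 2 ≤ n ^ 2 / 3)
    (hU : ∀ r ∈ Set.Ioo (0 : ℝ) 1, P * (1 - r ^ 2) ≤ a0 - c / 2 * r ^ 2)
    (gψ : Gd ψ) (gh : Gd h) (gω : Gd ω) (gg : Gd (fun r => (r : ℂ) * g r))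
    (gFr : Gd Fr) (gFz : Gd Fz)
    (hL : ∃ K, ∀ r ∈ Set.Ioo (0 : ℝ) 1, ‖ψ r‖ ≤ K * (1 - r))
    (du : ∀ r ∈ Set.Ioo (0 : ℝ) 1, HasDerivAt (fun r : ℝ => (r : ℂ) * ψ r) (r * h r) r)
    (dh : ∀ r ∈ Set.Ioo (0 : ℝ) 1, HasDerivAt h (ω r) r)
    (dw : ∀ r ∈ Set.Ioo (0 : ℝ) 1, HasDerivAt (fun r : ℝ => (r : ℂ) * ω r) (r * g r) r)
    (dg : ∀ r ∈ Set.Ioo (0 : ℝ) 1, HasDerivAt g (Λ r) r)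
    (dF : ∀ r ∈ Set.Ioo (0 : ℝ) 1, HasDerivAt Fz (Fz' r) r)
    (ψ0 : Tendsto ψ (𝓝[>] 0) (𝓝 0)) (ω0 : Tendsto ω (𝓝[>] 0) (𝓝 0))
    (ψ1 : Tendsto ψ (𝓝[<] 1) (𝓝 0)) (hh1 : Tendsto h (𝓝[<] 1) (𝓝 h1))
    (ω1 : Tendsto ω (𝓝[<] 1) (𝓝 (-(α : ℂ) * h1)))
    (eqn : ∀ r ∈ Set.Ioo (0 : ℝ) 1,
      Complex.I * n * ((a0 - c / 2 * r ^ 2 : ℝ) : ℂ) * (ω r - (n : ℂ) ^ 2 * ψ r)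
      - (Λ r - (n : ℂ) ^ 2 * ω r - (n : ℂ) ^ 2 * (ω r - (n : ℂ) ^ 2 * ψ r))
       = Complex.I * n * Fr r - Fz' r) :
    ((∫ r in Set.Ioo (0 : ℝ) 1, r * ‖ω r‖ ^ 2)
      + n ^ 2 * (∫ r in Set.Ioo (0 : ℝ) 1, r * ‖h r‖ ^ 2)
      + n ^ 4 * (∫ r in Set.Ioo (0 : ℝ) 1, r * ‖ψ r‖ ^ 2)
      ≤ (2 * (1 + 2 / ε ^ 2)) ^ 2 / n ^ 2
        * ∫ r in Set.Ioo (0 : ℝ) 1, (‖Fr r‖ ^ 2 + ‖Fz r‖ ^ 2) * r) ∧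
    (|n| * (∫ r in Set.Ioo (0 : ℝ) 1, (a0 - c / 2 * r ^ 2) * (r * ‖h r‖ ^ 2))
      + |n| ^ 3 * (∫ r in Set.Ioo (0 : ℝ) 1, (a0 - c / 2 * r ^ 2) * (r * ‖ψ r‖ ^ 2))
      ≤ (2 * (1 + 2 / ε ^ 2)) ^ 2 / n ^ 2
        * ∫ r in Set.Ioo (0 : ℝ) 1, (‖Fr r‖ ^ 2 + ‖Fz r‖ ^ 2) * r) := by
  have hn0 : 0 < |n| := by linarith
  have hn2 : 0 < n ^ 2 := by rw [← sq_abs]; positivity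
  have gid : Gd (fun r : ℝ => (r : ℂ)) := Gd.id.ofReal
  have gU : Gd (fun r : ℝ => a0 - c / 2 * r ^ 2) :=
    (Gd.const a0).sub ((Gd.const (c / 2)).mul Gd.id.pow2)
  have hU0 : ∀ r ∈ Set.Ioo (0 : ℝ) 1, 0 ≤ a0 - c / 2 * r ^ 2 := fun r hr => by
    refine le_trans ?_ (hU r hr)
    have : r ^ 2 ≤ 1 := pow_le_one₀ hr.1.le hr.2.le
    have : 0 ≤ 1 - r ^ 2 := by linarith
    positivity
  have gJ : Gd (fun r : ℝ => ((r : ℂ) * star (ψ r)) * (r * h r)) :=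
    (gid.mul gψ.star).mul (gid.mul gh)
  have gA : Gd (fun r : ℝ => r * ‖ω r‖ ^ 2) := Gd.id.mul gω.norm.pow2
  have gB : Gd (fun r : ℝ => r * ‖h r‖ ^ 2) := Gd.id.mul gh.norm.pow2
  have gD : Gd (fun r : ℝ => r * ‖ψ r‖ ^ 2) := Gd.id.mul gψ.norm.pow2
  have gX := gU.mul gB
  have gY := gU.mul gD
  have gS : Gd (fun r : ℝ => Complex.I * n * ((r : ℂ) * star (ψ r) * Fr r)
          + Fz r * (r * star (h r))) :=
    ((Gd.const (Complex.I * n)).mul ((gid.mul gψ.star).mul gFr)).add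
      (gFz.mul (gid.mul gh.star))
  have gG : Gd (fun r : ℝ => (‖Fr r‖ ^ 2 + ‖Fz r‖ ^ 2) * r) :=
    (gFr.norm.pow2.add gFz.norm.pow2).mul Gd.id
  have gu : Gd (fun r : ℝ => r * ‖ψ r‖) := Gd.id.mul gψ.norm
  -- the quotient `|u| / (1 - r²)`
  have gv : Gd (fun r : ℝ => r * ‖ψ r‖ / (1 - r ^ 2)) := by
    obtain ⟨K, hK⟩ := hL
    refine ⟨gu.1.div (by fun_prop) (fun r hr => ?_), K, fun r hr => ?_⟩
    · have := hr.1; have := hr.2; nlinarith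
    · have h0 := hr.1
      have h1 := hr.2
      have : 0 < 1 - r ^ 2 := by nlinarith
      rw [Real.norm_of_nonneg (by positivity), div_le_iff₀ this]
      have hk := hK r hr
      have hK0 : 0 ≤ K * (1 - r) := (norm_nonneg _).trans hk
      nlinarith [norm_nonneg (ψ r)]
  have gZ : Gd (fun r : ℝ => r * ((r * ‖ψ r‖ / (1 - r ^ 2)) * (r * ‖ψ r‖))) :=
    Gd.id.mul (gv.mul gu)
  have gH : Gd (fun r : ℝ => r * (r * ‖ψ r‖ / (1 - r ^ 2)) ^ 2) := Gd.id.mul gv.pow2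
  have nn : ∀ f : ℝ → ℝ, (∀ r ∈ Set.Ioo (0 : ℝ) 1, 0 ≤ f r) →
      0 ≤ ∫ r in Set.Ioo (0 : ℝ) 1, f r := fun f hf => setIntegral_nonneg measurableSet_Ioo hf
  have hnd : ∀ r ∈ Set.Ioo (0 : ℝ) 1, HasDerivAt (fun r : ℝ => ‖(r : ℂ) * ψ r‖ ^ 2)
      (2 * (((r : ℂ) * star (ψ r)) * (r * h r)).re) r := fun r hr => by
    refine (du r hr).norm_sq.congr_deriv ?_
    rw [Complex.inner]
    simp [mul_comm]
  have hnu : ∀ r ∈ Set.Ioo (0 : ℝ) 1, ‖(r : ℂ) * ψ r‖ = r * ‖ψ r‖ := fun r hr => by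
    rw [norm_mul, Complex.norm_real, Real.norm_of_nonneg hr.1.le]
  have u0 : Tendsto (fun r : ℝ => ‖(r : ℂ) * ψ r‖) (𝓝[>] 0) (𝓝 0) := by
    have := (gid.mul_le_of (g := fun r : ℝ => (r : ℂ) * ψ r) ev0 ψ0 (fun r => mul_comm _ _)).norm
    simpa using this
  have u1 : Tendsto (fun r : ℝ => ‖(r : ℂ) * ψ r‖) (𝓝[<] 1) (𝓝 0) := by
    have := (gid.mul_le_of (g := fun r : ℝ => (r : ℂ) * ψ r) ev1 ψ1 (fun r => mul_comm _ _)).norm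
    simpa using this
  have gJre : Gd (fun r : ℝ => 2 * (((r : ℂ) * star (ψ r)) * (r * h r)).re) := by
    refine ⟨continuousOn_const.mul (Complex.continuous_re.comp_continuousOn gJ.1), ?_⟩
    obtain ⟨-, K, hK⟩ := gJ
    refine ⟨2 * K, fun r hr => ?_⟩
    rw [norm_mul]
    have := (Complex.abs_re_le_norm _).trans (hK r hr)
    rw [Real.norm_eq_abs, Real.norm_eq_abs, abs_two]
    linarith
  have hJre : (∫ r in Set.Ioo (0 : ℝ) 1, ((r : ℂ) * star (ψ r)) * (r * h r)).re = 0 := by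
    have e := Gd.ftc gJre hnd (a := 0) (b := 0) (by simpa using u0.pow 2) (by simpa using u1.pow 2)
    rw [integral_const_mul, sub_zero] at e
    have e2 : (∫ r in Set.Ioo (0 : ℝ) 1, (((r : ℂ) * star (ψ r)) * (r * h r)).re)
      = (∫ r in Set.Ioo (0 : ℝ) 1, ((r : ℂ) * star (ψ r)) * (r * h r)).re :=
      integral_re gJ.integrable
    rw [← e2]
    linarith
  -- Hardy inequality
  have hardy : ∫ r in Set.Ioo (0 : ℝ) 1, r * (r * ‖ψ r‖ / (1 - r ^ 2)) ^ 2
      ≤ ∫ r in Set.Ioo (0 : ℝ) 1, r * ‖h r‖ ^ 2 := by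
    have gI : Gd (fun r : ℝ => (1 - r ^ 2)⁻¹ * (2 * (((r : ℂ) * star (ψ r)) * (r * h r)).re)) := by
      refine ⟨ContinuousOn.mul (ContinuousOn.inv₀ (by fun_prop) (fun r hr => ?_)) gJre.1, ?_⟩
      · have := hr.1; have := hr.2; nlinarith
      · obtain ⟨-, K, hK⟩ := gv.mul (Gd.id.mul gh.norm)
        refine ⟨2 * K, fun r hr => ?_⟩
        have h0 := hr.1
        have h1 := hr.2
        have : 0 < 1 - r ^ 2 := by nlinarith
        have b := Complex.abs_re_le_norm (((r : ℂ) * star (ψ r)) * (r * h r))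
        simp only [norm_mul, Complex.norm_real, Real.norm_of_nonneg h0.le, norm_star] at b
        have k := (le_abs_self _).trans (hK r hr)
        rw [norm_mul, norm_mul, Real.norm_of_nonneg (by positivity : 0 ≤ (1 - r ^ 2)⁻¹)]
        rw [Real.norm_eq_abs, Real.norm_eq_abs, abs_two]
        calc _ ≤ (1 - r ^ 2)⁻¹ * (2 * (r * ‖ψ r‖ * (r * ‖h r‖))) := by gcongr
          _ = 2 * (r * ‖ψ r‖ / (1 - r ^ 2) * (r * ‖h r‖)) := by ring
          _ ≤ 2 * K := by linarith
    have gF := gI.add ((Gd.const (2 : ℝ)).mul gH)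
    have lim : ∀ l : Filter ℝ, (∀ᶠ r in l, r ∈ Set.Ioo (0 : ℝ) 1) →
        Tendsto (fun r : ℝ => ‖(r : ℂ) * ψ r‖) l (𝓝 0) →
        Tendsto (fun r : ℝ => ‖(r : ℂ) * ψ r‖ ^ 2 / (1 - r ^ 2)) l (𝓝 0) := by
      intro l hl hu
      obtain ⟨-, K, hK⟩ := gv
      refine squeeze_zero_norm' (a := fun r : ℝ => ‖(r : ℂ) * ψ r‖ * K) ?_ ?_
      · filter_upwards [hl] with r hr
        have : ‖r * ‖ψ r‖ / (1 - r ^ 2)‖ ≤ K := hK r hr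
        rw [← hnu r hr] at this
        rw [show ‖(r : ℂ) * ψ r‖ ^ 2 / (1 - r ^ 2)
          = ‖(r : ℂ) * ψ r‖ * (‖(r : ℂ) * ψ r‖ / (1 - r ^ 2)) by ring, norm_mul, norm_norm]
        gcongr
      · simpa using hu.mul_const K
    have e := Gd.ftc (F := fun r : ℝ => ‖(r : ℂ) * ψ r‖ ^ 2 / (1 - r ^ 2)) gF ?_
      (lim _ ev0 u0) (lim _ ev1 u1)
    · have := Gd.mono_int gH (gB.add gF) ?_
      · rw [Gd.int_add gB gF, e] at this
        linarith
      · intro r hr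
        have h0 := hr.1
        have h1 := hr.2
        have hp : 0 < 1 - r ^ 2 := by nlinarith
        have b := (neg_abs_le _).trans' (neg_le_neg
          (Complex.abs_re_le_norm (((r : ℂ) * star (ψ r)) * (r * h r))))
        simp only [norm_mul, Complex.norm_real, Real.norm_of_nonneg h0.le, norm_star] at b
        have b2 : (1 - r ^ 2)⁻¹ * (2 * -(r * ‖ψ r‖ * (r * ‖h r‖))) ≤
          (1 - r ^ 2)⁻¹ * (2 * (((r : ℂ) * star (ψ r)) * (r * h r)).re) := by gcongr
        have b3 : (1 - r ^ 2)⁻¹ * (2 * -(r * ‖ψ r‖ * (r * ‖h r‖)))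
          = - (2 * r * (r * ‖ψ r‖ / (1 - r ^ 2)) * ‖h r‖) := by ring
        have b4 := mul_nonneg h0.le (sq_nonneg (‖h r‖ - r * ‖ψ r‖ / (1 - r ^ 2)))
        rw [b3] at b2
        nlinarith
    · intro r hr
      have h0 := hr.1
      have h1 := hr.2
      have hp : 1 - r ^ 2 ≠ 0 := by nlinarith
      have d := (hnd r hr).div ((hasDerivAt_pow 2 r).const_sub 1) hp
      refine d.congr_deriv ?_
      rw [hnu r hr]
      norm_num
      field_simp
      try ring
  have hid := core_identity n a0 c α h1 ψ h ω g Λ Fr Fz Fz' gψ gh gω gg gFr gFz du dh dw dg dF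
    ψ0 ω0 ψ1 hh1 ω1 eqn
  set A := ∫ r in Set.Ioo (0 : ℝ) 1, r * ‖ω r‖ ^ 2 with hA
  set B := ∫ r in Set.Ioo (0 : ℝ) 1, r * ‖h r‖ ^ 2 with hB
  set D := ∫ r in Set.Ioo (0 : ℝ) 1, r * ‖ψ r‖ ^ 2 with hD
  set X := ∫ r in Set.Ioo (0 : ℝ) 1, (a0 - c / 2 * r ^ 2) * (r * ‖h r‖ ^ 2) with hX
  set Y := ∫ r in Set.Ioo (0 : ℝ) 1, (a0 - c / 2 * r ^ 2) * (r * ‖ψ r‖ ^ 2) with hY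
  set J := ∫ r in Set.Ioo (0 : ℝ) 1, ((r : ℂ) * star (ψ r)) * (r * h r) with hJ
  set S := ∫ r in Set.Ioo (0 : ℝ) 1, (Complex.I * n * ((r : ℂ) * star (ψ r) * Fr r)
          + Fz r * (r * star (h r))) with hS
  set Z := ∫ r in Set.Ioo (0 : ℝ) 1, r * ((r * ‖ψ r‖ / (1 - r ^ 2)) * (r * ‖ψ r‖)) with hZ
  have hre := congrArg Complex.re hid
  have him := congrArg Complex.im hid
  have pn2 : (n : ℂ) ^ 2 = ((n ^ 2 : ℝ) : ℂ) := by push_cast; rfl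
  have pn4 : (n : ℂ) ^ 4 = ((n ^ 4 : ℝ) : ℂ) := by push_cast; rfl
  simp only [pn2, pn4, Complex.add_re, Complex.sub_re, Complex.mul_re, Complex.ofReal_re,
    Complex.ofReal_im, Complex.I_re, Complex.I_im, Complex.mul_im, Complex.sub_im,
    Complex.re_ofNat, Complex.im_ofNat, hJre] at hre
  simp only [pn2, pn4, Complex.add_im, Complex.add_re, Complex.sub_re, Complex.mul_re,
    Complex.ofReal_re,
    Complex.ofReal_im, Complex.I_re, Complex.I_im, Complex.mul_im, Complex.sub_im,
    Complex.re_ofNat, Complex.im_ofNat, hJre] at him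
  have sre := Complex.abs_re_le_norm S
  have sim := Complex.abs_im_le_norm S
  refine final_num ε n A B D X Y Z P c ‖J‖ _ ‖S‖ hε hn ?_ ?_ ?_ ?_ ?_ (norm_nonneg _) ?_ ?_ ?_ ?_
    hc hPn ?_
  · exact nn _ fun r hr => mul_nonneg hr.1.le (sq_nonneg _)
  · exact nn _ fun r hr => mul_nonneg hr.1.le (sq_nonneg _)
  · exact nn _ fun r hr => mul_nonneg (hU0 r hr) (mul_nonneg hr.1.le (sq_nonneg _))
  · exact nn _ fun r hr => mul_nonneg (hU0 r hr) (mul_nonneg hr.1.le (sq_nonneg _))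
  · refine nn _ fun r hr => ?_
    have h0 := hr.1
    have h1 := hr.2
    have : 0 < 1 - r ^ 2 := by nlinarith
    positivity
  · have a1 : 0 ≤ α * ‖h1‖ ^ 2 := by positivity
    have a2 : -(n * (c * J.im)) ≤ |n| * (c * ‖J‖) := by
      have b := Complex.abs_im_le_norm J
      calc -(n * (c * J.im)) ≤ |n * (c * J.im)| := neg_le_abs _
        _ = |n| * (c * |J.im|) := by rw [abs_mul, abs_mul, abs_of_nonneg hc0]
        _ ≤ _ := by gcongr
    have a3 := neg_le_abs S.re
    nlinarith
  · have : n * (X + n ^ 2 * Y) = - S.im := by nlinarith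
    have hXY : 0 ≤ X + n ^ 2 * Y := by
      have : 0 ≤ X := nn _ fun r hr => mul_nonneg (hU0 r hr) (mul_nonneg hr.1.le (sq_nonneg _))
      have : 0 ≤ Y := nn _ fun r hr => mul_nonneg (hU0 r hr) (mul_nonneg hr.1.le (sq_nonneg _))
      positivity
    rw [← abs_of_nonneg hXY, ← abs_mul, this, abs_neg]
    exact sim
  · have a1 : ‖J‖ ≤ ∫ r in Set.Ioo (0 : ℝ) 1, ‖((r : ℂ) * star (ψ r)) * (r * h r)‖ :=
      norm_integral_le_integral_norm _
    have a2 := Gd.mono_int ((Gd.const P).mul gJ.norm)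
      (((Gd.const ((ε ^ 2)⁻¹ / 2)).mul gX).add ((Gd.const (P * ε ^ 2 / 2)).mul gZ)) ?_
    · rw [Gd.int_add ((Gd.const ((ε ^ 2)⁻¹ / 2)).mul gX) ((Gd.const (P * ε ^ 2 / 2)).mul gZ),
        integral_const_mul, integral_const_mul, integral_const_mul] at a2
      exact (mul_le_mul_of_nonneg_left a1 hP).trans a2
    · intro r hr
      have h0 := hr.1
      have h1 := hr.2
      have hp : 0 < 1 - r ^ 2 := by nlinarith
      simp only [norm_mul, Complex.norm_real, Real.norm_of_nonneg h0.le, norm_star]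
      have b1 := mul_le_mul_of_nonneg_right (hU r hr)
        (by positivity : 0 ≤ (ε ^ 2)⁻¹ / 2 * (r * ‖h r‖ ^ 2))
      have b2 : (P * (1 - r ^ 2)) * ((ε ^ 2)⁻¹ / 2 * (r * ‖h r‖ ^ 2))
          + P * ε ^ 2 / 2 * (r * ((r * ‖ψ r‖ / (1 - r ^ 2)) * (r * ‖ψ r‖)))
          - P * (r * ‖ψ r‖ * (r * ‖h r‖))
          = P * (1 - r ^ 2) * r / 2 * (‖h r‖ / ε - ε * (r * ‖ψ r‖ / (1 - r ^ 2))) ^ 2 := by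
        field_simp
        ring
      have b3 : 0 ≤ P * (1 - r ^ 2) * r / 2
          * (‖h r‖ / ε - ε * (r * ‖ψ r‖ / (1 - r ^ 2))) ^ 2 := by positivity
      linarith
  · have a2 := Gd.mono_int ((Gd.const (2 * |n|)).mul gZ) (gH.add ((Gd.const (n ^ 2)).mul gD)) ?_
    · rw [Gd.int_add gH ((Gd.const (n ^ 2)).mul gD), integral_const_mul, integral_const_mul] at a2
      have a3 : n ^ 2 * (2 * |n| * Z) ≤ n ^ 2 * (B + n ^ 2 * D) := by
        refine mul_le_mul_of_nonneg_left ?_ hn2.le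
        linarith
      have a4 : 2 * |n| ^ 3 * Z = n ^ 2 * (2 * |n| * Z) := by rw [← sq_abs n]; ring
      rw [a4]
      linarith
    · intro r hr
      have h0 := hr.1
      have h1 := hr.2
      have hp : 0 < 1 - r ^ 2 := by nlinarith
      have b1 := mul_nonneg h0.le (sq_nonneg (r * ‖ψ r‖ / (1 - r ^ 2) - |n| * (r * ‖ψ r‖)))
      have b2 : n ^ 2 * (r * (r * ‖ψ r‖) ^ 2) ≤ n ^ 2 * (r * ‖ψ r‖ ^ 2) := by
        have : r * ‖ψ r‖ ≤ ‖ψ r‖ := mul_le_of_le_one_left (norm_nonneg _) h1.le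
        gcongr
      have b3 := sq_abs n
      rw [← b3] at b2 ⊢
      nlinarith
  · intro s hs
    have a1 : ‖S‖ ≤ ∫ r in Set.Ioo (0 : ℝ) 1, ‖Complex.I * n * ((r : ℂ) * star (ψ r) * Fr r)
          + Fz r * (r * star (h r))‖ :=
      norm_integral_le_integral_norm _
    have k1 := (Gd.const (s / (2 * n ^ 2))).mul gG
    have kB := (Gd.const (n ^ 2 / (2 * s))).mul gB
    have kD := (Gd.const (n ^ 4 / (2 * s))).mul gD
    have a2 := Gd.mono_int gS.norm ((k1.add kB).add kD) ?_
    · rw [Gd.int_add (k1.add kB) kD, Gd.int_add k1 kB, integral_const_mul, integral_const_mul,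
        integral_const_mul] at a2
      refine (a1.trans a2).trans (le_of_eq ?_)
      ring
    · intro r hr
      have h0 := hr.1
      refine (norm_add_le _ _).trans ?_
      simp only [norm_mul, Complex.norm_real, Real.norm_of_nonneg h0.le, norm_star,
        Complex.norm_I, one_mul, Real.norm_eq_abs]
      have b1 : 0 ≤ r * s / (2 * |n| ^ 2) * (‖Fr r‖ - |n| ^ 3 / s * ‖ψ r‖) ^ 2 := by positivity
      have b2 : 0 ≤ r * s / (2 * |n| ^ 2) * (‖Fz r‖ - |n| ^ 2 / s * ‖h r‖) ^ 2 := by positivity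
      have b3 : s / (2 * n ^ 2) * ((‖Fr r‖ ^ 2 + ‖Fz r‖ ^ 2) * r) +
          n ^ 2 / (2 * s) * (r * ‖h r‖ ^ 2) + n ^ 4 / (2 * s) * (r * ‖ψ r‖ ^ 2)
          - (|n| * (r * ‖ψ r‖ * ‖Fr r‖) + ‖Fz r‖ * (r * ‖h r‖))
          = r * s / (2 * |n| ^ 2) * (‖Fr r‖ - |n| ^ 3 / s * ‖ψ r‖) ^ 2
          + r * s / (2 * |n| ^ 2) * (‖Fz r‖ - |n| ^ 2 / s * ‖h r‖) ^ 2 := by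
        rw [show n ^ 4 = (n ^ 2) ^ 2 by ring, ← sq_abs n]
        field_simp
        ring
      linarith

theorem Gd.congr {E : Type*} [NormedAddCommGroup E] {f g : ℝ → E} (hf : Gd f)
    (h : ∀ r ∈ Set.Ioo (0 : ℝ) 1, g r = f r) : Gd g := by
  obtain ⟨hc, K, hK⟩ := hf
  exact ⟨hc.congr h, K, fun r hr => by rw [h r hr]; exact hK r hr⟩

theorem dz_hasDerivAt_s15 {f : ℝ → ℂ} {r : ℝ} (hr : r ∈ Set.Ioo (0 : ℝ) 1)
    (hf : DifferentiableAt ℝ f r) : HasDerivAt f (dz f r) r := by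
  have : dz f r = deriv f r := derivWithin_of_mem_nhds (Ioc_mem_nhds hr.1 hr.2)
  rw [this]
  exact hf.hasDerivAt

theorem dz_eq {f : ℝ → ℂ} {f' : ℂ} {r : ℝ} (hr : r ∈ Set.Ioo (0 : ℝ) 1)
    (hf : HasDerivAt f f' r) : dz f r = f' :=
  (dz_hasDerivAt_s15 hr hf.differentiableAt).unique hf

theorem cd_hasDerivAt {f : ℝ → ℂ} {m : WithTop ℕ∞} (hm : m ≠ 0) {r : ℝ}
    (hr : r ∈ Set.Ioo (0 : ℝ) 1)
    (hf : ContDiffOn ℝ m f (Set.Ioc 0 1)) : HasDerivAt f (dz f r) r :=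
  dz_hasDerivAt_s15 hr ((hf.differentiableOn hm r (Ioo_subset_Ioc_self hr)).differentiableAt
    (Ioc_mem_nhds hr.1 hr.2))

theorem cd_dz {f : ℝ → ℂ} {m k : WithTop ℕ∞} (hm : k + 1 ≤ m)
    (hf : ContDiffOn ℝ m f (Set.Ioc 0 1)) : ContDiffOn ℝ k (dz f) (Set.Ioc 0 1) :=
  hf.derivWithin (uniqueDiffOn_Ioc 0 1) hm

theorem cd_ofReal {k : WithTop ℕ∞} {s : Set ℝ} : ContDiffOn ℝ k (fun r : ℝ => (r : ℂ)) s :=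
  Complex.ofRealCLM.contDiff.contDiffOn

theorem cd_Lop {f : ℝ → ℂ} (hf : ContDiffOn ℝ 4 f (Set.Ioc 0 1)) :
    ContDiffOn ℝ 2 (Lop f) (Set.Ioc 0 1) := by
  have h1 : ContDiffOn ℝ 3 (dz f) (Set.Ioc 0 1) := cd_dz (by norm_num) hf
  have h2 : ContDiffOn ℝ 2 (dz (dz f)) (Set.Ioc 0 1) := cd_dz (by norm_num) h1
  have hne : ∀ r ∈ Set.Ioc (0 : ℝ) 1, (r : ℂ) ≠ 0 := fun r hr => by
    simpa using hr.1.ne'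
  refine (h2.add ((cd_ofReal.inv hne).mul (h1.of_le (by norm_num)))).sub
    (((cd_ofReal.pow 2).inv (fun r hr => pow_ne_zero 2 (hne r hr))).mul (hf.of_le (by norm_num)))

theorem lim0 {f : ℝ → ℂ} {a : ℂ} (h : Tendsto f (𝓝[Set.Ioc 0 1] 0) (𝓝 a)) :
    Tendsto f (𝓝[>] 0) (𝓝 a) := by
  rwa [nhdsWithin_Ioc_eq_nhdsGT zero_lt_one] at h

theorem lim1 {f : ℝ → ℂ} (h : ContinuousOn f (Set.Ioc 0 1)) :
    Tendsto f (𝓝[<] 1) (𝓝 (f 1)) := by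
  have := h 1 ⟨zero_lt_one, le_rfl⟩
  rw [ContinuousWithinAt, nhdsWithin_Ioc_eq_nhdsLE zero_lt_one] at this
  exact this.mono_left (nhdsWithin_mono _ Set.Iio_subset_Iic_self)

theorem der_u {f : ℝ → ℂ} (hf : ContDiffOn ℝ 2 f (Set.Ioc 0 1)) {r : ℝ}
    (hr : r ∈ Set.Ioo (0 : ℝ) 1) :
    HasDerivAt (fun r : ℝ => (r : ℂ) * f r) (r * (f r / r + dz f r)) r := by
  have h1 := cd_hasDerivAt (by norm_num) hr hf
  have hne : (r : ℂ) ≠ 0 := by simpa using hr.1.ne'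
  have h0 : HasDerivAt (fun r : ℝ => (r : ℂ)) 1 r := Complex.ofRealCLM.hasDerivAt
  refine (h0.mul h1).congr_deriv ?_
  field_simp

theorem der_h {f : ℝ → ℂ} (hf : ContDiffOn ℝ 2 f (Set.Ioc 0 1)) {r : ℝ}
    (hr : r ∈ Set.Ioo (0 : ℝ) 1) :
    HasDerivAt (fun r : ℝ => f r / r + dz f r) (Lop f r) r := by
  have h1 := cd_hasDerivAt (by norm_num) hr hf
  have h2 := cd_hasDerivAt one_ne_zero hr (cd_dz (k := 1) (by norm_num) hf)
  have hne : (r : ℂ) ≠ 0 := by simpa using hr.1.ne'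
  have h0 : HasDerivAt (fun r : ℝ => (r : ℂ)) 1 r := Complex.ofRealCLM.hasDerivAt
  refine ((h1.div h0 hne).add h2).congr_deriv ?_
  unfold Lop
  field_simp
  ring

theorem Lop_sub {f g : ℝ → ℂ} (c : ℂ) (hf : ContDiffOn ℝ 2 f (Set.Ioc 0 1))
    (hg : ContDiffOn ℝ 2 g (Set.Ioc 0 1)) {r : ℝ} (hr : r ∈ Set.Ioo (0 : ℝ) 1) :
    Lop (fun s => f s - c * g s) r = Lop f r - c * Lop g r := by
  have e1 : ∀ s ∈ Set.Ioo (0 : ℝ) 1, dz (fun s => f s - c * g s) s = dz f s - c * dz g s :=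
    fun s hs => dz_eq hs ((cd_hasDerivAt (by norm_num) hs hf).sub
      ((cd_hasDerivAt (by norm_num) hs hg).const_mul c))
  have e2 : dz (dz (fun s => f s - c * g s)) r = dz (dz f) r - c * dz (dz g) r := by
    refine dz_eq hr ?_
    have := (cd_hasDerivAt one_ne_zero hr (cd_dz (k := 1) (by norm_num) hf)).sub
      ((cd_hasDerivAt one_ne_zero hr (cd_dz (k := 1) (by norm_num) hg)).const_mul c)
    refine this.congr_of_eventuallyEq ?_
    filter_upwards [Ioo_mem_nhds hr.1 hr.2] with s hs using e1 s hs
  unfold Lop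
  rw [e2, e1 r hr]
  ring

theorem main_real (ε Φ α : ℝ) (n : ℤ) (Fr Fz ψ : ℝ → ℂ) (hε : 0 < ε)
    (hΦ : 0 ≤ Φ) (hα : 0 ≤ α) (h1 : 1 ≤ ε * Real.sqrt Φ) (h2 : ε * Real.sqrt Φ ≤ |(n : ℝ)|)
    (hFr : ContinuousOn Fr (Set.Icc 0 1)) (hFz : ContDiffOn ℝ 1 Fz (Set.Icc 0 1))
    (sol : NavierSol Φ α n (fun r => Complex.I * (n : ℂ) * Fr r - dz Fz r) ψ) :
    (wInt (fun r => ‖Lop ψ r‖ ^ 2 * r)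
        + ENNReal.ofReal ((n : ℝ) ^ 2)
            * wInt (fun r => ‖dz (fun s => (s : ℂ) * ψ s) r‖ ^ 2 / r)
        + ENNReal.ofReal ((n : ℝ) ^ 4) * wInt (fun r => ‖ψ r‖ ^ 2 * r)
          ≤ ENNReal.ofReal ((2 * (1 + 2 / ε ^ 2)) ^ 2 / (n : ℝ) ^ 2)
              * wInt (fun r => (‖Fr r‖ ^ 2 + ‖Fz r‖ ^ 2) * r)) ∧
      (ENNReal.ofReal |(n : ℝ)|
          * wInt (fun r => (Ubar Φ α r / r) * ‖dz (fun s => (s : ℂ) * ψ s) r‖ ^ 2)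
        + ENNReal.ofReal (|(n : ℝ)| ^ 3)
            * wInt (fun r => Ubar Φ α r * ‖ψ r‖ ^ 2 * r)
          ≤ ENNReal.ofReal ((2 * (1 + 2 / ε ^ 2)) ^ 2 / (n : ℝ) ^ 2)
              * wInt (fun r => (‖Fr r‖ ^ 2 + ‖Fz r‖ ^ 2) * r)) := by
  have c4 := sol.smooth
  have c2 : ContDiffOn ℝ 2 ψ (Set.Ioc 0 1) := c4.of_le (by norm_num)
  have cω := cd_Lop c4
  have cdψ : ContDiffOn ℝ 3 (dz ψ) (Set.Ioc 0 1) := cd_dz (by norm_num) c4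
  have crω : ContDiffOn ℝ 2 (fun r : ℝ => (r : ℂ) * Lop ψ r) (Set.Ioc 0 1) := cd_ofReal.mul cω
  have cdrω : ContDiffOn ℝ 1 (dz (fun r : ℝ => (r : ℂ) * Lop ψ r)) (Set.Ioc 0 1) :=
    cd_dz (by norm_num) crω
  have mono : Set.Ioo (0 : ℝ) 1 ⊆ Set.Ioc 0 1 := Ioo_subset_Ioc_self
  have ψ0 := lim0 sol.ext_psi
  have ψ1 := lim1 c4.continuousOn
  rw [sol.bc_psi] at ψ1
  obtain ⟨L, hL⟩ := sol.ext_dpsi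
  have dψ1 := lim1 cdψ.continuousOn
  have ω0 := lim0 sol.ext_Lpsi
  have ω1 := lim1 cω.continuousOn
  obtain ⟨L', hL'⟩ := sol.ext_dLpsi
  have gψ : Gd ψ := Gd.of_tendsto (c4.continuousOn.mono mono) ψ0 ψ1
  have gdψ : Gd (dz ψ) := Gd.of_tendsto (cdψ.continuousOn.mono mono) (lim0 hL) dψ1
  have gω : Gd (Lop ψ) := Gd.of_tendsto (cω.continuousOn.mono mono) ω0 ω1
  have gdrω := Gd.of_tendsto (cdrω.continuousOn.mono mono) (lim0 hL') (lim1 cdrω.continuousOn)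
  have gg : Gd (fun r : ℝ => (r : ℂ) * (Lop ψ r / r + dz (Lop ψ) r)) :=
    gdrω.congr fun r hr => (dz_eq hr (der_u cω hr)).symm
  obtain ⟨K, hK⟩ := gdψ.2
  have lip : ∀ r ∈ Set.Ioo (0 : ℝ) 1, ∀ s ∈ Set.Ioo (0 : ℝ) 1, ‖ψ s - ψ r‖ ≤ K * |s - r| :=
    fun r hr s hs => (convex_Ioo (0 : ℝ) 1).norm_image_sub_le_of_norm_hasDerivWithin_le
      (fun x hx => (cd_hasDerivAt (by norm_num) hx c2).hasDerivWithinAt) hK hr hs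
  have lip0 : ∀ r ∈ Set.Ioo (0 : ℝ) 1, ‖ψ r‖ ≤ K * r := fun r hr => by
    have t1 : Tendsto (fun s => ‖ψ s - ψ r‖) (𝓝[>] 0) (𝓝 ‖0 - ψ r‖) := (ψ0.sub_const _).norm
    have t2 : Tendsto (fun s => K * |s - r|) (𝓝[>] 0) (𝓝 (K * |0 - r|)) :=
      ((by fun_prop : Continuous fun s => K * |s - r|).tendsto 0).mono_left nhdsWithin_le_nhds
    have := le_of_tendsto_of_tendsto t1 t2 (ev0.mono fun s hs => lip r hr s hs)
    simpa [abs_of_pos hr.1] using this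
  have lip1 : ∀ r ∈ Set.Ioo (0 : ℝ) 1, ‖ψ r‖ ≤ K * (1 - r) := fun r hr => by
    have t1 : Tendsto (fun s => ‖ψ s - ψ r‖) (𝓝[<] 1) (𝓝 ‖0 - ψ r‖) := (ψ1.sub_const _).norm
    have t2 : Tendsto (fun s => K * |s - r|) (𝓝[<] 1) (𝓝 (K * |1 - r|)) :=
      ((by fun_prop : Continuous fun s => K * |s - r|).tendsto 1).mono_left nhdsWithin_le_nhds
    have := le_of_tendsto_of_tendsto t1 t2 (ev1.mono fun s hs => lip r hr s hs)
    simpa [abs_of_pos (sub_pos.2 hr.2)] using this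
  have gh : Gd (fun r : ℝ => ψ r / r + dz ψ r) := by
    refine Gd.add ⟨gψ.1.div Complex.continuous_ofReal.continuousOn
      (fun r hr => by simpa using hr.1.ne'), K, fun r hr => ?_⟩ gdψ
    rw [norm_div, Complex.norm_real, Real.norm_of_nonneg hr.1.le, div_le_iff₀ hr.1]
    exact lip0 r hr
  have hid : Tendsto (fun r : ℝ => (r : ℂ)) (𝓝[<] 1) (𝓝 ((1 : ℝ) : ℂ)) :=
    (Complex.continuous_ofReal.tendsto 1).mono_left nhdsWithin_le_nhds
  have hh1 : Tendsto (fun r : ℝ => ψ r / r + dz ψ r) (𝓝[<] 1) (𝓝 (dz ψ 1)) := by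
    simpa using (ψ1.div hid (by simp)).add dψ1
  rw [sol.bc_navier] at ω1
  have gFr : Gd Fr := Gd.of_continuousOn hFr
  have gFz : Gd Fz := Gd.of_continuousOn hFz.continuousOn
  have dF : ∀ r ∈ Set.Ioo (0 : ℝ) 1, HasDerivAt Fz (dz Fz r) r := fun r hr =>
    dz_hasDerivAt_s15 hr ((hFz.differentiableOn one_ne_zero r
      (Ioo_subset_Icc_self hr)).differentiableAt (Icc_mem_nhds hr.1 hr.2))
  have hn : 1 ≤ |(n : ℝ)| := h1.trans h2
  have hP : 0 ≤ Φ / Real.pi := div_nonneg hΦ Real.pi_pos.le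
  have hUbar : ∀ r, Ubar Φ α r = (4 + 2 * α) / (4 + α) * (Φ / Real.pi)
      - (4 * α / (4 + α) * (Φ / Real.pi)) / 2 * r ^ 2 := fun r => by
    unfold Ubar
    have : 4 + α ≠ 0 := by positivity
    have : 4 + 2 * α ≠ 0 := by positivity
    field_simp
    ring
  have hPn : Φ / Real.pi * ε ^ 2 ≤ (n : ℝ) ^ 2 / 3 := by
    have a1 : ε ^ 2 * Φ ≤ (n : ℝ) ^ 2 := by
      have := pow_le_pow_left₀ (by linarith) h2 2
      rwa [mul_pow, Real.sq_sqrt hΦ, sq_abs] at this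
    have a2 : Φ / Real.pi ≤ Φ / 3 := by
      have := Real.pi_gt_three
      gcongr
    nlinarith [mul_le_mul_of_nonneg_right a2 (sq_nonneg ε)]
  have hU : ∀ r ∈ Set.Ioo (0 : ℝ) 1, Φ / Real.pi * (1 - r ^ 2) ≤
      (4 + 2 * α) / (4 + α) * (Φ / Real.pi)
      - (4 * α / (4 + α) * (Φ / Real.pi)) / 2 * r ^ 2 := fun r hr => by
    have e : (4 + 2 * α) / (4 + α) * (Φ / Real.pi)
      - (4 * α / (4 + α) * (Φ / Real.pi)) / 2 * r ^ 2
      - Φ / Real.pi * (1 - r ^ 2)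
      = Φ / Real.pi * ((α * (1 - r ^ 2) + 4 * r ^ 2) / (4 + α)) := by
      have : 4 + α ≠ 0 := by positivity
      field_simp
      ring
    have : 0 ≤ 1 - r ^ 2 := by have := hr.1; have := hr.2; nlinarith
    have : 0 ≤ Φ / Real.pi * ((α * (1 - r ^ 2) + 4 * r ^ 2) / (4 + α)) := by positivity
    linarith
  have hc : 4 * α / (4 + α) * (Φ / Real.pi) ≤ 4 * (Φ / Real.pi) := by
    refine mul_le_mul_of_nonneg_right ?_ hP
    rw [div_le_iff₀ (by positivity)]
    linarith
  have core := core_estimate ε n (Φ / Real.pi) ((4 + 2 * α) / (4 + α) * (Φ / Real.pi))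
    (4 * α / (4 + α) * (Φ / Real.pi)) α (dz ψ 1) ψ (fun r : ℝ => ψ r / r + dz ψ r) (Lop ψ)
    (fun r : ℝ => Lop ψ r / r + dz (Lop ψ) r) (Lop (Lop ψ)) Fr Fz (dz Fz)
    hε hn hα hP (by positivity) hc hPn hU gψ gh gω gg gFr gFz ⟨K, lip1⟩
    (fun r hr => der_u c2 hr) (fun r hr => der_h c2 hr) (fun r hr => der_u cω hr)
    (fun r hr => der_h cω hr) dF ψ0 ω0 ψ1 hh1 ω1 ?_
  · have hU0 : ∀ r ∈ Set.Ioo (0 : ℝ) 1, 0 ≤ Ubar Φ α r := fun r hr => by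
      rw [hUbar]
      refine le_trans ?_ (hU r hr)
      have : 0 ≤ 1 - r ^ 2 := by have := hr.1; have := hr.2; nlinarith
      positivity
    have gU : Gd (Ubar Φ α) :=
      ((Gd.const _).sub ((Gd.const _).mul Gd.id.pow2)).congr fun r _ => hUbar r
    simp only [← hUbar] at core
    have key : ∀ (f g : ℝ → ℝ), Gd g → (∀ r ∈ Set.Ioo (0 : ℝ) 1, 0 ≤ g r) →
        (∀ r ∈ Set.Ioo (0 : ℝ) 1, f r = g r) →
        wInt f = ENNReal.ofReal (∫ r in Set.Ioo (0 : ℝ) 1, g r) := by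
      intro f g hg h0 hfg
      rw [← Gd.wInt_eq hg h0]
      exact setLIntegral_congr_fun measurableSet_Ioo fun r hr => by simp only [hfg r hr]
    have nn : ∀ f : ℝ → ℝ, (∀ r ∈ Set.Ioo (0 : ℝ) 1, 0 ≤ f r) →
      0 ≤ ∫ r in Set.Ioo (0 : ℝ) 1, f r := fun f hf => setIntegral_nonneg measurableSet_Ioo hf
    have sq0 : ∀ (f : ℝ → ℂ), ∀ r ∈ Set.Ioo (0 : ℝ) 1, 0 ≤ r * ‖f r‖ ^ 2 :=
      fun f r hr => mul_nonneg hr.1.le (sq_nonneg _)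
    have sqU0 : ∀ (f : ℝ → ℂ), ∀ r ∈ Set.Ioo (0 : ℝ) 1, 0 ≤ Ubar Φ α r * (r * ‖f r‖ ^ 2) :=
      fun f r hr => mul_nonneg (hU0 r hr) (sq0 f r hr)
    have edz : ∀ r ∈ Set.Ioo (0 : ℝ) 1, ‖dz (fun s => (s : ℂ) * ψ s) r‖
        = r * ‖ψ r / r + dz ψ r‖ := fun r hr => by
      rw [dz_eq hr (der_u c2 hr), norm_mul, Complex.norm_real, Real.norm_of_nonneg hr.1.le]
    have sB := sq0 (fun r : ℝ => ψ r / r + dz ψ r)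
    have sX := sqU0 (fun r : ℝ => ψ r / r + dz ψ r)
    have gB := Gd.id.mul gh.norm.pow2
    have gD := Gd.id.mul gψ.norm.pow2
    have wA := key (fun r => ‖Lop ψ r‖ ^ 2 * r) _ (Gd.id.mul gω.norm.pow2) (sq0 _)
      (fun r hr => mul_comm _ _)
    have wB := key (fun r => ‖dz (fun s => (s : ℂ) * ψ s) r‖ ^ 2 / r) _ gB sB
      (fun r hr => by rw [edz r hr]; have := hr.1.ne'; field_simp)
    have wD := key (fun r => ‖ψ r‖ ^ 2 * r) _ gD (sq0 _) (fun r hr => mul_comm _ _)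
    have wX := key (fun r => (Ubar Φ α r / r) * ‖dz (fun s => (s : ℂ) * ψ s) r‖ ^ 2) _
      (gU.mul gB) sX (fun r hr => by rw [edz r hr]; have := hr.1.ne'; field_simp)
    have wY := key (fun r => Ubar Φ α r * ‖ψ r‖ ^ 2 * r) _ (gU.mul gD) (sqU0 _)
      (fun r hr => by ring)
    have wG := key (fun r => (‖Fr r‖ ^ 2 + ‖Fz r‖ ^ 2) * r) _
      ((gFr.norm.pow2.add gFz.norm.pow2).mul Gd.id)
      (fun r hr => mul_nonneg (by positivity) hr.1.le) (fun r hr => rfl)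
    have pA := nn _ (sq0 (Lop ψ))
    have pB := nn _ sB
    have pD := nn _ (sq0 ψ)
    have pX := nn _ sX
    have pY := nn _ (sqU0 ψ)
    rw [wA, wB, wD, wX, wY, wG]
    constructor
    · rw [← ENNReal.ofReal_mul (by positivity), ← ENNReal.ofReal_mul (by positivity),
        ← ENNReal.ofReal_mul (by positivity), ← ENNReal.ofReal_add pA (by positivity),
        ← ENNReal.ofReal_add (by positivity) (by positivity)]
      exact ENNReal.ofReal_le_ofReal core.1
    · rw [← ENNReal.ofReal_mul (by positivity), ← ENNReal.ofReal_mul (by positivity),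
        ← ENNReal.ofReal_mul (by positivity), ← ENNReal.ofReal_add (by positivity) (by positivity)]
      exact ENNReal.ofReal_le_ofReal core.2
  · intro r hr
    have e := sol.eqn r hr
    rw [Lop_sub _ cω c2 hr] at e
    rw [← hUbar]
    push_cast
    exact e

end helpers

/-- Proposition 3.4: the case of large flux and high frequency. For each `ε₁ ∈ (0,1)`,
there is `C = C(ε₁) > 0` such that whenever `1 ≤ ε₁√Φ ≤ |n|` and
`f = i n F^r − (F^z)'`, the two stated estimates hold. -/
theorem high_frequency_estimate (ε₁ : ℝ) (hε₁0 : 0 < ε₁) (hε₁1 : ε₁ < 1) :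
    ∃ C : ℝ, 0 < C ∧ ∀ (Φ α : ℝ) (n : ℤ) (Fr Fz ψ : ℝ → ℂ),
      0 ≤ Φ → 0 ≤ α →
      1 ≤ ε₁ * Real.sqrt Φ → ε₁ * Real.sqrt Φ ≤ |(n : ℝ)| →
      ContinuousOn Fr (Set.Icc 0 1) → ContDiffOn ℝ 1 Fz (Set.Icc 0 1) →
      NavierSol Φ α n (fun r => Complex.I * (n : ℂ) * Fr r - dz Fz r) ψ →
      (wInt (fun r => ‖Lop ψ r‖ ^ 2 * r)
        + ENNReal.ofReal ((n : ℝ) ^ 2)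
            * wInt (fun r => ‖dz (fun s => (s : ℂ) * ψ s) r‖ ^ 2 / r)
        + ENNReal.ofReal ((n : ℝ) ^ 4) * wInt (fun r => ‖ψ r‖ ^ 2 * r)
          ≤ ENNReal.ofReal (C / (n : ℝ) ^ 2)
              * wInt (fun r => (‖Fr r‖ ^ 2 + ‖Fz r‖ ^ 2) * r)) ∧
      (ENNReal.ofReal |(n : ℝ)|
          * wInt (fun r => (Ubar Φ α r / r) * ‖dz (fun s => (s : ℂ) * ψ s) r‖ ^ 2)
        + ENNReal.ofReal (|(n : ℝ)| ^ 3)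
            * wInt (fun r => Ubar Φ α r * ‖ψ r‖ ^ 2 * r)
          ≤ ENNReal.ofReal (C / (n : ℝ) ^ 2)
              * wInt (fun r => (‖Fr r‖ ^ 2 + ‖Fz r‖ ^ 2) * r)) := by
  refine ⟨(2 * (1 + 2 / ε₁ ^ 2)) ^ 2, by positivity, ?_⟩
  intro Φ α n Fr Fz ψ hΦ hα h1 h2 hFr hFz sol
  exact main_real ε₁ Φ α n Fr Fz ψ hε₁0 hΦ hα h1 h2 hFr hFz sol
end

section
/- There exists a constant C > 0, independent of Φ, α, n and f, such that for every Φ > 0, every α ≥ 0, every nonzero integer n, every continuous f on (0,1) with ∫₀¹|f|²·r dr < ∞, and every smooth solution ψ of the n-th mode problem with slip boundary conditions, the following four estimates hold: (i) ∫₀¹ |(d/dr)(r·ψ)|²·(1/r) dr + n²·∫₀¹ |ψ|²·r dr ≤ C·(Φ·|n|)⁻²·(4+α)²·∫₀¹ |f|²·r dr; (ii) ∫₀¹ |𝓛ψ|²·r dr + n²·∫₀¹ |(d/dr)(r·ψ)|²·(1/r) dr + n⁴·∫₀¹ |ψ|²·r dr ≤ C·(Φ·|n|)⁻²·(4+α)²·∫₀¹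 |f|²·r dr; (iii) ∫₀¹ |(d/dr)(r·𝓛ψ)|²·(1/r) dr + n²·∫₀¹ |𝓛ψ|²·r dr + n⁴·∫₀¹ |(d/dr)(r·ψ)|²·(1/r) dr + n⁶·∫₀¹ |ψ|²·r dr ≤ C·(Φ·|n|)⁻¹·(4+α)·∫₀¹ |f|²·r dr; (iv) |(d/dr)(r·ψ)(1)| ≤ C·(Φ·|n|)⁻¹·(4+α)·(∫₀¹ |f|²·r dr)^{1/2}. (Lemma 3.5 (propslip): a priori estimates for the auxiliary slip problem.) -/
open MeasureTheory Filter

/-- A smooth solution of the `n`-th mode problem with slip boundary conditions: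
`ψ` is four times continuously differentiable on `(0,1]`; `ψ`, `ψ'`, `𝓛ψ` and
`(d/dr)(r 𝓛ψ)` extend continuously to `[0,1]`;
`i n Ū (𝓛−n²)ψ − (𝓛−n²)²ψ = f` on `(0,1)`; `ψ(0) = ψ(1) = (𝓛ψ)(0) = 0` and
`(𝓛ψ)(1) = 0`; and the relevant weighted integrals are finite. -/
structure SlipSol (Φ α : ℝ) (n : ℤ) (f ψ : ℝ → ℂ) : Prop where
  smooth : ContDiffOn ℝ 4 ψ (Set.Ioc 0 1)
  /-- `ψ` extends continuously to `[0,1]` with `ψ(0) = 0`. -/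
  ext_psi : Filter.Tendsto ψ (nhdsWithin (0 : ℝ) (Set.Ioc 0 1)) (nhds (0 : ℂ))
  /-- `ψ'` extends continuously to `[0,1]`. -/
  ext_dpsi : ∃ L : ℂ, Filter.Tendsto (dz ψ) (nhdsWithin (0 : ℝ) (Set.Ioc 0 1)) (nhds L)
  /-- `𝓛ψ` extends continuously to `[0,1]` with `(𝓛ψ)(0) = 0`. -/
  ext_Lpsi : Filter.Tendsto (Lop ψ) (nhdsWithin (0 : ℝ) (Set.Ioc 0 1)) (nhds (0 : ℂ))
  /-- `(d/dr)(r 𝓛ψ)` extends continuously to `[0,1]`. -/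
  ext_dLpsi : ∃ L : ℂ, Filter.Tendsto (dz (fun r => (r : ℂ) * Lop ψ r))
    (nhdsWithin (0 : ℝ) (Set.Ioc 0 1)) (nhds L)
  bc_psi : ψ 1 = 0
  bc_slip : Lop ψ 1 = 0
  eqn : ∀ r ∈ Set.Ioo (0 : ℝ) 1,
    Complex.I * (n : ℂ) * (Ubar Φ α r : ℂ) * (Lop ψ r - (n : ℂ) ^ 2 * ψ r)
      - (Lop (fun s => Lop ψ s - (n : ℂ) ^ 2 * ψ s) r
          - (n : ℂ) ^ 2 * (Lop ψ r - (n : ℂ) ^ 2 * ψ r)) = f r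
  fin_psi : wInt (fun r => ‖ψ r‖ ^ 2 * r) < ⊤
  fin_dpsi : wInt (fun r => ‖dz (fun s => (s : ℂ) * ψ s) r‖ ^ 2 / r) < ⊤
  fin_Lpsi : wInt (fun r => ‖Lop ψ r‖ ^ 2 * r) < ⊤
  fin_dLpsi : wInt (fun r => ‖dz (fun s => (s : ℂ) * Lop ψ s) r‖ ^ 2 / r) < ⊤
  fin_LLpsi : wInt (fun r => ‖Lop (Lop ψ) r‖ ^ 2 * r) < ⊤

open Set Topology

/-- Weighted inner product. -/
noncomputable def PP (u v : ℝ → ℂ) : ℝ := ∫ r in Set.Ioo (0:ℝ) 1, r * inner ℝ (u r) (v r)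

/-- Continuous and weighted square integrable. -/
def QQ (u : ℝ → ℂ) : Prop :=
  ContinuousOn u (Set.Ioo 0 1) ∧
    Integrable (fun r => r * ‖u r‖ ^ 2) (volume.restrict (Set.Ioo (0:ℝ) 1))

lemma QQ.inner {u v : ℝ → ℂ} (hu : QQ u) (hv : QQ v) :
    Integrable (fun r => r * inner ℝ (u r) (v r)) (volume.restrict (Set.Ioo (0:ℝ) 1)) := by
  refine Integrable.mono' (hu.2.add hv.2) ?_ ?_
  · refine ContinuousOn.aestronglyMeasurable ?_ measurableSet_Ioo
    exact continuousOn_id.mul (hu.1.inner hv.1)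
  · refine (ae_restrict_mem measurableSet_Ioo).mono fun r hr => ?_
    have h1 := abs_real_inner_le_norm (u r) (v r)
    have h0 : (0:ℝ) < r := hr.1
    simp only [Real.norm_eq_abs, abs_mul, abs_of_pos h0, Pi.add_apply]
    nlinarith [sq_nonneg (‖u r‖ - ‖v r‖), sq_nonneg (‖u r‖), sq_nonneg (‖v r‖)]

lemma QQ.add {u v : ℝ → ℂ} (hu : QQ u) (hv : QQ v) : QQ (fun r => u r + v r) := by
  refine ⟨hu.1.add hv.1, ?_⟩
  have := (hu.2.add ((hu.inner hv).const_mul 2)).add hv.2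
  refine this.congr (Filter.Eventually.of_forall fun r => ?_)
  simp only [Pi.add_apply, norm_add_sq_real]
  ring

lemma QQ.mul {u c : ℝ → ℂ} (M : ℝ) (hu : QQ u) (hc : ContinuousOn c (Set.Ioo 0 1))
    (hM : ∀ r ∈ Set.Ioo (0:ℝ) 1, ‖c r‖ ≤ M) : QQ (fun r => c r * u r) := by
  refine ⟨hc.mul hu.1, Integrable.mono' (hu.2.const_mul (M^2)) ?_ ?_⟩
  · refine ContinuousOn.aestronglyMeasurable ?_ measurableSet_Ioo
    exact continuousOn_id.mul ((hc.mul hu.1).norm.pow 2)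
  · refine (ae_restrict_mem measurableSet_Ioo).mono fun r hr => ?_
    have h0 : (0:ℝ) < r := hr.1
    rw [Real.norm_of_nonneg (by positivity), norm_mul]
    have : ‖c r‖^2 ≤ M^2 := pow_le_pow_left₀ (norm_nonneg _) (hM r hr) 2
    have := mul_le_mul_of_nonneg_right this (show 0 ≤ r * ‖u r‖^2 by positivity)
    linarith

lemma QQ.cmul {u : ℝ → ℂ} (c : ℂ) (hu : QQ u) : QQ (fun r => c * u r) :=
  hu.mul ‖c‖ continuousOn_const (fun _ _ => le_rfl)

lemma QQ.sub {u v : ℝ → ℂ} (hu : QQ u) (hv : QQ v) : QQ (fun r => u r - v r) := by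
  have := hu.add (hv.cmul (-1))
  simpa [sub_eq_add_neg] using this

lemma PP_congr {u v u' v' : ℝ → ℂ} (h : ∀ r ∈ Set.Ioo (0:ℝ) 1, u r = u' r)
    (h' : ∀ r ∈ Set.Ioo (0:ℝ) 1, v r = v' r) : PP u v = PP u' v' := by
  refine setIntegral_congr_fun measurableSet_Ioo fun r hr => ?_
  simp only [h r hr, h' r hr]

lemma PP_self_eq (u : ℝ → ℂ) : PP u u = ∫ r in Set.Ioo (0:ℝ) 1, r * ‖u r‖ ^ 2 := by
  simp only [PP, real_inner_self_eq_norm_sq]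

lemma PP_self_nonneg (u : ℝ → ℂ) : 0 ≤ PP u u := by
  rw [PP_self_eq]
  exact setIntegral_nonneg measurableSet_Ioo fun r hr => mul_nonneg hr.1.le (sq_nonneg _)

lemma PP_expand {u v : ℝ → ℂ} (hu : QQ u) (hv : QQ v) (N : ℝ) :
    PP (fun r => u r - (N:ℂ) * v r) (fun r => u r - (N:ℂ) * v r)
      = PP u u - 2 * N * PP u v + N ^ 2 * PP v v := by
  have hh : Integrable (fun r => r * inner ℝ (u r) (u r) - 2 * N * (r * inner ℝ (u r) (v r)))
      (volume.restrict (Set.Ioo (0:ℝ) 1)) := (hu.inner hu).sub ((hu.inner hv).const_mul _)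
  unfold PP
  rw [← integral_const_mul, ← integral_const_mul, ← integral_sub (hu.inner hu)
    ((hu.inner hv).const_mul _), ← integral_add hh ((hv.inner hv).const_mul _)]
  refine integral_congr_ae (Filter.Eventually.of_forall fun r => ?_)
  simp only [Complex.inner, Complex.mul_re, Complex.conj_re, Complex.conj_im, Complex.sub_re,
    Complex.sub_im, Complex.mul_im, Complex.ofReal_re, Complex.ofReal_im]
  ring

lemma ibp_core {F f : ℝ → ℝ} {A B : ℝ}
    (hd : ∀ r ∈ Set.Ioo (0:ℝ) 1, HasDerivAt F (f r) r)
    (hi : Integrable f (volume.restrict (Set.Ioo (0:ℝ) 1)))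
    (h0 : Tendsto F (𝓝[>] 0) (𝓝 A)) (h1 : Tendsto F (𝓝[<] 1) (𝓝 B)) :
    ∫ r in Set.Ioo (0:ℝ) 1, f r = B - A := by
  rw [← integral_Ioc_eq_integral_Ioo, ← intervalIntegral.integral_of_le zero_le_one]
  refine intervalIntegral.integral_eq_sub_of_hasDerivAt_of_tendsto zero_lt_one hd ?_ h0 h1
  rw [intervalIntegrable_iff_integrableOn_Ioo_of_le zero_le_one]
  exact hi

lemma ibp {a b c d : ℝ → ℂ} (ha : QQ a) (hb : QQ b) (hc : QQ c) (hd : QQ d)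
    (hda : ∀ r ∈ Set.Ioo (0:ℝ) 1, HasDerivAt a (c r - a r / r) r)
    (hdb : ∀ r ∈ Set.Ioo (0:ℝ) 1, HasDerivAt b (d r) r)
    (a0 : Tendsto a (𝓝[>] 0) (𝓝 0)) (a1 : Tendsto a (𝓝[<] 1) (𝓝 0))
    {L M : ℂ} (b0 : Tendsto (fun r : ℝ => (r:ℂ) * b r) (𝓝[>] 0) (𝓝 L))
    (b1 : Tendsto (fun r : ℝ => (r:ℂ) * b r) (𝓝[<] 1) (𝓝 M)) :
    PP c b + PP a d = 0 := by
  unfold PP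
  rw [← integral_add (hc.inner hb) (ha.inner hd)]
  have := ibp_core (F := fun r => inner ℝ (a r) ((r:ℂ) * b r))
    (f := fun r => r * inner ℝ (c r) (b r) + r * inner ℝ (a r) (d r)) (A := 0) (B := 0) ?_
    ((hc.inner hb).add (ha.inner hd)) ?_ ?_
  · simpa using this
  · intro r hr
    have hr0 : (r:ℝ) ≠ 0 := hr.1.ne'
    have h1 : HasDerivAt (fun r : ℝ => (r:ℂ) * b r) (1 * b r + r * d r) r :=
      (HasDerivAt.ofReal_comp (hasDerivAt_id r)).mul (hdb r hr)
    have := (hda r hr).inner ℝ h1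
    refine this.congr_deriv ?_
    have e : a r / r = ((r⁻¹ : ℝ) : ℂ) * a r := by
      push_cast; field_simp
    rw [e]
    simp only [Complex.inner, Complex.mul_re, Complex.conj_re, Complex.conj_im, Complex.sub_re,
      Complex.sub_im, Complex.mul_im, Complex.ofReal_re, Complex.ofReal_im, Complex.add_re,
      Complex.add_im, one_mul]
    field_simp
    ring
  · have := a0.inner (𝕜 := ℝ) b0
    rwa [inner_zero_left] at this
  · have := a1.inner (𝕜 := ℝ) b1
    rwa [inner_zero_left] at this

lemma young_c (m : ℝ) (hm : 0 < m) (x y : ℝ) : x * y ≤ m / 2 * x ^ 2 + 1 / (2 * m) * y ^ 2 := by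
  have : m / 2 * x ^ 2 + 1 / (2 * m) * y ^ 2 - x * y = (m * x - y) ^ 2 / (2 * m) := by
    field_simp; ring
  have h2 : 0 ≤ (m * x - y) ^ 2 / (2 * m) := by positivity
  linarith

/-- The energy estimates for `w`. -/
lemma energy {w k d f : ℝ → ℂ} {U : ℝ → ℝ} {n m N : ℝ} (hm : 0 < m)
    (hU : ∀ r ∈ Set.Ioo (0:ℝ) 1, m ≤ |n| * U r)
    (hw : QQ w) (hk : QQ k) (hd : QQ d) (hf : QQ f)
    (he : ∀ r ∈ Set.Ioo (0:ℝ) 1, d r = Complex.I * n * U r * w r + N * w r - f r)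
    (hdw : ∀ r ∈ Set.Ioo (0:ℝ) 1, HasDerivAt w (k r - w r / r) r)
    (hdk : ∀ r ∈ Set.Ioo (0:ℝ) 1, HasDerivAt k (d r) r)
    (a0 : Tendsto w (𝓝[>] 0) (𝓝 0)) (a1 : Tendsto w (𝓝[<] 1) (𝓝 0))
    {L M : ℂ} (b0 : Tendsto (fun r : ℝ => (r:ℂ) * k r) (𝓝[>] 0) (𝓝 L))
    (b1 : Tendsto (fun r : ℝ => (r:ℂ) * k r) (𝓝[<] 1) (𝓝 M)) :
    m ^ 2 * PP w w ≤ PP f f ∧ m * (PP k k + N * PP w w) ≤ PP f f := by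
  have C1 := ibp hw hk hk hd hdw hdk a0 a1 b0 b1
  have C2 := ibp (hw.cmul Complex.I) hk (hk.cmul Complex.I) hd
    (fun r hr => by
      have := (hdw r hr).const_mul Complex.I
      refine this.congr_deriv ?_
      ring) hdk
    (by simpa using a0.const_mul Complex.I) (by simpa using a1.const_mul Complex.I) b0 b1
  have z : PP (fun r => Complex.I * k r) k = 0 := by
    have : ∀ r, inner ℝ (Complex.I * k r) (k r) = 0 := by
      intro r
      simp only [Complex.inner, Complex.mul_re, Complex.conj_re, Complex.conj_im, Complex.mul_im,
        Complex.I_re, Complex.I_im]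
      ring
    simp [PP, this]
  rw [z, zero_add] at C2
  obtain ⟨s, hs, hsn⟩ : ∃ s : ℝ, |s| = 1 ∧ s * n = |n| := by
    rcases le_total 0 n with h | h
    · exact ⟨1, by simp, by rw [abs_of_nonneg h]; ring⟩
    · exact ⟨-1, by simp, by rw [abs_of_nonpos h]; ring⟩
  have i1 := (hw.cmul Complex.I).inner hd
  have E1 : (m / 2) * PP w w - 1 / (2 * m) * PP f f ≤ s * PP (fun r => Complex.I * w r) d := by
    unfold PP
    rw [← integral_const_mul, ← integral_const_mul, ← integral_const_mul,
      ← integral_sub ((hw.inner hw).const_mul _) ((hf.inner hf).const_mul _)]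
    refine setIntegral_mono_on (((hw.inner hw).const_mul _).sub ((hf.inner hf).const_mul _))
      (i1.const_mul _) measurableSet_Ioo fun r hr => ?_
    have e : inner ℝ (Complex.I * w r) (d r) = n * U r * ‖w r‖ ^ 2
        - inner ℝ (Complex.I * w r) (f r) := by
      rw [he r hr, ← real_inner_self_eq_norm_sq]
      simp only [Complex.inner, Complex.mul_re, Complex.conj_re, Complex.conj_im, Complex.sub_re,
        Complex.sub_im, Complex.mul_im, Complex.ofReal_re, Complex.ofReal_im, Complex.add_re,
        Complex.add_im, Complex.I_re, Complex.I_im]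
      ring
    rw [e, real_inner_self_eq_norm_sq, real_inner_self_eq_norm_sq]
    have h1 : s * inner ℝ (Complex.I * w r) (f r) ≤ ‖w r‖ * ‖f r‖ := by
      calc s * inner ℝ (Complex.I * w r) (f r) ≤ |s * inner ℝ (Complex.I * w r) (f r)| :=
            le_abs_self _
        _ = |inner ℝ (Complex.I * w r) (f r)| := by rw [abs_mul, hs, one_mul]
        _ ≤ ‖Complex.I * w r‖ * ‖f r‖ := abs_real_inner_le_norm _ _
        _ = _ := by simp
    have h2 := young_c m hm ‖w r‖ ‖f r‖
    have h3 := mul_le_mul_of_nonneg_right (hU r hr) (sq_nonneg ‖w r‖)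
    have h4 : m / 2 * ‖w r‖ ^ 2 - 1 / (2 * m) * ‖f r‖ ^ 2 ≤
        s * (n * U r * ‖w r‖ ^ 2 - inner ℝ (Complex.I * w r) (f r)) := by
      have : s * (n * U r * ‖w r‖ ^ 2) = |n| * U r * ‖w r‖ ^ 2 := by rw [← hsn]; ring
      rw [mul_sub, this]
      linarith
    have := mul_le_mul_of_nonneg_left h4 hr.1.le
    linarith
  have E2 : (N - m / 2) * PP w w - 1 / (2 * m) * PP f f ≤ PP w d := by
    unfold PP
    rw [← integral_const_mul, ← integral_const_mul,
      ← integral_sub ((hw.inner hw).const_mul _) ((hf.inner hf).const_mul _)]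
    refine setIntegral_mono_on (((hw.inner hw).const_mul _).sub ((hf.inner hf).const_mul _))
      (hw.inner hd) measurableSet_Ioo fun r hr => ?_
    have e : inner ℝ (w r) (d r) = N * ‖w r‖ ^ 2 - inner ℝ (w r) (f r) := by
      rw [he r hr, ← real_inner_self_eq_norm_sq]
      simp only [Complex.inner, Complex.mul_re, Complex.conj_re, Complex.conj_im, Complex.sub_re,
        Complex.sub_im, Complex.mul_im, Complex.ofReal_re, Complex.ofReal_im, Complex.add_re,
        Complex.add_im, Complex.I_re, Complex.I_im]
      ring
    rw [e, real_inner_self_eq_norm_sq, real_inner_self_eq_norm_sq]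
    have h1 := real_inner_le_norm (w r) (f r)
    have h2 := young_c m hm ‖w r‖ ‖f r‖
    have := mul_le_mul_of_nonneg_left (h1.trans h2) hr.1.le
    linarith
  rw [C2, mul_zero] at E1
  have c : m * (1 / (2 * m)) = 1 / 2 := by field_simp
  have E1' := mul_le_mul_of_nonneg_left E1 hm.le
  have E2' := mul_le_mul_of_nonneg_left E2 hm.le
  have r1 : m ^ 2 * PP w w ≤ PP f f := by
    have : m * (m / 2 * PP w w - 1 / (2 * m) * PP f f) = m ^ 2 / 2 * PP w w - 1 / 2 * PP f f := by
      rw [← c]; ring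
    linarith
  refine ⟨r1, ?_⟩
  have : m * ((N - m / 2) * PP w w - 1 / (2 * m) * PP f f)
      = m * (N * PP w w) - (m ^ 2 / 2 * PP w w + 1 / 2 * PP f f) := by
    rw [← c]; ring
  have : PP w d = - PP k k := by linarith
  nlinarith

/-- trace estimate -/
lemma trace_est {g φ : ℝ → ℂ} (hg : QQ g) (hφ : QQ φ) {M : ℂ}
    (hdg : ∀ r ∈ Set.Ioo (0:ℝ) 1, HasDerivAt g (φ r) r)
    (b0 : Tendsto (fun r : ℝ => (r:ℂ) * g r) (𝓝[>] 0) (𝓝 0))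
    (b1 : Tendsto (fun r : ℝ => (r:ℂ) * g r) (𝓝[<] 1) (𝓝 M)) :
    ‖M‖ ^ 2 ≤ 3 * PP g g + PP φ φ := by
  have hr' : QQ (fun r => (r:ℂ) * g r) := hg.mul 1 (by fun_prop) (fun r hr => by
    rw [Complex.norm_real, Real.norm_of_nonneg hr.1.le]; exact hr.2.le)
  have hi := ((hg.inner hg).const_mul 2).add ((hr'.inner hφ).const_mul 2)
  have := ibp_core (F := fun r => inner ℝ ((r:ℂ) * g r) ((r:ℂ) * g r))
    (f := fun r => 2 * (r * inner ℝ (g r) (g r)) + 2 * (r * inner ℝ ((r:ℂ) * g r) (φ r)))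
    (A := 0) (B := ‖M‖ ^ 2) ?_ hi ?_ ?_
  · rw [sub_zero] at this
    rw [← this]
    unfold PP
    rw [← integral_const_mul, ← integral_add ((hg.inner hg).const_mul _) (hφ.inner hφ)]
    refine setIntegral_mono_on hi (((hg.inner hg).const_mul _).add (hφ.inner hφ))
      measurableSet_Ioo fun r hr => ?_
    rw [real_inner_self_eq_norm_sq, real_inner_self_eq_norm_sq]
    have h1 := real_inner_le_norm ((r:ℂ) * g r) (φ r)
    rw [norm_mul, Complex.norm_real, Real.norm_of_nonneg hr.1.le] at h1
    have h2 : r * ‖g r‖ ≤ ‖g r‖ := mul_le_of_le_one_left (norm_nonneg _) hr.2.le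
    have h3 := mul_le_mul_of_nonneg_right h2 (norm_nonneg (φ r))
    have h4 : 2 * inner ℝ ((r:ℂ) * g r) (φ r) ≤ ‖g r‖ ^ 2 + ‖φ r‖ ^ 2 := by
      nlinarith [sq_nonneg (‖g r‖ - ‖φ r‖)]
    have := mul_le_mul_of_nonneg_left h4 hr.1.le
    linarith
  · intro r hr
    have h1 : HasDerivAt (fun r : ℝ => (r:ℂ) * g r) (1 * g r + r * φ r) r :=
      (HasDerivAt.ofReal_comp (hasDerivAt_id r)).mul (hdg r hr)
    have := h1.inner ℝ h1
    refine this.congr_deriv ?_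
    simp only [Complex.inner, Complex.mul_re, Complex.conj_re, Complex.conj_im, Complex.mul_im,
      Complex.ofReal_re, Complex.ofReal_im, Complex.add_re,
      Complex.add_im, one_mul]
    ring
  · simpa using b0.inner (𝕜 := ℝ) b0
  · have := b1.inner (𝕜 := ℝ) b1
    rwa [real_inner_self_eq_norm_sq] at this

lemma wInt_eq_s16 {h : ℝ → ℝ} {u : ℝ → ℂ} (hu : QQ u)
    (e : ∀ r ∈ Set.Ioo (0:ℝ) 1, h r = r * ‖u r‖ ^ 2) : wInt h = ENNReal.ofReal (PP u u) := by
  rw [PP_self_eq, ofReal_integral_eq_lintegral_ofReal hu.2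
    ((ae_restrict_mem measurableSet_Ioo).mono fun r hr => mul_nonneg hr.1.le (sq_nonneg _))]
  exact setLIntegral_congr_fun measurableSet_Ioo fun r hr => by simp only [e r hr]

lemma QQ_of {h : ℝ → ℝ} {u : ℝ → ℂ} (hu : ContinuousOn u (Set.Ioo 0 1))
    (e : ∀ r ∈ Set.Ioo (0:ℝ) 1, h r = r * ‖u r‖ ^ 2) (hf : wInt h < ⊤) : QQ u := by
  refine ⟨hu, ?_, ?_⟩
  · refine ContinuousOn.aestronglyMeasurable ?_ measurableSet_Ioo
    exact continuousOn_id.mul (hu.norm.pow 2)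
  · rw [hasFiniteIntegral_iff_ofReal
      ((ae_restrict_mem measurableSet_Ioo).mono fun r hr => mul_nonneg hr.1.le (sq_nonneg _))]
    refine lt_of_eq_of_lt ?_ hf
    exact setLIntegral_congr_fun measurableSet_Ioo fun r hr => by simp only [e r hr]

/-- `G u = u' + u/r`. -/
noncomputable def GG (u : ℝ → ℂ) : ℝ → ℂ := fun r => dz u r + (r:ℂ)⁻¹ * u r

lemma dz_contDiffOn {u : ℝ → ℂ} {k l : ℕ} (hu : ContDiffOn ℝ k u (Set.Ioc 0 1)) (h : l + 1 ≤ k) :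
    ContDiffOn ℝ l (dz u) (Set.Ioc 0 1) :=
  hu.derivWithin (uniqueDiffOn_Ioc 0 1) (by exact_mod_cast h)

lemma inv_contDiffOn {k : ℕ} : ContDiffOn ℝ k (fun r : ℝ => (r:ℂ)⁻¹) (Set.Ioc 0 1) := by
  refine ContDiffOn.inv (Complex.ofRealCLM.contDiff.contDiffOn) ?_
  intro r hr
  exact_mod_cast hr.1.ne'

lemma Lop_contDiffOn {u : ℝ → ℂ} {k : ℕ} (hu : ContDiffOn ℝ (k+2 : ℕ) u (Set.Ioc 0 1)) :
    ContDiffOn ℝ k (Lop u) (Set.Ioc 0 1) := by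
  have h1 : ContDiffOn ℝ (k+1 : ℕ) (dz u) (Set.Ioc 0 1) := dz_contDiffOn hu le_rfl
  have h2 : ContDiffOn ℝ k (dz (dz u)) (Set.Ioc 0 1) := dz_contDiffOn h1 le_rfl
  have e : Lop u = fun r : ℝ =>
      dz (dz u) r + ((r : ℂ))⁻¹ * dz u r - ((r : ℂ))⁻¹ ^ 2 * u r := by
    funext r; simp [Lop]
  rw [e]
  exact (h2.add (inv_contDiffOn.mul (h1.of_le (by norm_cast; omega)))).sub
    ((inv_contDiffOn.pow 2).mul (hu.of_le (by norm_cast; omega)))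

lemma dz_hasDerivAt_s16 {u : ℝ → ℂ} (hu : ContDiffOn ℝ (1:ℕ) u (Set.Ioc 0 1)) :
    ∀ r ∈ Set.Ioo (0:ℝ) 1, HasDerivAt u (dz u r) r := by
  intro r hr
  have hd := (hu.differentiableOn (by norm_num)) r ⟨hr.1, hr.2.le⟩
  exact hd.hasDerivWithinAt.hasDerivAt (Ioc_mem_nhds hr.1 hr.2)

lemma GG_hasDerivAt {u : ℝ → ℂ} (hu : ContDiffOn ℝ (2:ℕ) u (Set.Ioc 0 1)) :
    ∀ r ∈ Set.Ioo (0:ℝ) 1, HasDerivAt (GG u) (Lop u r) r := by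
  intro r hr
  have h1 := dz_hasDerivAt_s16 (hu.of_le (by norm_num)) r hr
  have h2 := dz_hasDerivAt_s16 (dz_contDiffOn hu (l := 1) le_rfl) r hr
  have hr0 : (r:ℂ) ≠ 0 := by exact_mod_cast hr.1.ne'
  have h3 := (HasDerivAt.ofReal_comp (hasDerivAt_id r)).inv (by simpa using hr0)
  have := h2.add (h3.mul h1)
  refine (HasDerivAt.congr_deriv this ?_)
  simp [Lop]
  field_simp
  ring

lemma GG_hasDerivAt' {u : ℝ → ℂ} (hu : ContDiffOn ℝ (1:ℕ) u (Set.Ioc 0 1)) :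
    ∀ r ∈ Set.Ioo (0:ℝ) 1, HasDerivAt u (GG u r - u r / r) r := by
  intro r hr
  convert dz_hasDerivAt_s16 hu r hr using 1
  simp [GG, div_eq_mul_inv]; ring

lemma GG_cont {u : ℝ → ℂ} (hu : ContDiffOn ℝ (1:ℕ) u (Set.Ioc 0 1)) :
    ContinuousOn (GG u) (Set.Ioc 0 1) :=
  (dz_contDiffOn hu (l := 0) le_rfl).continuousOn.add
    ((inv_contDiffOn (k := 0)).continuousOn.mul hu.continuousOn)

lemma dz_rmul {u : ℝ → ℂ} (hu : ContDiffOn ℝ (1:ℕ) u (Set.Ioc 0 1)) :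
    ∀ r ∈ Set.Ioc (0:ℝ) 1, dz (fun s => (s:ℂ) * u s) r = r * GG u r := by
  intro r hr
  have hd := (hu.differentiableOn (by norm_num)) r hr
  have hr0 : (r:ℂ) ≠ 0 := by exact_mod_cast hr.1.ne'
  have h3 := (HasDerivAt.ofReal_comp (hasDerivAt_id r)).hasDerivWithinAt (s := Set.Ioc 0 1)
  have := (h3.mul hd.hasDerivWithinAt).derivWithin (uniqueDiffOn_Ioc 0 1 r hr)
  unfold dz GG
  refine Eq.trans this ?_
  simp [dz]
  field_simp
  ring

lemma lim_one {u : ℝ → ℂ} (hu : ContinuousOn u (Set.Ioc 0 1)) : Tendsto u (𝓝[<] 1) (𝓝 (u 1)) := by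
  have := hu 1 (by simp)
  rw [ContinuousWithinAt, nhdsWithin_Ioc_eq_nhdsLE zero_lt_one] at this
  exact this.mono_left (nhdsWithin_mono _ Iio_subset_Iic_self)

lemma GG_lin {n : ℂ} {u v : ℝ → ℂ} (hu : ContDiffOn ℝ (1:ℕ) u (Set.Ioc 0 1))
    (hv : ContDiffOn ℝ (1:ℕ) v (Set.Ioc 0 1)) :
    ∀ r ∈ Set.Ioo (0:ℝ) 1, GG (fun s => u s - n * v s) r = GG u r - n * GG v r := by
  intro r hr
  have h1 := (dz_hasDerivAt_s16 hu r hr).sub ((dz_hasDerivAt_s16 hv r hr).const_mul n)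
  have h2 := dz_hasDerivAt_s16 (hu.sub (contDiffOn_const.mul hv (f := fun _ => n))) r hr
  have h3 : dz (fun s => u s - n * v s) r = _ := h2.unique h1
  simp only [GG, h3]
  ring

/-- All real estimates. -/
lemma main_real_s16 {Φ α : ℝ} {n : ℤ} {f ψ : ℝ → ℂ} (hΦ : 0 < Φ) (hα : 0 ≤ α) (hn : n ≠ 0)
    (hfc : ContinuousOn f (Set.Ioo 0 1)) (hff : wInt (fun r => ‖f r‖ ^ 2 * r) < ⊤)
    (S : SlipSol Φ α n f ψ) :
    QQ f ∧ QQ ψ ∧ QQ (GG ψ) ∧ QQ (Lop ψ) ∧ QQ (GG (Lop ψ)) ∧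
    ∃ m : ℝ, 0 < m ∧ Φ * |(n:ℝ)| ≤ m * (4 + α) ∧
      m ^ 2 * (PP (Lop ψ) (Lop ψ) + 2 * (n:ℝ) ^ 2 * PP (GG ψ) (GG ψ) + (n:ℝ) ^ 4 * PP ψ ψ)
        ≤ PP f f ∧
      m * ((PP (GG (Lop ψ)) (GG (Lop ψ)) + 2 * (n:ℝ) ^ 2 * PP (Lop ψ) (Lop ψ)
          + (n:ℝ) ^ 4 * PP (GG ψ) (GG ψ)) + (n:ℝ) ^ 2 *
          (PP (Lop ψ) (Lop ψ) + 2 * (n:ℝ) ^ 2 * PP (GG ψ) (GG ψ) + (n:ℝ) ^ 4 * PP ψ ψ))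
        ≤ PP f f ∧
      ‖GG ψ 1‖ ^ 2 ≤ 3 * PP (GG ψ) (GG ψ) + PP (Lop ψ) (Lop ψ) := by
  have c4 : ContDiffOn ℝ (4:ℕ) ψ (Set.Ioc 0 1) := S.smooth
  have c2 : ContDiffOn ℝ (2:ℕ) (Lop ψ) (Set.Ioc 0 1) := Lop_contDiffOn c4
  have c1 : ContDiffOn ℝ (1:ℕ) ψ (Set.Ioc 0 1) := c4.of_le (by norm_num)
  have c2' : ContDiffOn ℝ (2:ℕ) ψ (Set.Ioc 0 1) := c4.of_le (by norm_num)
  have c1' : ContDiffOn ℝ (1:ℕ) (Lop ψ) (Set.Ioc 0 1) := c2.of_le (by norm_num)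
  have sub : Set.Ioo (0:ℝ) 1 ⊆ Set.Ioc 0 1 := Ioo_subset_Ioc_self
  have nz : nhdsWithin (0 : ℝ) (Set.Ioc 0 1) = 𝓝[>] 0 := nhdsWithin_Ioc_eq_nhdsGT zero_lt_one
  have key : ∀ (u : ℝ → ℂ), ContDiffOn ℝ (1:ℕ) u (Set.Ioc 0 1) → ∀ r ∈ Set.Ioo (0:ℝ) 1,
      ‖dz (fun s => (s:ℂ) * u s) r‖ ^ 2 / r = r * ‖GG u r‖ ^ 2 := by
    intro u hu r hr
    have : r ≠ 0 := hr.1.ne'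
    rw [dz_rmul hu r (sub hr), norm_mul, Complex.norm_real, Real.norm_of_nonneg hr.1.le]
    field_simp
  have qf : QQ f := QQ_of hfc (fun r _ => mul_comm _ _) hff
  have qψ : QQ ψ := QQ_of (c4.continuousOn.mono sub) (fun r _ => mul_comm _ _) S.fin_psi
  have qg : QQ (GG ψ) := QQ_of ((GG_cont c1).mono sub) (key ψ c1) S.fin_dpsi
  have qφ : QQ (Lop ψ) := QQ_of (c2.continuousOn.mono sub) (fun r _ => mul_comm _ _) S.fin_Lpsi
  have qh : QQ (GG (Lop ψ)) := QQ_of ((GG_cont c1').mono sub) (key _ c1') S.fin_dLpsi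
  refine ⟨qf, qψ, qg, qφ, qh, ?_⟩
  -- limits
  have lψ0 := S.ext_psi
  have lφ0 := S.ext_Lpsi
  obtain ⟨L1, hL1⟩ := S.ext_dpsi
  obtain ⟨L2, hL2⟩ := S.ext_dLpsi
  rw [nz] at lψ0 lφ0 hL1 hL2
  have lψ1 := lim_one c4.continuousOn
  have lφ1 := lim_one c2.continuousOn
  rw [S.bc_psi] at lψ1
  rw [S.bc_slip] at lφ1
  have ev : ∀ᶠ r : ℝ in 𝓝[>] 0, r ∈ Set.Ioc (0:ℝ) 1 := Ioc_mem_nhdsGT zero_lt_one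
  have lid : Tendsto (fun r : ℝ => (r:ℂ)) (𝓝[>] 0) (𝓝 0) := by
    have : Continuous (fun r : ℝ => (r:ℂ)) := Complex.continuous_ofReal
    simpa using (this.tendsto 0).mono_left nhdsWithin_le_nhds
  have lid1 : Tendsto (fun r : ℝ => (r:ℂ)) (𝓝[<] 1) (𝓝 1) := by
    have : Continuous (fun r : ℝ => (r:ℂ)) := Complex.continuous_ofReal
    simpa using (this.tendsto 1).mono_left nhdsWithin_le_nhds
  have lg0 : Tendsto (fun r : ℝ => (r:ℂ) * GG ψ r) (𝓝[>] 0) (𝓝 0) := by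
    have : Tendsto (fun r : ℝ => (r:ℂ) * dz ψ r + ψ r) (𝓝[>] 0) (𝓝 (0 * L1 + 0)) :=
      (lid.mul hL1).add lψ0
    rw [zero_mul, zero_add] at this
    refine this.congr' (ev.mono fun r hr => ?_)
    have hr0 : (r:ℂ) ≠ 0 := by exact_mod_cast hr.1.ne'
    simp only [GG]
    field_simp
  have lg1 : Tendsto (fun r : ℝ => (r:ℂ) * GG ψ r) (𝓝[<] 1) (𝓝 (GG ψ 1)) := by
    simpa using lid1.mul (lim_one (GG_cont c1))
  have lh0 : Tendsto (fun r : ℝ => (r:ℂ) * GG (Lop ψ) r) (𝓝[>] 0) (𝓝 L2) :=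
    hL2.congr' (ev.mono fun r hr => dz_rmul c1' r hr)
  have lh1 : Tendsto (fun r : ℝ => (r:ℂ) * GG (Lop ψ) r) (𝓝[<] 1) (𝓝 (GG (Lop ψ) 1)) := by
    simpa using lid1.mul (lim_one (GG_cont c1'))
  have A := ibp qψ qg qg qφ (GG_hasDerivAt' c1) (GG_hasDerivAt c2') lψ0 lψ1 lg0 lg1
  have B := ibp qφ qg qh qφ (GG_hasDerivAt' c1') (GG_hasDerivAt c2') lφ0 lφ1 lg0 lg1
  have T := trace_est qg qφ (GG_hasDerivAt c2') lg0 lg1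
  -- the function w
  set N : ℝ := (n:ℝ) ^ 2 with hN
  have hNC : (N:ℂ) = (n:ℂ) ^ 2 := by simp [hN]
  have cw : ContDiffOn ℝ (2:ℕ) (fun s => Lop ψ s - (N:ℂ) * ψ s) (Set.Ioc 0 1) :=
    c2.sub (contDiffOn_const.mul c2')
  have cw1 : ContDiffOn ℝ (1:ℕ) (fun s => Lop ψ s - (N:ℂ) * ψ s) (Set.Ioc 0 1) :=
    cw.of_le (by norm_num)
  have qw : QQ (fun s => Lop ψ s - (N:ℂ) * ψ s) := qφ.sub (qψ.cmul _)
  have ek := GG_lin (n := (N:ℂ)) c1' c1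
  have qk0 : QQ (fun s => GG (Lop ψ) s - (N:ℂ) * GG ψ s) := qh.sub (qg.cmul _)
  have lw0 : Tendsto (fun s => Lop ψ s - (N:ℂ) * ψ s) (𝓝[>] 0) (𝓝 0) := by
    simpa using lφ0.sub (lψ0.const_mul (N:ℂ))
  have lw1 : Tendsto (fun s => Lop ψ s - (N:ℂ) * ψ s) (𝓝[<] 1) (𝓝 0) := by
    simpa using lφ1.sub (lψ1.const_mul (N:ℂ))
  have lk0 : Tendsto (fun r : ℝ => (r:ℂ) * (GG (Lop ψ) r - (N:ℂ) * GG ψ r)) (𝓝[>] 0)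
      (𝓝 (L2 - (N:ℂ) * 0)) :=
    (lh0.sub (lg0.const_mul (N:ℂ))).congr fun r => by ring
  have lk1 : Tendsto (fun r : ℝ => (r:ℂ) * (GG (Lop ψ) r - (N:ℂ) * GG ψ r)) (𝓝[<] 1)
      (𝓝 (GG (Lop ψ) 1 - (N:ℂ) * GG ψ 1)) :=
    (lh1.sub (lg1.const_mul (N:ℂ))).congr fun r => by ring
  have hUc : Continuous (Ubar Φ α) := by unfold Ubar; fun_prop
  obtain ⟨MU, hMU⟩ := isCompact_Icc.exists_bound_of_continuousOn
    (s := Set.Icc (0:ℝ) 1) (f := Ubar Φ α) hUc.continuousOn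
  set d : ℝ → ℂ := fun r => Complex.I * ((n:ℝ):ℂ) * (Ubar Φ α r : ℂ) * (Lop ψ r - (N:ℂ) * ψ r)
    + (N:ℂ) * (Lop ψ r - (N:ℂ) * ψ r) - f r with hd
  have qd : QQ d := by
    refine QQ.sub (QQ.add (QQ.mul (‖(n:ℂ)‖ * MU) qw ?_ ?_) (qw.cmul _)) qf
    · have : Continuous fun r => (Ubar Φ α r : ℂ) := Complex.continuous_ofReal.comp hUc
      fun_prop
    · intro r hr
      have := hMU r ⟨hr.1.le, hr.2.le⟩
      rw [norm_mul, norm_mul, Complex.norm_I, one_mul, Complex.norm_real (Ubar Φ α r)]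
      push_cast
      gcongr
  have dk : ∀ r ∈ Set.Ioo (0:ℝ) 1,
      HasDerivAt (fun s => GG (Lop ψ) s - (N:ℂ) * GG ψ s) (d r) r := by
    intro r hr
    have h1 := GG_hasDerivAt cw r hr
    have h2 : HasDerivAt (fun s => GG (Lop ψ) s - (N:ℂ) * GG ψ s)
        (Lop (fun s => Lop ψ s - (N:ℂ) * ψ s) r) r := by
      refine h1.congr_of_eventuallyEq ?_
      filter_upwards [Ioo_mem_nhds hr.1 hr.2] with s hs
      exact (ek s hs).symm
    refine h2.congr_deriv ?_
    have := S.eqn r hr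
    rw [← hNC] at this
    simp only [hd]
    rw [← this]
    push_cast
    ring
  have dw : ∀ r ∈ Set.Ioo (0:ℝ) 1, HasDerivAt (fun s => Lop ψ s - (N:ℂ) * ψ s)
      ((GG (Lop ψ) r - (N:ℂ) * GG ψ r) - (Lop ψ r - (N:ℂ) * ψ r) / r) r := by
    intro r hr
    rw [← ek r hr]
    exact GG_hasDerivAt' cw1 r hr
  have hn0 : 0 < |(n:ℝ)| := abs_pos.mpr (by exact_mod_cast hn)
  have hm : 0 < Φ * |(n:ℝ)| / (4 + α) := by positivity
  have hU : ∀ r ∈ Set.Ioo (0:ℝ) 1, Φ * |(n:ℝ)| / (4 + α) ≤ |(n:ℝ)| * Ubar Φ α r := by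
    intro r hr
    have e : |(n:ℝ)| * Ubar Φ α r
        = Φ * |(n:ℝ)| / (4 + α) * ((4 + 2 * α * (1 - r ^ 2)) / Real.pi) := by
      have := Real.pi_pos
      unfold Ubar
      field_simp
      ring
    rw [e]
    refine le_mul_of_one_le_right hm.le ?_
    rw [one_le_div Real.pi_pos]
    have : r ^ 2 ≤ 1 := by nlinarith [hr.1, hr.2]
    have : 0 ≤ 2 * α * (1 - r ^ 2) := by
      have : 0 ≤ 1 - r ^ 2 := by linarith
      positivity
    linarith [Real.pi_le_four]
  obtain ⟨E1, E2⟩ := energy (N := N) (n := (n:ℝ)) (U := Ubar Φ α) hm hU qw qk0 qd qf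
    (fun r hr => rfl) dw dk lw0 lw1 lk0 lk1
  have comm : ∀ u v : ℝ → ℂ, PP u v = PP v u := by
    intro u v; simp only [PP, real_inner_comm]
  have X1 := PP_expand qφ qψ N
  have X2 := PP_expand qh qg N
  have A' : PP (Lop ψ) ψ = - PP (GG ψ) (GG ψ) := by rw [comm]; linarith
  have B' : PP (GG (Lop ψ)) (GG ψ) = - PP (Lop ψ) (Lop ψ) := by linarith
  have n4 : (n:ℝ) ^ 4 = N ^ 2 := by rw [hN]; ring
  rw [X1, A'] at E1 E2
  rw [X2, B'] at E2
  refine ⟨_, hm, le_of_eq (by field_simp), ?_, ?_, T⟩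
  · rw [n4]; convert E1 using 2; ring
  · rw [n4]; convert E2 using 2; ring

/-- Lemma 3.5 (propslip): a priori estimates for the auxiliary slip problem,
uniform in `Φ > 0`, `α ≥ 0`, `n ≠ 0` and `f`. -/
theorem slip_apriori_estimates :
    ∃ C : ℝ, 0 < C ∧ ∀ (Φ α : ℝ) (n : ℤ) (f ψ : ℝ → ℂ),
      0 < Φ → 0 ≤ α → n ≠ 0 →
      ContinuousOn f (Set.Ioo 0 1) → wInt (fun r => ‖f r‖ ^ 2 * r) < ⊤ →
      SlipSol Φ α n f ψ →
      (wInt (fun r => ‖dz (fun s => (s : ℂ) * ψ s) r‖ ^ 2 / r)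
          + ENNReal.ofReal ((n : ℝ) ^ 2) * wInt (fun r => ‖ψ r‖ ^ 2 * r)
        ≤ ENNReal.ofReal (C * (4 + α) ^ 2 / (Φ * |(n : ℝ)|) ^ 2)
            * wInt (fun r => ‖f r‖ ^ 2 * r)) ∧
      (wInt (fun r => ‖Lop ψ r‖ ^ 2 * r)
          + ENNReal.ofReal ((n : ℝ) ^ 2)
              * wInt (fun r => ‖dz (fun s => (s : ℂ) * ψ s) r‖ ^ 2 / r)
          + ENNReal.ofReal ((n : ℝ) ^ 4) * wInt (fun r => ‖ψ r‖ ^ 2 * r)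
        ≤ ENNReal.ofReal (C * (4 + α) ^ 2 / (Φ * |(n : ℝ)|) ^ 2)
            * wInt (fun r => ‖f r‖ ^ 2 * r)) ∧
      (wInt (fun r => ‖dz (fun s => (s : ℂ) * Lop ψ s) r‖ ^ 2 / r)
          + ENNReal.ofReal ((n : ℝ) ^ 2) * wInt (fun r => ‖Lop ψ r‖ ^ 2 * r)
          + ENNReal.ofReal ((n : ℝ) ^ 4)
              * wInt (fun r => ‖dz (fun s => (s : ℂ) * ψ s) r‖ ^ 2 / r)
          + ENNReal.ofReal ((n : ℝ) ^ 6) * wInt (fun r => ‖ψ r‖ ^ 2 * r)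
        ≤ ENNReal.ofReal (C * (4 + α) / (Φ * |(n : ℝ)|))
            * wInt (fun r => ‖f r‖ ^ 2 * r)) ∧
      (ENNReal.ofReal ‖dz (fun s => (s : ℂ) * ψ s) 1‖
        ≤ ENNReal.ofReal (C * (4 + α) / (Φ * |(n : ℝ)|))
            * (wInt (fun r => ‖f r‖ ^ 2 * r)) ^ ((1 : ℝ) / 2)) := by
  refine ⟨2, by norm_num, ?_⟩
  intro Φ α n f ψ hΦ hα hn hfc hff S
  obtain ⟨qf, qψ, qg, qφ, qh, m, hm, hmle, H1, H2, H3⟩ := main_real_s16 hΦ hα hn hfc hff S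
  have c4 : ContDiffOn ℝ (4:ℕ) ψ (Set.Ioc 0 1) := S.smooth
  have c2 : ContDiffOn ℝ (2:ℕ) (Lop ψ) (Set.Ioc 0 1) := Lop_contDiffOn c4
  have c1 : ContDiffOn ℝ (1:ℕ) ψ (Set.Ioc 0 1) := c4.of_le (by norm_num)
  have c1' : ContDiffOn ℝ (1:ℕ) (Lop ψ) (Set.Ioc 0 1) := c2.of_le (by norm_num)
  have key : ∀ (u : ℝ → ℂ), ContDiffOn ℝ (1:ℕ) u (Set.Ioc 0 1) → ∀ r ∈ Set.Ioo (0:ℝ) 1,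
      ‖dz (fun s => (s:ℂ) * u s) r‖ ^ 2 / r = r * ‖GG u r‖ ^ 2 := by
    intro u hu r hr
    have : r ≠ 0 := hr.1.ne'
    rw [dz_rmul hu r ⟨hr.1, hr.2.le⟩, norm_mul, Complex.norm_real, Real.norm_of_nonneg hr.1.le]
    field_simp
  have hn0 : 0 < |(n:ℝ)| := abs_pos.mpr (by exact_mod_cast hn)
  have hn1 : 1 ≤ (n:ℝ) ^ 2 := by
    have : 1 ≤ n ^ 2 := by
      have := sq_nonneg n
      have : n ^ 2 ≠ 0 := pow_ne_zero 2 hn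
      omega
    exact_mod_cast this
  have hy : 0 < Φ * |(n:ℝ)| := by positivity
  set K : ℝ := (4 + α) / (Φ * |(n:ℝ)|) with hK
  have hKpos : 0 < K := by positivity
  have hmK : 1 ≤ m * K := by
    rw [hK, ← mul_div_assoc, one_le_div hy]; exact hmle
  have k1 : 2 * (4 + α) / (Φ * |(n:ℝ)|) = 2 * K := by rw [hK]; ring
  have k2 : 2 * (4 + α) ^ 2 / (Φ * |(n:ℝ)|) ^ 2 = 2 * K ^ 2 := by rw [hK]; field_simp
  have p1 := PP_self_nonneg ψ
  have p2 := PP_self_nonneg (GG ψ)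
  have p3 := PP_self_nonneg (Lop ψ)
  have p4 := PP_self_nonneg (GG (Lop ψ))
  have p5 := PP_self_nonneg f
  have step1 : ∀ X F : ℝ, 0 ≤ X → m * X ≤ F → X ≤ K * F := by
    intro X F hX h
    calc X = 1 * X := (one_mul X).symm
      _ ≤ (m * K) * X := mul_le_mul_of_nonneg_right hmK hX
      _ = K * (m * X) := by ring
      _ ≤ K * F := mul_le_mul_of_nonneg_left h hKpos.le
  set a := PP ψ ψ
  set b := PP (GG ψ) (GG ψ)
  set c := PP (Lop ψ) (Lop ψ)
  set e := PP (GG (Lop ψ)) (GG (Lop ψ))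
  set F := PP f f
  have n2 : 0 ≤ (n:ℝ) ^ 2 := by positivity
  have n4 : 0 ≤ (n:ℝ) ^ 4 := by positivity
  have n6 : 0 ≤ (n:ℝ) ^ 6 := by positivity
  have H1' : c + 2 * (n:ℝ) ^ 2 * b + (n:ℝ) ^ 4 * a ≤ K ^ 2 * F := by
    have h0 : 0 ≤ c + 2 * (n:ℝ) ^ 2 * b + (n:ℝ) ^ 4 * a := by positivity
    have h1 := step1 (m * (c + 2 * (n:ℝ) ^ 2 * b + (n:ℝ) ^ 4 * a)) F (by positivity)
      (le_trans (le_of_eq (by ring)) H1)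
    exact (step1 _ _ h0 h1).trans (le_of_eq (by ring))
  have H2' := step1 _ _ (by positivity) H2
  have b2 : 0 ≤ (n:ℝ) ^ 2 * b := by positivity
  have c2' : 0 ≤ (n:ℝ) ^ 2 * c := by positivity
  have b4 : 0 ≤ (n:ℝ) ^ 4 * b := by positivity
  have a4 : 0 ≤ (n:ℝ) ^ 4 * a := by positivity
  have KF : 0 ≤ K ^ 2 * F := by positivity
  have KF' : 0 ≤ K * F := by positivity
  have bb : b ≤ (n:ℝ) ^ 2 * b := le_mul_of_one_le_left p2 hn1
  have aa : (n:ℝ) ^ 2 * a ≤ (n:ℝ) ^ 4 * a := by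
    have := le_mul_of_one_le_left (show 0 ≤ (n:ℝ) ^ 2 * a by positivity) hn1
    linarith
  rw [wInt_eq_s16 qf (h := fun r => ‖f r‖ ^ 2 * r) (fun r _ => mul_comm _ _),
    wInt_eq_s16 qψ (h := fun r => ‖ψ r‖ ^ 2 * r) (fun r _ => mul_comm _ _),
    wInt_eq_s16 qφ (h := fun r => ‖Lop ψ r‖ ^ 2 * r) (fun r _ => mul_comm _ _),
    wInt_eq_s16 qg (key ψ c1), wInt_eq_s16 qh (key _ c1'), k1, k2]
  refine ⟨?_, ?_, ?_, ?_⟩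
  · rw [← ENNReal.ofReal_mul n2, ← ENNReal.ofReal_add (by positivity) (by positivity),
      ← ENNReal.ofReal_mul (by positivity)]
    refine ENNReal.ofReal_le_ofReal ?_
    linarith
  · rw [← ENNReal.ofReal_mul n2, ← ENNReal.ofReal_mul n4,
      ← ENNReal.ofReal_add (by positivity) (by positivity),
      ← ENNReal.ofReal_add (by positivity) (by positivity),
      ← ENNReal.ofReal_mul (by positivity)]
    refine ENNReal.ofReal_le_ofReal ?_
    linarith
  · rw [← ENNReal.ofReal_mul n2, ← ENNReal.ofReal_mul n4, ← ENNReal.ofReal_mul n6,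
      ← ENNReal.ofReal_add (by positivity) (by positivity),
      ← ENNReal.ofReal_add (by positivity) (by positivity),
      ← ENNReal.ofReal_add (by positivity) (by positivity),
      ← ENNReal.ofReal_mul (by positivity)]
    refine ENNReal.ofReal_le_ofReal ?_
    linarith
  · rw [ENNReal.ofReal_rpow_of_nonneg p5 (by norm_num), ← ENNReal.ofReal_mul (by positivity),
      ← Real.sqrt_eq_rpow, dz_rmul c1 1 (by simp)]
    refine ENNReal.ofReal_le_ofReal ?_
    simp only [Complex.ofReal_one, one_mul]
    refine abs_le_of_sq_le_sq' ?_ (by positivity) |>.2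
    rw [mul_pow, Real.sq_sqrt p5]
    linarith
end
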